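/- Let n ≥ 5 and let N be a group of order n!. Suppose there exist a group homomorphism f : Sₙ → Aut(N) and a bijective map g : Sₙ → N satisfying g(στ) = g(σ) · f(σ)(g(τ)) for all σ, τ ∈ Sₙ. Then N contains a subgroup isomorphic to the alternating group Aₙ. -/

import Mathlib

set_option linter.all false

namespace SP

section tk
variable {A : Type*} [Group A]

abbrev NN (Q : Subgroup A) : Subgroup A := Subgroup.normalizer (Q : Set A)
abbrev CC (x : A) : Subgroup A := Subgroup.centralizer {x}
abbrev CS (Q : Subgroup A) : Subgroup A := Subgroup.centralizer (Q : Set A)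

lemma mem_CC {x y : A} : y ∈ CC x ↔ y * x = x * y := Subgroup.mem_centralizer_singleton_iff

lemma mem_CS {Q : Subgroup A} {y : A} : y ∈ CS Q ↔ ∀ x ∈ Q, y * x = x * y := by
  rw [Subgroup.mem_centralizer_iff]
  exact ⟨fun h x hx => (h x hx).symm, fun h x hx => (h x hx).symm⟩

lemma nm_conj {Q : Subgroup A} {b x : A} (hb : b ∈ NN Q) (hx : x ∈ Q) : b * x * b⁻¹ ∈ Q :=
  (Subgroup.mem_normalizer_iff.1 hb x).1 hx

lemma nm_conj' {Q : Subgroup A} {b x : A} (hb : b ∈ NN Q) (hx : x ∈ Q) : b⁻¹ * x * b ∈ Q := by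
  have := nm_conj (inv_mem hb) hx
  simpa using this

variable [Finite A]

lemma mem_nm {Q : Subgroup A} {b : A} (h : ∀ x ∈ Q, b * x * b⁻¹ ∈ Q) : b ∈ NN Q := by
  rw [Subgroup.mem_normalizer_iff]
  have hinj : Function.Injective (fun x : Q => (⟨b * x * b⁻¹, h x x.2⟩ : Q)) := by
    intro x y hxy
    simp only [Subtype.mk.injEq] at hxy
    exact Subtype.ext (by simpa using hxy)
  have hs := Finite.surjective_of_injective hinj
  intro x
  refine ⟨h x, fun hx => ?_⟩
  obtain ⟨y, hy⟩ := hs ⟨_, hx⟩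
  simp only [Subtype.mk.injEq] at hy
  have : (y : A) = x := by simpa using hy
  exact this ▸ y.2

lemma le_NN (Q : Subgroup A) : Q ≤ NN Q := Subgroup.le_normalizer

lemma CS_le_NN (Q : Subgroup A) : CS Q ≤ NN Q := by
  intro b hb
  apply mem_nm
  intro x hx
  rw [mem_CS.1 hb x hx]; simpa using hx

lemma fixed_point {X : Type*} [Finite X] {p : ℕ} (hp : p.Prime) (φ : X → X)
    (h : ∀ x, φ^[p] x = x) (hc : ¬ p ∣ Nat.card X) : ∃ x, φ x = x := by
  classical
  haveI := Fact.mk hp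
  haveI := Fintype.ofFinite X
  have hb : Function.Bijective φ := by
    have h1 : φ^[p] = id := funext h
    obtain ⟨k, rfl⟩ : ∃ k, p = k + 1 := ⟨p - 1, by have := hp.pos; omega⟩
    refine ⟨?_, ?_⟩
    · rw [Function.iterate_succ] at h1
      exact Function.Injective.of_comp (f := φ^[k]) (h1 ▸ Function.injective_id)
    · rw [Function.iterate_succ'] at h1
      exact Function.Surjective.of_comp (g := φ^[k]) (h1 ▸ Function.surjective_id)
  have := Equiv.Perm.exists_fixed_point_of_prime (p := p) (n := 1) (α := X)
    (by rwa [Nat.card_eq_fintype_card] at hc) (σ := Equiv.ofBijective φ hb) (by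
      ext x
      rw [pow_one]
      have : ⇑((Equiv.ofBijective φ hb) ^ p) = φ^[p] := by
        rw [Equiv.Perm.coe_pow] <;> rfl
      rw [this, h]; rfl)
  simpa using this

/-- power trick -/
lemma LA {p : ℕ} (hp : p.Prime) {K : Subgroup A} (hK : ¬ p ∣ Nat.card K) {y : A}
    (hy : y ^ p ∈ K) : ∃ k : ℕ, (y ^ k) ^ p = 1 ∧ k % p = 1 := by
  have hcop : Nat.Coprime (Nat.card K) p := ((Nat.Prime.coprime_iff_not_dvd hp).2 hK).symm
  obtain ⟨m, -, hm⟩ := Nat.exists_mul_mod_eq_one_of_coprime hcop hp.one_lt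
  refine ⟨Nat.card K * m, ?_, hm⟩
  rw [← pow_mul, mul_comm, pow_mul, pow_mul]
  have : (⟨y ^ p, hy⟩ : K) ^ Nat.card K = 1 := pow_card_eq_one'
  have h2 : (y ^ p) ^ Nat.card K = 1 := congrArg Subtype.val this
  rw [h2, one_pow]

lemma pow_mod {p k : ℕ} {s : A} (hs : s ^ p = 1) (hk : k % p = 1) : s ^ k = s := by
  rw [← Nat.div_add_mod k p, hk, pow_add, pow_mul, hs, one_pow, one_mul, pow_one]

lemma LB {p : ℕ} (hp : p.Prime) {K : Subgroup A} (hK : ¬ p ∣ Nat.card K) {c c' : A}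
    (hc : c ∈ NN K) (hcp : c ^ p = 1) (hcp' : c' ^ p = 1) (hcc : c' * c⁻¹ ∈ K) :
    ∃ m ∈ K, c' = m * c * m⁻¹ := by
  have hmem : ∀ x : K, c' * x * c⁻¹ ∈ K := by
    intro x
    have := K.mul_mem hcc (nm_conj hc x.2)
    convert this using 1; group
  obtain ⟨x, hx⟩ := fixed_point hp (fun x : K => (⟨c' * x * c⁻¹, hmem x⟩ : K)) (by
    intro x
    have : ∀ k : ℕ, (((fun x : K => (⟨c' * x * c⁻¹, hmem x⟩ : K))^[k] x : K) : A)
        = c' ^ k * x * (c ^ k)⁻¹ := by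
      intro k
      induction k with
      | zero => simp
      | succ k ih =>
        rw [Function.iterate_succ_apply']
        simp only [ih]
        rw [pow_succ', pow_succ']; group
    apply Subtype.ext
    rw [this, hcp, hcp']; simp) hK
  refine ⟨x, x.2, ?_⟩
  have h1 : c' * x * c⁻¹ = (x : A) := congrArg Subtype.val hx
  calc c' = (c' * x * c⁻¹) * c * (x : A)⁻¹ := by group
    _ = _ := by rw [h1]

/-- coset fixed point: `c` normalises `K`, `x⁻¹ c x c⁻¹ ∈ K`, gives an element of `xK` fixed by `c` -/
lemma LC {p : ℕ} (hp : p.Prime) {K : Subgroup A} (hK : ¬ p ∣ Nat.card K) {c x : A}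
    (hc : c ∈ NN K) (hcp : c ^ p = 1) (hx : x⁻¹ * c * x * c⁻¹ ∈ K) :
    ∃ y ∈ K, (x * y) * c = c * (x * y) := by
  obtain ⟨m, hm, h⟩ := LB hp hK hc hcp (c' := x⁻¹ * c * x) (by
    have : x⁻¹ * c * x = x⁻¹ * c * (x⁻¹)⁻¹ := by simp
    rw [this, conj_pow, hcp]; simp) hx
  refine ⟨m, hm, ?_⟩
  have : c = x * (x⁻¹ * c * x) * x⁻¹ := by group
  rw [h] at this
  calc x * m * c = (x * (m * c * m⁻¹) * x⁻¹) * (x * m) := by group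
    _ = _ := by rw [← this]

/-- Sylow predicates inside subgroups -/
def IsSyl (q : ℕ) (H Q : Subgroup A) : Prop :=
  Q ≤ H ∧ Nat.card Q = q ^ (Nat.card H).factorization q

lemma IsSyl.le {q : ℕ} {H Q : Subgroup A} (h : IsSyl q H Q) : Q ≤ H := h.1

lemma IsSyl.isPGroup {q : ℕ} {H Q : Subgroup A} (h : IsSyl q H Q) : IsPGroup q Q :=
  IsPGroup.of_card h.2

lemma isSyl_iff {q : ℕ} [Fact q.Prime] {H Q : Subgroup A} :
    IsSyl q H Q ↔ ∃ P : Sylow q H, (P : Subgroup H).map H.subtype = Q := by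
  constructor
  · rintro ⟨h1, h2⟩
    have hc : Nat.card (Q.subgroupOf H) = q ^ (Nat.card H).factorization q := by
      rw [← h2]; exact Nat.card_congr (Subgroup.subgroupOfEquivOfLe h1).toEquiv
    refine ⟨Sylow.ofCard _ hc, ?_⟩
    rw [Sylow.coe_ofCard, Subgroup.subgroupOf_map_subtype]; simpa using h1
  · rintro ⟨P, rfl⟩
    refine ⟨Subgroup.map_subtype_le _, ?_⟩
    rw [← P.card_eq_multiplicity]
    exact (Nat.card_congr ((P : Subgroup H).equivMapOfInjective _ H.subtype_injective).toEquiv).symm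

lemma exists_isSyl (q : ℕ) [Fact q.Prime] (H : Subgroup A) : ∃ Q, IsSyl q H Q :=
  ⟨_, isSyl_iff.2 ⟨(default : Sylow q H), rfl⟩⟩

lemma exists_isSyl_ge {q : ℕ} [Fact q.Prime] {H R : Subgroup A} (hR : R ≤ H) (hq : IsPGroup q R) :
    ∃ Q, IsSyl q H Q ∧ R ≤ Q := by
  have : IsPGroup q (R.subgroupOf H) := by
    refine IsPGroup.of_injective hq (Subgroup.subgroupOfEquivOfLe hR).toMonoidHom
      (Subgroup.subgroupOfEquivOfLe hR).injective
  obtain ⟨P, hP⟩ := this.exists_le_sylow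
  refine ⟨_, isSyl_iff.2 ⟨P, rfl⟩, ?_⟩
  intro x hx
  exact ⟨⟨x, hR hx⟩, hP (by simpa [Subgroup.mem_subgroupOf] using hx), rfl⟩

lemma isSyl_conj {q : ℕ} [Fact q.Prime] {H Q Q' : Subgroup A} (h : IsSyl q H Q)
    (h' : IsSyl q H Q') : ∃ m ∈ H, ∀ x, x ∈ Q' ↔ m⁻¹ * x * m ∈ Q := by
  obtain ⟨P, rfl⟩ := isSyl_iff.1 h
  obtain ⟨P', rfl⟩ := isSyl_iff.1 h'
  obtain ⟨m, hm⟩ := MulAction.exists_smul_eq H P P'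
  refine ⟨m, m.2, fun x => ?_⟩
  rw [← hm]
  constructor
  · rintro ⟨y, hy, rfl⟩
    rw [SetLike.mem_coe, Sylow.coe_subgroup_smul, Subgroup.mem_pointwise_smul_iff_inv_smul_mem] at hy
    refine ⟨_, hy, ?_⟩
    simp [MulAut.smul_def]
  · rintro ⟨y, hy, hyx⟩
    refine ⟨m * y * m⁻¹, ?_, ?_⟩
    · rw [SetLike.mem_coe, Sylow.coe_subgroup_smul, Subgroup.mem_pointwise_smul_iff_inv_smul_mem]
      have hy2 : y ∈ (P : Subgroup H) := hy
      have e : (MulAut.conj m)⁻¹ • (m * y * m⁻¹) = y := by simp [MulAut.smul_def, mul_assoc]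
      rw [e]; exact hy2
    · simp only [Subgroup.subtype_apply] at hyx
      simp [hyx, mul_assoc]

/-- conjugate subgroup -/
def cj (b : A) (Q : Subgroup A) : Subgroup A := Q.map (MulAut.conj b).toMonoidHom

lemma mem_cj {b x : A} {Q : Subgroup A} : x ∈ cj b Q ↔ b⁻¹ * x * b ∈ Q := by
  constructor
  · rintro ⟨y, hy, rfl⟩
    simpa [mul_assoc] using hy
  · intro h
    exact ⟨_, h, by simp [mul_assoc]⟩

lemma card_cj (b : A) (Q : Subgroup A) : Nat.card (cj b Q) = Nat.card Q :=
  (Nat.card_congr (Q.equivMapOfInjective _ (MulAut.conj b).injective).toEquiv).symm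

lemma conj_mem_cj {b x : A} {Q : Subgroup A} (h : x ∈ Q) : b * x * b⁻¹ ∈ cj b Q := by
  rw [mem_cj]; simpa [mul_assoc] using h

lemma isSyl_cj {q : ℕ} {H Q : Subgroup A} (h : IsSyl q H Q) {b : A} (hb : b ∈ NN H) :
    IsSyl q H (cj b Q) := by
  refine ⟨?_, by rw [card_cj, h.2]⟩
  intro x hx
  rw [mem_cj] at hx
  have := nm_conj hb (h.1 hx)
  simpa [mul_assoc] using this

lemma frattini {q : ℕ} [Fact q.Prime] {H Q : Subgroup A} (h : IsSyl q H Q) {b : A}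
    (hb : b ∈ NN H) : ∃ m ∈ H, m * b ∈ NN Q := by
  obtain ⟨m, hm, hx⟩ := isSyl_conj (isSyl_cj h hb) h
  refine ⟨m, hm, mem_nm fun x hxQ => ?_⟩
  rw [hx, mem_cj]
  have : b⁻¹ * (m⁻¹ * (m * b * x * (m * b)⁻¹) * m) * b = x := by group
  rwa [this]

lemma isSyl_fixed {p q : ℕ} (hp : p.Prime) [Fact q.Prime] {H : Subgroup A} {c : A} (hcp : c ^ p = 1)
    (hc : c ∈ NN H) (hH : ¬ p ∣ Nat.card H) : ∃ Q, IsSyl q H Q ∧ c ∈ NN Q := by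
  obtain ⟨Q, hQ⟩ := exists_isSyl q H
  obtain ⟨m, hm, hmc⟩ := frattini hQ hc
  have hmod : ∀ k : ℕ, (m * c) ^ k * (c ^ k)⁻¹ ∈ H := by
    intro k
    induction k with
    | zero => simp
    | succ k ih =>
      have : (m * c) ^ (k+1) * (c ^ (k+1))⁻¹ = m * (c * ((m * c) ^ k * (c ^ k)⁻¹) * c⁻¹) := by
        rw [pow_succ', pow_succ']; group
      rw [this]
      exact H.mul_mem hm (nm_conj hc ih)
  obtain ⟨k, hk1, hk2⟩ := LA hp hH (y := m * c) (by simpa [hcp] using hmod p)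
  have := hmod k
  rw [pow_mod hcp hk2] at this
  obtain ⟨x, hx, hxc⟩ := LB hp hH hc hcp hk1 this
  -- (mc)^k = x c x⁻¹ normalises Q, so c normalises x⁻¹ Q x
  refine ⟨cj x⁻¹ Q, isSyl_cj hQ (le_NN _ (inv_mem hx)), mem_nm fun y hy => ?_⟩
  rw [mem_cj] at hy ⊢
  have h2 := nm_conj ((NN Q).pow_mem hmc k) hy
  rw [hxc] at h2
  convert h2 using 1; group

end tk
end SP

namespace SP
open TensorProduct

def Prim (p l l' : ℕ) : Prop := l * l' % p = 1 ∧ orderOf ((l' : ℕ) : ZMod p) = p - 1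

section lin
variable {K U : Type*} [Field K] [AddCommGroup U] [Module K U] [FiniteDimensional K U]

lemma eig_count {ι : Type*} [Fintype ι] (D : Module.End K U) (μ : ι → K)
    (hμ : Function.Injective μ) (h : ∀ i, ∃ v, v ≠ 0 ∧ D v = μ i • v) :
    Fintype.card ι ≤ Module.finrank K U := by
  choose v hv0 hv using h
  have := Module.End.eigenvectors_linearIndependent' D μ hμ v (fun i =>
    ⟨Module.End.mem_eigenspace_iff.2 (hv i), hv0 i⟩)
  exact this.fintype_card_le_finrank

lemma eig_step {p l l' : ℕ} (hl : l * l' % p = 1) (C W : Module.End K U)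
    (hCp : C ^ p = 1) (hWC : W * C = C ^ l * W) {u : U} {μ : K} (hu : C u = μ • u) :
    C (W u) = μ ^ l' • W u := by
  have h1 : (C ^ l) (W u) = μ • W u := by
    have : (C ^ l * W) u = (W * C) u := by rw [hWC]
    simpa [hu] using this
  have h2 : ((C ^ l) ^ l') (W u) = μ ^ l' • W u := by
    generalize C ^ l = D at h1
    clear hl hWC
    induction l' with
    | zero => simp
    | succ k ih => rw [pow_succ', Module.End.mul_apply, ih, map_smul, h1, smul_smul, pow_succ]
  rw [← h2, ← pow_mul]
  congr 1
  rw [← Nat.div_add_mod (l * l') p, hl, pow_add, pow_mul, hCp, one_pow, one_mul, pow_one]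

lemma eig_iter {p l l' : ℕ} (hl : l * l' % p = 1) (C W : Module.End K U)
    (hCp : C ^ p = 1) (hWC : W * C = C ^ l * W) {u : U} {μ : K} (hu : C u = μ • u) (j : ℕ) :
    C ((W ^ j) u) = μ ^ (l' ^ j) • (W ^ j) u := by
  induction j with
  | zero => simpa using hu
  | succ j ih =>
    rw [pow_succ' W, Module.End.mul_apply, eig_step hl C W hCp hWC ih, pow_succ, pow_mul]

lemma pow_inj {p l l' : ℕ} (hp : p.Prime) (hP : Prim p l l') {μ : K} (h1 : μ ≠ 1) (hμ : μ ^ p = 1)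
    {i j : ℕ} (hi : i < p - 1) (hj : j < p - 1) (h : μ ^ (l' ^ i) = μ ^ (l' ^ j)) : i = j := by
  have ho : orderOf μ = p := by
    haveI := Fact.mk hp
    exact orderOf_eq_prime hμ h1
  rw [← pow_mod_orderOf μ (l' ^ i), ← pow_mod_orderOf μ (l' ^ j)] at h
  have h' := pow_injOn_Iio_orderOf (x := μ)
    (by simpa using Nat.mod_lt _ (by rw [ho]; exact hp.pos))
    (by simpa using Nat.mod_lt _ (by rw [ho]; exact hp.pos)) h
  rw [ho] at h'
  have h : ((l' ^ i : ℕ) : ZMod p) = ((l' ^ j : ℕ) : ZMod p) :=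
    (ZMod.natCast_eq_natCast_iff _ _ _).2 h'
  push_cast at h
  exact pow_injOn_Iio_orderOf (by simpa [hP.2] using hi) (by simpa [hP.2] using hj) h

lemma eig_pow1 {p : ℕ} (C : Module.End K U) (hCp : C ^ p = 1) {v : U} {μ : K} (hv0 : v ≠ 0)
    (hv : C v = μ • v) : μ ^ p = 1 := by
  have hpow : ∀ k : ℕ, (C ^ k) v = μ ^ k • v := by
    intro k
    induction k with
    | zero => simp
    | succ k ih => rw [pow_succ', Module.End.mul_apply, ih, map_smul, hv, smul_smul, pow_succ]
  have := hpow p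
  rw [hCp, Module.End.one_apply] at this
  have h3 : (μ ^ p - 1) • v = 0 := by rw [sub_smul, ← this, one_smul, sub_self]
  rcases smul_eq_zero.1 h3 with h | h
  · exact sub_eq_zero.1 h
  · exact absurd h hv0

lemma exists_eig [IsAlgClosed K] {p : ℕ} (hpK : (p : K) ≠ 0) (C : Module.End K U) (hCp : C ^ p = 1)
    {u : U} (hu : C u ≠ u) : ∃ (μ : K) (v : U), v ≠ 0 ∧ C v = μ • v ∧ μ ≠ 1 ∧ μ ^ p = 1 := by
  set Φ : Module.End K U := ∑ i ∈ Finset.range p, C ^ i with hΦ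
  have hcomm : C * Φ = Φ * C := by
    rw [hΦ, Finset.mul_sum, Finset.sum_mul]
    exact Finset.sum_congr rfl fun i _ => by rw [← pow_succ, ← pow_succ']
  have hz : Φ * (C - 1) = 0 := by rw [hΦ, geom_sum_mul, hCp, sub_self]
  have hinv : ∀ x ∈ LinearMap.ker Φ, C x ∈ LinearMap.ker Φ := by
    intro x hx
    rw [LinearMap.mem_ker] at hx ⊢
    have : (Φ * C) x = (C * Φ) x := by rw [hcomm]
    simpa [hx] using this
  have hmem : C u - u ∈ LinearMap.ker Φ := by
    rw [LinearMap.mem_ker]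
    have : (Φ * (C - 1)) u = 0 := by rw [hz]; rfl
    simpa using this
  haveI : Nontrivial (LinearMap.ker Φ) :=
    ⟨⟨⟨_, hmem⟩, 0, fun h => hu (sub_eq_zero.1 (congrArg Subtype.val h))⟩⟩
  obtain ⟨μ, hμ⟩ := Module.End.exists_eigenvalue (C.restrict hinv)
  obtain ⟨v, hv, hv0⟩ := hμ.exists_hasEigenvector
  rw [Module.End.mem_eigenspace_iff] at hv
  have hv' : C (v : U) = μ • (v : U) := congrArg Subtype.val hv
  have hv0' : (v : U) ≠ 0 := fun h => hv0 (Subtype.ext h)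
  have hpow : ∀ k : ℕ, (C ^ k) (v : U) = μ ^ k • (v : U) := by
    intro k
    induction k with
    | zero => simp
    | succ k ih => rw [pow_succ', Module.End.mul_apply, ih, map_smul, hv', smul_smul, pow_succ]
  refine ⟨μ, v, hv0', hv', ?_, ?_⟩
  · rintro rfl
    have h0 : (∑ i ∈ Finset.range p, C ^ i) (v : U) = 0 := v.2
    rw [LinearMap.sum_apply] at h0
    simp only [hpow, one_pow, one_smul, Finset.sum_const, Finset.card_range] at h0
    rw [← Nat.cast_smul_eq_nsmul K] at h0
    exact (smul_ne_zero hpK hv0') h0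
  · have := hpow p
    rw [hCp, Module.End.one_apply] at this
    have h3 : (μ ^ p - 1) • (v : U) = 0 := by rw [sub_smul, ← this, one_smul, sub_self]
    rcases smul_eq_zero.1 h3 with h | h
    · exact sub_eq_zero.1 h
    · exact absurd h hv0'
end lin

section fin
variable {q : ℕ} [Fact q.Prime] {V : Type*} [AddCommGroup V] [Module (ZMod q) V] [Finite V]

lemma card_V : Nat.card V = q ^ Module.finrank (ZMod q) V := by
  rw [Module.natCard_eq_pow_finrank (K := ZMod q), Nat.card_zmod]

variable (KK : Type) [Field KK] [Algebra (ZMod q) KK] [IsAlgClosed KK]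

lemma cast_ne {p : ℕ} (hp : p.Prime) (hpq : p ≠ q) : (p : KK) ≠ 0 := by
  intro h
  haveI : CharP KK q := charP_of_injective_algebraMap (algebraMap (ZMod q) KK).injective q
  rw [CharP.cast_eq_zero_iff KK q] at h
  exact hpq ((Nat.prime_dvd_prime_iff_eq Fact.out hp).1 h).symm

lemma tmul_ne {v : V} (hv : v ≠ 0) : (1 : KK) ⊗ₜ[ZMod q] v ≠ 0 := by
  intro h
  exact hv ((Module.FaithfullyFlat.one_tmul_eq_zero_iff (ZMod q) (M := V) (A := KK) v).1 h)

include KK in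
lemma R0 {p l l' : ℕ} (hp : p.Prime) (hpq : p ≠ q) (hP : Prim p l l')
    (hV : Nat.card V < q ^ (p - 1)) (C W : Module.End (ZMod q) V)
    (hCp : C ^ p = 1) (hWC : W * C = C ^ l * W) (hW : Function.Injective W) (v : V) : C v = v := by
  by_contra hv
  set b := Module.End.baseChangeHom (ZMod q) KK V with hb
  obtain ⟨W', hW'⟩ : ∃ W' : Module.End (ZMod q) V, W' * W = 1 := by
    have hbij : Function.Bijective W := Finite.injective_iff_bijective.1 hW
    refine ⟨(LinearEquiv.ofBijective W hbij).symm.toLinearMap, ?_⟩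
    ext x
    exact (LinearEquiv.ofBijective W hbij).symm_apply_apply x
  have hu : (b C) ((1 : KK) ⊗ₜ[ZMod q] v) ≠ (1 : KK) ⊗ₜ[ZMod q] v := by
    intro h
    have h1 : (b C) ((1 : KK) ⊗ₜ[ZMod q] v) = (1 : KK) ⊗ₜ[ZMod q] (C v) := rfl
    rw [h1, ← sub_eq_zero, ← TensorProduct.tmul_sub] at h
    exact tmul_ne KK (sub_ne_zero.2 hv) h
  obtain ⟨μ, u, hu0, hCu, hμ1, hμp⟩ := exists_eig (cast_ne KK hp hpq) (b C)
    (by rw [← map_pow, hCp, map_one]) hu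
  have hWi : ∀ x, b W x = 0 → x = 0 := by
    intro x hx
    have : (b W' * b W) x = x := by rw [← map_mul, hW', map_one]; rfl
    rw [Module.End.mul_apply, hx, map_zero] at this
    exact this.symm
  have hWj : ∀ j : ℕ, ((b W) ^ j) u ≠ 0 := by
    intro j
    induction j with
    | zero => simpa using hu0
    | succ j ih => rw [pow_succ', Module.End.mul_apply]; exact fun h => ih (hWi _ h)
  have := eig_count (ι := Fin (p - 1)) (b C) (fun j => μ ^ (l' ^ (j : ℕ)))
    (fun i j hij => Fin.ext (pow_inj hp hP hμ1 hμp i.2 j.2 hij))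
    (fun j => ⟨((b W) ^ (j : ℕ)) u, hWj j, eig_iter hP.1 (b C) (b W) (by rw [← map_pow, hCp, map_one])
      (by rw [← map_mul, hWC, map_mul, map_pow]) hCu j⟩)
  rw [Fintype.card_fin, Module.finrank_baseChange] at this
  rw [card_V (q := q) (V := V)] at hV
  have h2 := (Nat.pow_lt_pow_iff_right (Fact.out : q.Prime).one_lt).1 hV
  omega
end fin

section fin2
variable {V : Type*} [AddCommGroup V] [Module (ZMod 2) V] [Finite V]
variable (KK : Type) [Field KK] [Algebra (ZMod 2) KK] [IsAlgClosed KK]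

include KK in
lemma E0 {p l l' r : ℕ} (hp : p.Prime) (hp2 : p ≠ 2) (hP : Prim p l l')
    (hr : r.Prime) (hr2 : r ≠ 2) (hrp : r ≠ p)
    (hV : Nat.card V < 2 ^ (2 * (p - 1))) (C W Y : Module.End (ZMod 2) V)
    (hCp : C ^ p = 1) (hWC : W * C = C ^ l * W) (hW : Function.Injective W)
    (hfix : ∀ v, C v = v → v = 0) (hYr : Y ^ r = 1) (hYC : C * Y = Y * C) (hYW : W * Y = Y * W)
    (v : V) : Y v = v := by
  haveI : Fact (Nat.Prime 2) := ⟨Nat.prime_two⟩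
  by_contra hv
  set b := Module.End.baseChangeHom (ZMod 2) KK V with hb
  obtain ⟨W', hW'⟩ : ∃ W' : Module.End (ZMod 2) V, W' * W = 1 := by
    have hbij : Function.Bijective W := Finite.injective_iff_bijective.1 hW
    refine ⟨(LinearEquiv.ofBijective W hbij).symm.toLinearMap, ?_⟩
    ext x
    exact (LinearEquiv.ofBijective W hbij).symm_apply_apply x
  have hWi : ∀ x, b W x = 0 → x = 0 := by
    intro x hx
    have : (b W' * b W) x = x := by rw [← map_mul, hW', map_one]; rfl
    rw [Module.End.mul_apply, hx, map_zero] at this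
    exact this.symm
  have hu : (b Y) ((1 : KK) ⊗ₜ[ZMod 2] v) ≠ (1 : KK) ⊗ₜ[ZMod 2] v := by
    intro h
    have h1 : (b Y) ((1 : KK) ⊗ₜ[ZMod 2] v) = (1 : KK) ⊗ₜ[ZMod 2] (Y v) := rfl
    rw [h1, ← sub_eq_zero, ← TensorProduct.tmul_sub] at h
    exact tmul_ne KK (sub_ne_zero.2 hv) h
  obtain ⟨ν, u, hu0, hYu, hν1, hνr⟩ := exists_eig (cast_ne (q := 2) KK hr hr2) (b Y)
    (by rw [← map_pow, hYr, map_one]) hu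
  have hPhi : ∑ i ∈ Finset.range p, C ^ i = 0 := by
    ext x
    apply hfix
    have : (C - 1) * ∑ i ∈ Finset.range p, C ^ i = 0 := by
      rw [mul_geom_sum, hCp, sub_self]
    have h2 : ((C - 1) * ∑ i ∈ Finset.range p, C ^ i) x = 0 := by rw [this]; rfl
    rw [Module.End.mul_apply, LinearMap.sub_apply, Module.End.one_apply, sub_eq_zero] at h2
    exact h2
  have hbPhi : ∑ i ∈ Finset.range p, (b C) ^ i = 0 := by
    have := congrArg b hPhi
    simpa [map_sum] using this
  have hbCp : (b C) ^ p = 1 := by rw [← map_pow, hCp, map_one]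
  -- for any eigenvalue of Y
  have key : ∀ ν : KK, (∃ u, u ≠ 0 ∧ b Y u = ν • u) → ∃ (μ : KK) (u : KK ⊗[ZMod 2] V), u ≠ 0 ∧ b Y u = ν • u ∧ b C u = μ • u ∧
      μ ≠ 1 ∧ μ ^ p = 1 := by
    rintro ν ⟨u, hu0, hu⟩
    have hinv : ∀ x ∈ Module.End.eigenspace (b Y) ν, b C x ∈ Module.End.eigenspace (b Y) ν := by
      intro x hx
      rw [Module.End.mem_eigenspace_iff] at hx ⊢
      have : (b Y * b C) x = (b C * b Y) x := by rw [← map_mul, ← map_mul, hYC]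
      rw [Module.End.mul_apply, Module.End.mul_apply, hx, map_smul] at this
      exact this
    haveI : Nontrivial (Module.End.eigenspace (b Y) ν) :=
      ⟨⟨⟨u, Module.End.mem_eigenspace_iff.2 hu⟩, 0, fun h => hu0 (congrArg Subtype.val h)⟩⟩
    obtain ⟨μ, hμ⟩ := Module.End.exists_eigenvalue (K := KK)
      (V := Module.End.eigenspace (b Y) ν) ((b C).restrict hinv)
    obtain ⟨v, hv, hv0⟩ := hμ.exists_hasEigenvector
    rw [Module.End.mem_eigenspace_iff] at hv
    have hv' : b C (v : KK ⊗[ZMod 2] V) = μ • (v : KK ⊗[ZMod 2] V) := congrArg Subtype.val hv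
    have hv0' : (v : KK ⊗[ZMod 2] V) ≠ 0 := fun h => hv0 (Subtype.ext h)
    have hpow : ∀ k : ℕ, ((b C) ^ k) (v : KK ⊗[ZMod 2] V) = μ ^ k • (v : KK ⊗[ZMod 2] V) := by
      intro k
      induction k with
      | zero => simp
      | succ k ih => rw [pow_succ', Module.End.mul_apply, ih, map_smul, hv', smul_smul, pow_succ]
    refine ⟨μ, v, hv0', Module.End.mem_eigenspace_iff.1 v.2, hv', ?_, ?_⟩
    · rintro rfl
      have h0 : (∑ i ∈ Finset.range p, (b C) ^ i) (v : KK ⊗[ZMod 2] V) = 0 := by rw [hbPhi]; rfl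
      rw [LinearMap.sum_apply] at h0
      simp only [hpow, one_pow, one_smul, Finset.sum_const, Finset.card_range] at h0
      rw [← Nat.cast_smul_eq_nsmul KK] at h0
      exact (smul_ne_zero (cast_ne (q := 2) KK hp hp2) hv0') h0
    · exact eig_pow1 (b C) hbCp hv0' hv'
  have hν2 : ∃ u, u ≠ 0 ∧ b Y u = (ν ^ 2) • u := by
    have h1 : Module.End.HasEigenvalue (b Y) ν :=
      Module.End.hasEigenvalue_of_hasEigenvector ⟨Module.End.mem_eigenspace_iff.2 hYu, hu0⟩
    rw [Module.End.hasEigenvalue_iff_isRoot_charpoly] at h1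
    have hcp : (b Y).charpoly = Y.charpoly.map (algebraMap (ZMod 2) KK) :=
      LinearMap.charpoly_baseChange Y KK
    have h2 : Module.End.HasEigenvalue (b Y) (ν ^ 2) := by
      rw [Module.End.hasEigenvalue_iff_isRoot_charpoly]
      rw [hcp, Polynomial.IsRoot, Polynomial.eval_map_algebraMap] at h1 ⊢
      have h4 := Polynomial.aeval_algHom_apply (FiniteField.frobeniusAlgHom (ZMod 2) KK) ν Y.charpoly
      rw [h1, map_zero] at h4
      simpa [FiniteField.frobeniusAlgHom] using h4
    obtain ⟨w, hw, hw0⟩ := h2.exists_hasEigenvector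
    exact ⟨w, hw0, Module.End.mem_eigenspace_iff.1 hw⟩
  obtain ⟨μ1, u1, hu1, hY1, hC1, hμ1, hμ1p⟩ := key ν ⟨u, hu0, hYu⟩
  obtain ⟨μ2, u2, hu2, hY2, hC2, hμ2, hμ2p⟩ := key (ν ^ 2) hν2
  have hWj : ∀ u, u ≠ 0 → ∀ j : ℕ, ((b W) ^ j) u ≠ 0 := by
    intro u hu0 j
    induction j with
    | zero => simpa using hu0
    | succ j ih => rw [pow_succ', Module.End.mul_apply]; exact fun h => ih (hWi _ h)
  have hYj : ∀ u (ν : KK), b Y u = ν • u → ∀ j : ℕ, b Y (((b W) ^ j) u) = ν • ((b W) ^ j) u := by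
    intro u ν hu j
    have : (b Y * (b W) ^ j) u = ((b W) ^ j * b Y) u := by
      rw [← map_pow, ← map_mul, ← map_mul]
      congr 2
      exact ((show Commute W Y from hYW).pow_left j).symm
    rw [Module.End.mul_apply, Module.End.mul_apply, hu, map_smul] at this
    exact this
  have hbWC : b W * b C = (b C) ^ l * b W := by rw [← map_mul, hWC, map_mul, map_pow]
  have hν0 : ν ≠ 0 := by
    rintro rfl
    rw [zero_pow hr.ne_zero] at hνr
    exact zero_ne_one hνr
  have hνp : ν ^ p ≠ 1 := by
    intro h
    have h1 := Nat.dvd_gcd (orderOf_dvd_of_pow_eq_one hνr) (orderOf_dvd_of_pow_eq_one h)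
    rw [(Nat.coprime_primes hr hp).2 hrp] at h1
    exact hν1 (orderOf_eq_one_iff.1 (Nat.dvd_one.1 h1))
  have hcount := eig_count (ι := Fin (p - 1) ⊕ Fin (p - 1)) (b C * b Y)
    (Sum.elim (fun j => μ1 ^ (l' ^ (j : ℕ)) * ν) (fun j => μ2 ^ (l' ^ (j : ℕ)) * ν ^ 2))
    (by
      have hne : ∀ i j : ℕ, μ1 ^ (l' ^ i) * ν ≠ μ2 ^ (l' ^ j) * ν ^ 2 := by
        intro i j h
        have h2 := congrArg (· ^ p) h
        simp only [mul_pow] at h2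
        rw [pow_right_comm μ1, pow_right_comm μ2, hμ1p, hμ2p, one_pow, one_pow,
          one_mul, one_mul, pow_right_comm ν, sq] at h2
        exact hνp (mul_left_cancel₀ (pow_ne_zero p hν0) (by rw [← h2, mul_one]))
      rintro (i | i) (j | j) hij
      · simp only [Sum.elim_inl] at hij
        rw [Fin.ext (pow_inj hp hP hμ1 hμ1p i.2 j.2 (mul_right_cancel₀ hν0 hij))]
      · exact absurd hij (hne _ _)
      · exact absurd hij.symm (hne _ _)
      · simp only [Sum.elim_inr] at hij
        rw [Fin.ext (pow_inj hp hP hμ2 hμ2p i.2 j.2 (mul_right_cancel₀ (pow_ne_zero 2 hν0) hij))])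
    (by
      rintro (j | j)
      · refine ⟨_, hWj u1 hu1 j, ?_⟩
        rw [Module.End.mul_apply, hYj u1 ν hY1, map_smul, eig_iter hP.1 (b C) (b W) hbCp hbWC hC1 j,
          smul_smul, Sum.elim_inl, mul_comm]
      · refine ⟨_, hWj u2 hu2 j, ?_⟩
        rw [Module.End.mul_apply, hYj u2 _ hY2, map_smul, eig_iter hP.1 (b C) (b W) hbCp hbWC hC2 j,
          smul_smul, Sum.elim_inr, mul_comm])
  rw [Fintype.card_sum, Fintype.card_fin, Module.finrank_baseChange] at hcount
  rw [card_V (q := 2) (V := V)] at hV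
  have h2 := (Nat.pow_lt_pow_iff_right (by norm_num : 1 < 2)).1 hV
  omega
end fin2
end SP

namespace SP

section cg
variable {X : Type*} [CommGroup X] [Finite X]

lemma toZ_iter {q : ℕ} [Module (ZMod q) (Additive X)] (c : X →* X) (k : ℕ) (x : Additive X) :
    (((MonoidHom.toAdditive c).toZModLinearMap q : Module.End (ZMod q) (Additive X)) ^ k) x
        = Additive.ofMul (c^[k] x.toMul) := by
  induction k with
  | zero => rfl
  | succ k ih => rw [pow_succ', Module.End.mul_apply, ih, Function.iterate_succ_apply']; rfl

lemma R1 {p q l l' : ℕ} (hp : p.Prime) [Fact q.Prime] (hpq : p ≠ q) (hP : Prim p l l')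
    (hX : Nat.card X < q ^ (p - 1)) (hq : ∀ x : X, x ^ q = 1) (c w : X →* X)
    (hc : ∀ x, c^[p] x = x) (hwc : ∀ x, w (c x) = c^[l] (w x)) (hw : Function.Injective w) (x : X) :
    c x = x := by
  letI : Module (ZMod q) (Additive X) := AddCommGroup.zmodModule (n := q) (fun x => by
    have := hq x.toMul
    exact this)
  have hC := fun c : X →* X => toZ_iter (q := q) c
  exact R0 (q := q) (V := Additive X) (AlgebraicClosure (ZMod q)) hp hpq hP hX
    ((MonoidHom.toAdditive c).toZModLinearMap q) ((MonoidHom.toAdditive w).toZModLinearMap q)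
    (by ext x; rw [hC, hc]; rfl)
    (by
      ext x
      rw [Module.End.mul_apply, Module.End.mul_apply, hC]
      exact hwc x) hw x

lemma E1 {p l l' r : ℕ} (hp : p.Prime) (hp2 : p ≠ 2) (hP : Prim p l l')
    (hr : r.Prime) (hr2 : r ≠ 2) (hrp : r ≠ p)
    (hX : Nat.card X < 2 ^ (2 * (p - 1))) (hq : ∀ x : X, x ^ 2 = 1) (c w y : X →* X)
    (hc : ∀ x, c^[p] x = x) (hwc : ∀ x, w (c x) = c^[l] (w x)) (hw : Function.Injective w)
    (hfix : ∀ x, c x = x → x = 1) (hyr : ∀ x, y^[r] x = x) (hyc : ∀ x, c (y x) = y (c x))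
    (hyw : ∀ x, w (y x) = y (w x)) (x : X) : y x = x := by
  letI : Module (ZMod 2) (Additive X) := AddCommGroup.zmodModule (n := 2) (fun x => by
    have := hq x.toMul
    exact this)
  have hC := fun c : X →* X => toZ_iter (q := 2) c
  exact E0 (V := Additive X) (AlgebraicClosure (ZMod 2)) hp hp2 hP hr hr2 hrp hX
    ((MonoidHom.toAdditive c).toZModLinearMap 2) ((MonoidHom.toAdditive w).toZModLinearMap 2)
    ((MonoidHom.toAdditive y).toZModLinearMap 2)
    (by ext x; rw [hC, hc]; rfl)
    (by
      ext x
      rw [Module.End.mul_apply, Module.End.mul_apply, hC]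
      exact hwc x) hw hfix (by ext x; rw [hC, hyr]; rfl)
    (by ext x; exact hyc x) (by ext x; exact hyw x) x
end cg

section sec
variable {A : Type*} [Group A]

/-- conjugation on a section -/
def cmap {Q0 Q1 : Subgroup A} [(Q0.subgroupOf Q1).Normal] (b : A) (h0 : b ∈ NN Q0) (h1 : b ∈ NN Q1) :
    (Q1 ⧸ Q0.subgroupOf Q1) →* (Q1 ⧸ Q0.subgroupOf Q1) :=
  QuotientGroup.map _ _ (MonoidHom.mk' (fun x : Q1 => (⟨b * x * b⁻¹, nm_conj h1 x.2⟩ : Q1))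
    (fun x y => Subtype.ext (by simp))) (by
      intro x hx
      rw [Subgroup.mem_subgroupOf] at hx
      rw [Subgroup.mem_comap, Subgroup.mem_subgroupOf]
      exact nm_conj h0 hx)

lemma cmap_mk {Q0 Q1 : Subgroup A} [(Q0.subgroupOf Q1).Normal] (b : A) (h0 : b ∈ NN Q0) (h1 : b ∈ NN Q1)
    (x : Q1) : cmap b h0 h1 (QuotientGroup.mk x) =
      QuotientGroup.mk (⟨b * x * b⁻¹, nm_conj h1 x.2⟩ : Q1) := rfl

lemma cmap_iter {Q0 Q1 : Subgroup A} [(Q0.subgroupOf Q1).Normal] (b : A) (h0 : b ∈ NN Q0) (h1 : b ∈ NN Q1)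
    (k : ℕ) (x : Q1) : (cmap b h0 h1)^[k] (QuotientGroup.mk x) =
      QuotientGroup.mk (⟨b ^ k * x * (b ^ k)⁻¹, nm_conj (pow_mem h1 k) x.2⟩ : Q1) := by
  induction k with
  | zero => simp
  | succ k ih =>
    rw [Function.iterate_succ_apply', ih, cmap_mk]
    congr 2
    rw [pow_succ']; group

lemma sec_eq {Q0 Q1 : Subgroup A} (x y : Q1) :
    (QuotientGroup.mk x : Q1 ⧸ Q0.subgroupOf Q1) = QuotientGroup.mk y ↔ (x : A)⁻¹ * y ∈ Q0 := by
  rw [QuotientGroup.eq, Subgroup.mem_subgroupOf]; rfl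

lemma cmap_inj {Q0 Q1 : Subgroup A} [(Q0.subgroupOf Q1).Normal] (b : A) (h0 : b ∈ NN Q0) (h1 : b ∈ NN Q1) :
    Function.Injective (cmap b h0 h1) := by
  rw [injective_iff_map_eq_one]
  intro x
  induction x using QuotientGroup.induction_on with
  | H x =>
    intro h
    rw [cmap_mk, QuotientGroup.eq_one_iff, Subgroup.mem_subgroupOf] at h
    rw [QuotientGroup.eq_one_iff, Subgroup.mem_subgroupOf]
    have := nm_conj' h0 h
    simpa [mul_assoc] using this

variable [Finite A]

lemma sec_card {Q0 Q1 : Subgroup A} (h : Q0 ≤ Q1) :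
    Nat.card (Q1 ⧸ Q0.subgroupOf Q1) * Nat.card Q0 = Nat.card Q1 := by
  rw [Subgroup.card_eq_card_quotient_mul_card_subgroup (Q0.subgroupOf Q1)]
  congr 1
  exact Nat.card_congr (Subgroup.subgroupOfEquivOfLe h).symm.toEquiv

/-- core rank lemma for elementary abelian sections -/
lemma R2 {p q l l' : ℕ} (hp : p.Prime) [Fact q.Prime] (hpq : p ≠ q) (hP : Prim p l l')
    {Q0 Q1 : Subgroup A} (h01 : Q0 ≤ Q1) (hab : ∀ x ∈ Q1, ∀ y ∈ Q1, x⁻¹ * y⁻¹ * x * y ∈ Q0)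
    (hq : ∀ x ∈ Q1, x ^ q ∈ Q0) (hcard : Nat.card Q1 < q ^ (p - 1) * Nat.card Q0)
    {c w : A} (hcp : c ^ p = 1) (hwc : w * c * w⁻¹ = c ^ l)
    (hc0 : c ∈ NN Q0) (hc1 : c ∈ NN Q1) (hw0 : w ∈ NN Q0) (hw1 : w ∈ NN Q1) :
    ∀ x ∈ Q1, x⁻¹ * c * x * c⁻¹ ∈ Q0 := by
  haveI hn : (Q0.subgroupOf Q1).Normal := ⟨fun x hx y => by
    rw [Subgroup.mem_subgroupOf] at hx ⊢
    have h1 := hab (y : A)⁻¹ (inv_mem y.2) x⁻¹ (inv_mem x.2)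
    have := Q0.mul_mem h1 hx
    convert this using 1
    simp [mul_assoc]⟩
  letI : CommGroup (Q1 ⧸ Q0.subgroupOf Q1) :=
    { QuotientGroup.Quotient.group (Q0.subgroupOf Q1) with
      mul_comm := by
        intro a b
        induction a using QuotientGroup.induction_on with
        | H x =>
          induction b using QuotientGroup.induction_on with
          | H y =>
            rw [← QuotientGroup.mk_mul, ← QuotientGroup.mk_mul, sec_eq]
            have := hab y y.2 x x.2
            simpa [mul_assoc] using this }
  have hX : Nat.card (Q1 ⧸ Q0.subgroupOf Q1) < q ^ (p - 1) := by
    rw [← sec_card h01] at hcard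
    exact lt_of_mul_lt_mul_right hcard (Nat.zero_le _)
  intro x hx
  have := R1 hp hpq hP hX (by
      intro a
      induction a using QuotientGroup.induction_on with
      | H x =>
        rw [← QuotientGroup.mk_pow, QuotientGroup.eq_one_iff, Subgroup.mem_subgroupOf]
        exact hq x x.2) (cmap c hc0 hc1) (cmap w hw0 hw1)
    (by
      intro a
      induction a using QuotientGroup.induction_on with
      | H x => rw [cmap_iter]; simp [hcp])
    (by
      intro a
      induction a using QuotientGroup.induction_on with
      | H x =>
        rw [cmap_mk, cmap_mk, cmap_mk, cmap_iter]
        congr 2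
        simp only [← hwc]; group)
    (cmap_inj w hw0 hw1) (QuotientGroup.mk ⟨x, hx⟩)
  rw [cmap_mk, sec_eq] at this
  have h4 := Q0.inv_mem this
  simpa [mul_assoc] using h4
end sec
end SP

namespace SP
section rr
variable {A : Type*} [Group A] [Finite A]

lemma not_dvd_of_pgroup {p q : ℕ} (hp : p.Prime) (hq : q.Prime) (hpq : p ≠ q) {Q : Subgroup A}
    (hQ : IsPGroup q Q) : ¬ p ∣ Nat.card Q := by
  haveI := Fact.mk hq
  obtain ⟨k, hk⟩ := (IsPGroup.iff_card).1 hQ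
  rw [hk]
  intro h
  exact hpq ((Nat.prime_dvd_prime_iff_eq hp hq).1 (hp.dvd_of_dvd_pow h))

lemma exists_step {q : ℕ} [Fact q.Prime] {Q0 Q : Subgroup A} (h : Q0 < Q) (hQ : IsPGroup q Q) :
    ∃ Q1 : Subgroup A, Q0 < Q1 ∧ Q1 ≤ Q ∧ (∀ x, x ∈ Q1 ↔ x ∈ Q ⊓ NN Q0 ∧
      (∀ y ∈ Q ⊓ NN Q0, x⁻¹ * y⁻¹ * x * y ∈ Q0) ∧ x ^ q ∈ Q0) := by
  set M := Q ⊓ NN Q0 with hM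
  have h0M : Q0 ≤ M := le_inf h.le (le_NN Q0)
  have hlt : Q0 < M := by
    haveI := hQ.isNilpotent
    have h1 : Q0.subgroupOf Q < ⊤ := by
      rw [lt_top_iff_ne_top]
      intro h2
      exact h.not_ge (Subgroup.subgroupOf_eq_top.1 h2)
    have h2 := Group.normalizerCondition_of_isNilpotent (G := Q) _ h1
    obtain ⟨x, hx, hx0⟩ := SetLike.exists_of_lt h2
    refine lt_of_le_of_ne h0M fun he => hx0 ?_
    rw [Subgroup.mem_subgroupOf, he]
    refine ⟨x.2, mem_nm fun y hy => ?_⟩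
    exact (Subgroup.mem_normalizer_iff.1 hx ⟨y, h.le hy⟩).1 hy
  haveI hn : (Q0.subgroupOf M).Normal := ⟨fun x hx y => by
    rw [Subgroup.mem_subgroupOf] at hx ⊢
    exact nm_conj y.2.2 hx⟩
  have hXp : IsPGroup q (M ⧸ Q0.subgroupOf M) := by
    have : IsPGroup q M := hQ.to_le inf_le_left
    exact this.to_quotient _
  haveI : Nontrivial (M ⧸ Q0.subgroupOf M) := by
    obtain ⟨x, hx, hx0⟩ := SetLike.exists_of_lt hlt
    refine ⟨⟨QuotientGroup.mk ⟨x, hx⟩, 1, fun h => hx0 ?_⟩⟩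
    rwa [QuotientGroup.eq_one_iff, Subgroup.mem_subgroupOf] at h
  haveI := hXp.center_nontrivial
  have hd : q ∣ Nat.card (Subgroup.center (M ⧸ Q0.subgroupOf M)) := by
    obtain ⟨k, hk, hk2⟩ := (IsPGroup.nontrivial_iff_card (hXp.to_subgroup (Subgroup.center (M ⧸ Q0.subgroupOf M)))).1 inferInstance
    rw [hk2]; exact dvd_pow_self _ hk.ne'
  obtain ⟨z, hz⟩ := exists_prime_orderOf_dvd_card' q hd
  let Ω : Subgroup (M ⧸ Q0.subgroupOf M) :=
    { carrier := {x | x ∈ Subgroup.center (M ⧸ Q0.subgroupOf M) ∧ x ^ q = 1}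
      mul_mem' := by
        rintro a b ⟨ha, ha'⟩ ⟨hb, hb'⟩
        refine ⟨mul_mem ha hb, ?_⟩
        have : Commute a b := (Subgroup.mem_center_iff.1 hb) a
        rw [this.mul_pow, ha', hb', one_mul]
      one_mem' := ⟨one_mem _, one_pow _⟩
      inv_mem' := by
        rintro a ⟨ha, ha'⟩
        exact ⟨inv_mem ha, by rw [inv_pow, ha', inv_one]⟩ }
  have hΩ : ∀ x, x ∈ Ω ↔ x ∈ Subgroup.center (M ⧸ Q0.subgroupOf M) ∧ x ^ q = 1 := fun x => Iff.rfl
  let Q1 : Subgroup A := (Ω.comap (QuotientGroup.mk' _)).map M.subtype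
  have hQ1 : ∀ x, x ∈ Q1 ↔ ∃ h : x ∈ M, (QuotientGroup.mk (⟨x, h⟩ : M) : M ⧸ Q0.subgroupOf M) ∈ Ω := by
    intro x
    constructor
    · rintro ⟨y, hy, rfl⟩
      exact ⟨y.2, hy⟩
    · rintro ⟨h1, h2⟩
      exact ⟨⟨x, h1⟩, h2, rfl⟩
  have hmem : ∀ x, x ∈ Q1 ↔ x ∈ M ∧ (∀ y ∈ M, x⁻¹ * y⁻¹ * x * y ∈ Q0) ∧ x ^ q ∈ Q0 := by
    intro x
    rw [hQ1]
    constructor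
    · rintro ⟨hx, h2⟩
      rw [hΩ] at h2
      refine ⟨hx, fun y hy => ?_, ?_⟩
      · have := (Subgroup.mem_center_iff.1 h2.1) (QuotientGroup.mk ⟨y, hy⟩)
        rw [← QuotientGroup.mk_mul, ← QuotientGroup.mk_mul, sec_eq] at this
        simpa [mul_assoc] using this
      · have := h2.2
        rwa [← QuotientGroup.mk_pow, QuotientGroup.eq_one_iff, Subgroup.mem_subgroupOf] at this
    · rintro ⟨hx, h2, h3⟩
      refine ⟨hx, (hΩ _).2 ⟨Subgroup.mem_center_iff.2 fun y => ?_, ?_⟩⟩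
      · induction y using QuotientGroup.induction_on with
        | H y =>
          rw [← QuotientGroup.mk_mul, ← QuotientGroup.mk_mul, sec_eq]
          have := h2 y y.2
          simpa [mul_assoc] using this
      · rw [← QuotientGroup.mk_pow, QuotientGroup.eq_one_iff, Subgroup.mem_subgroupOf]; exact h3
  refine ⟨Q1, ?_, ?_, hmem⟩
  · refine lt_of_le_of_ne (fun x hx => ?_) ?_
    · rw [hmem]
      refine ⟨h0M hx, fun y hy => ?_, Q0.pow_mem hx q⟩
      have := Q0.mul_mem (Q0.inv_mem hx) (nm_conj' hy.2 hx)
      simpa [mul_assoc] using this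
    · intro he
      obtain ⟨x, hx⟩ := QuotientGroup.mk_surjective z.1
      have h1 : (x : A) ∈ Q1 := by
        rw [hQ1]
        refine ⟨x.2, ?_⟩
        rw [hΩ]
        have e : (QuotientGroup.mk (⟨x, x.2⟩ : M) : M ⧸ Q0.subgroupOf M) = z := hx
        rw [e]
        refine ⟨z.2, ?_⟩
        have := pow_orderOf_eq_one z
        rw [hz] at this
        exact congrArg Subtype.val this
      rw [← he] at h1
      have h2 : z = 1 := by
        apply Subtype.ext
        rw [← hx]
        exact (QuotientGroup.eq_one_iff _).2 (Subgroup.mem_subgroupOf.2 h1)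
      rw [h2, orderOf_one] at hz
      exact (Fact.out : q.Prime).one_lt.ne hz
  · intro x hx
    exact ((hmem x).1 hx).1.1

lemma NN_inf {Q0 Q : Subgroup A} {b : A} (h : b ∈ NN Q) (h0 : b ∈ NN Q0) : b ∈ NN (Q ⊓ NN Q0) := by
  apply mem_nm
  rintro x ⟨hx, hx0⟩
  exact ⟨nm_conj h hx, (NN Q0).mul_mem ((NN Q0).mul_mem h0 hx0) (inv_mem h0)⟩

lemma R3 {p q l l' : ℕ} (hp : p.Prime) [Fact q.Prime] (hpq : p ≠ q) (hP : Prim p l l')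
    {Q0 Q : Subgroup A} (h : Q0 ≤ Q) (hQ : IsPGroup q Q)
    (hcard : Nat.card Q < q ^ (p - 1) * Nat.card Q0)
    {c w : A} (hcp : c ^ p = 1) (hwc : w * c * w⁻¹ = c ^ l)
    (hc0 : c ∈ NN Q0) (hc1 : c ∈ NN Q) (hw0 : w ∈ NN Q0) (hw1 : w ∈ NN Q) :
    ∀ x ∈ Q, ∃ b ∈ Q, ∃ a ∈ Q0, b * c = c * b ∧ x = b * a := by
  induction hk : Nat.card Q - Nat.card Q0 using Nat.strong_induction_on generalizing Q0 with
  | _ k ih =>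
  subst hk
  intro x hx
  by_cases he : Q0 = Q
  · exact ⟨1, Q.one_mem, x, he ▸ hx, by simp, by simp⟩
  have hlt : Q0 < Q := lt_of_le_of_ne h he
  obtain ⟨Q1, h01, h1Q, hmem⟩ := exists_step hlt hQ
  have hinv : ∀ b ∈ NN Q0, b ∈ NN Q → b ∈ NN Q1 := by
    intro b hb0 hb
    apply mem_nm
    intro x hx
    rw [hmem] at hx ⊢
    have hbM := NN_inf hb hb0
    refine ⟨nm_conj hbM hx.1, fun y hy => ?_, ?_⟩
    · have := nm_conj hb0 (hx.2.1 _ (nm_conj' hbM hy))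
      simpa [mul_assoc] using this
    · rw [conj_pow]; exact nm_conj hb0 hx.2.2
  have hc01 : Nat.card Q0 < Nat.card Q1 := by
    have h2 := Set.Finite.card_lt_card (Set.toFinite (Q1 : Set A)) (SetLike.coe_ssubset_coe.2 h01)
    exact h2
  have hc1Q : Nat.card Q1 ≤ Nat.card Q := Subgroup.card_le_of_le h1Q
  obtain ⟨b, hb, a, ha, hbc, rfl⟩ := ih _ (by omega) h1Q (hcard.trans (by
      have : 0 < q ^ (p-1) := pow_pos (Fact.out : q.Prime).pos _
      exact Nat.mul_lt_mul_of_pos_left hc01 this)) (hinv c hc0 hc1)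
    (hinv w hw0 hw1) rfl x hx
  have h2 := R2 hp hpq hP h01.le (fun x hx y hy => ((hmem x).1 hx).2.1 y ((hmem y).1 hy).1)
    (fun x hx => ((hmem x).1 hx).2.2) (lt_of_le_of_lt hc1Q hcard) hcp hwc hc0 (hinv c hc0 hc1) hw0
    (hinv w hw0 hw1) a ha
  obtain ⟨y, hy, hyc⟩ := LC hp (not_dvd_of_pgroup hp Fact.out hpq (hQ.to_le h)) hc0 hcp h2
  refine ⟨b * (a * y), Q.mul_mem hb (Q.mul_mem (h1Q ha) (h hy)), y⁻¹, inv_mem hy, ?_, by group⟩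
  rw [mul_assoc, hyc, ← mul_assoc, hbc, mul_assoc]

/-- rank lemma -/
lemma R4 {p q l l' : ℕ} (hp : p.Prime) [Fact q.Prime] (hpq : p ≠ q) (hP : Prim p l l')
    {Q : Subgroup A} (hQ : IsPGroup q Q) (hcard : Nat.card Q < q ^ (p - 1))
    {c w : A} (hcp : c ^ p = 1) (hwc : w * c * w⁻¹ = c ^ l)
    (hc1 : c ∈ NN Q) (hw1 : w ∈ NN Q) : c ∈ CS Q := by
  have hb : ∀ b : A, b ∈ NN (⊥ : Subgroup A) := fun b => mem_nm fun x hx => by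
    rw [Subgroup.mem_bot] at hx ⊢; simp [hx]
  rw [mem_CS]
  intro x hx
  obtain ⟨b, -, a, ha, hbc, rfl⟩ := R3 hp hpq hP (bot_le : ⊥ ≤ Q) hQ (by simpa using hcard) hcp hwc
    (hb c) hc1 (hb w) hw1 x hx
  rw [Subgroup.mem_bot] at ha
  subst ha
  simp [hbc]

/-- second rank lemma for sections -/
lemma E2 {p l l' r : ℕ} (hp : p.Prime) (hp2 : p ≠ 2) (hP : Prim p l l')
    (hr : r.Prime) (hr2 : r ≠ 2) (hrp : r ≠ p)
    {Q0 Q1 : Subgroup A} (h01 : Q0 ≤ Q1) (hab : ∀ x ∈ Q1, ∀ y ∈ Q1, x⁻¹ * y⁻¹ * x * y ∈ Q0)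
    (hq : ∀ x ∈ Q1, x ^ 2 ∈ Q0) (hcard : Nat.card Q1 < 2 ^ (2 * (p - 1)) * Nat.card Q0)
    {c w y : A} (hcp : c ^ p = 1) (hwc : w * c * w⁻¹ = c ^ l)
    (hc0 : c ∈ NN Q0) (hc1 : c ∈ NN Q1) (hw0 : w ∈ NN Q0) (hw1 : w ∈ NN Q1)
    (hy0 : y ∈ NN Q0) (hy1 : y ∈ NN Q1)
    (hfix : ∀ x ∈ Q1, x⁻¹ * c * x * c⁻¹ ∈ Q0 → x ∈ Q0) (hyr : ∀ x ∈ Q1, x⁻¹ * y ^ r * x * (y ^ r)⁻¹ ∈ Q0)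
    (hyc : y * c = c * y) (hyw : y * w = w * y) :
    ∀ x ∈ Q1, x⁻¹ * y * x * y⁻¹ ∈ Q0 := by
  haveI hn : (Q0.subgroupOf Q1).Normal := ⟨fun x hx y => by
    rw [Subgroup.mem_subgroupOf] at hx ⊢
    have h1 := hab (y : A)⁻¹ (inv_mem y.2) x⁻¹ (inv_mem x.2)
    have := Q0.mul_mem h1 hx
    convert this using 1
    simp [mul_assoc]⟩
  letI : CommGroup (Q1 ⧸ Q0.subgroupOf Q1) :=
    { QuotientGroup.Quotient.group (Q0.subgroupOf Q1) with
      mul_comm := by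
        intro a b
        induction a using QuotientGroup.induction_on with
        | H x =>
          induction b using QuotientGroup.induction_on with
          | H y =>
            rw [← QuotientGroup.mk_mul, ← QuotientGroup.mk_mul, sec_eq]
            have := hab y y.2 x x.2
            simpa [mul_assoc] using this }
  have hX : Nat.card (Q1 ⧸ Q0.subgroupOf Q1) < 2 ^ (2 * (p - 1)) := by
    rw [← sec_card h01] at hcard
    exact lt_of_mul_lt_mul_right hcard (Nat.zero_le _)
  intro x hx
  have hsw : ∀ b x : A, x⁻¹ * b * x * b⁻¹ ∈ Q0 ↔ (b * x * b⁻¹)⁻¹ * x ∈ Q0 := by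
    intro b x
    rw [← Q0.inv_mem_iff]
    simp [mul_assoc]
  have := E1 hp hp2 hP hr hr2 hrp hX (by
      intro a
      induction a using QuotientGroup.induction_on with
      | H x =>
        rw [← QuotientGroup.mk_pow, QuotientGroup.eq_one_iff, Subgroup.mem_subgroupOf]
        exact hq x x.2) (cmap c hc0 hc1) (cmap w hw0 hw1) (cmap y hy0 hy1)
    (by
      intro a
      induction a using QuotientGroup.induction_on with
      | H x => rw [cmap_iter]; simp [hcp])
    (by
      intro a
      induction a using QuotientGroup.induction_on with
      | H x =>
        rw [cmap_mk, cmap_mk, cmap_mk, cmap_iter]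
        congr 2
        simp only [← hwc]; group)
    (cmap_inj w hw0 hw1)
    (by
      intro a
      induction a using QuotientGroup.induction_on with
      | H x =>
        intro h
        rw [cmap_mk, sec_eq, ← hsw] at h
        rw [QuotientGroup.eq_one_iff, Subgroup.mem_subgroupOf]
        exact hfix x x.2 h)
    (by
      intro a
      induction a using QuotientGroup.induction_on with
      | H x =>
        rw [cmap_iter, sec_eq, ← hsw]
        exact hyr x x.2)
    (by
      intro a
      induction a using QuotientGroup.induction_on with
      | H x =>
        rw [cmap_mk, cmap_mk, cmap_mk, cmap_mk]
        congr 2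
        have e : ∀ u : A, c * (y * u * y⁻¹) * c⁻¹ = (c * y) * u * (c * y)⁻¹ := fun u => by group
        rw [e, ← hyc]; group)
    (by
      intro a
      induction a using QuotientGroup.induction_on with
      | H x =>
        rw [cmap_mk, cmap_mk, cmap_mk, cmap_mk]
        congr 2
        have e : ∀ u : A, w * (y * u * y⁻¹) * w⁻¹ = (w * y) * u * (w * y)⁻¹ := fun u => by group
        rw [e, ← hyw]; group)
    (QuotientGroup.mk ⟨x, hx⟩)
  rw [cmap_mk, sec_eq, ← hsw] at this
  exact this
end rr
end SP

namespace SP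
section b
variable {A : Type*} [Group A] [Finite A]

lemma prod_cover {S C H : Subgroup A} (hS : S ≤ H) (hle : C.relIndex H ≤ C.relIndex S) :
    ∀ x ∈ H, ∃ s ∈ S, ∃ y ∈ C, x = s * y := by
  intro x hx
  let e := Subgroup.quotientSubgroupOfEmbeddingOfLE C hS
  have hs : Function.Surjective e := by
    have : Function.Bijective e :=
      Nat.bijective_iff_injective_and_card _ |>.2 ⟨e.injective, le_antisymm
        (Nat.card_le_card_of_injective e e.injective) hle⟩
    exact this.2
  obtain ⟨y, hy⟩ := hs (QuotientGroup.mk ⟨x, hx⟩)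
  obtain ⟨s, rfl⟩ := QuotientGroup.mk_surjective y
  have h2 : (QuotientGroup.mk (⟨s, hS s.2⟩ : H) : H ⧸ C.subgroupOf H) = QuotientGroup.mk ⟨x, hx⟩ := hy
  rw [sec_eq] at h2
  exact ⟨s, s.2, _, h2, by simp⟩

lemma relIndex_mul_card {C H : Subgroup A} (h : C ≤ H) : C.relIndex H * Nat.card C = Nat.card H :=
  sec_card h

lemma factorization_mul_pow {q k m : ℕ} (hq : q.Prime) (hm : m ≠ 0) :
    (q ^ k * m).factorization q = k + m.factorization q := by
  rw [Nat.factorization_mul (pow_ne_zero _ hq.ne_zero) hm, Nat.Prime.factorization_pow hq]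
  simp

lemma card_ne (Q : Subgroup A) : Nat.card Q ≠ 0 := Nat.card_pos.ne'

lemma pgroup_card_le {q : ℕ} [Fact q.Prime] {R H : Subgroup A} (h : R ≤ H) (hR : IsPGroup q R) :
    Nat.card R ≤ q ^ (Nat.card H).factorization q := by
  obtain ⟨Q, hQ, hRQ⟩ := exists_isSyl_ge h hR
  rw [← hQ.2]
  exact Subgroup.card_le_of_le hRQ

lemma TR {q k : ℕ} [Fact q.Prime] {S C H : Subgroup A} (hC : C ≤ H) (hS : IsSyl q H S)
    (hk : Nat.card H = q ^ k * Nat.card C) :  ∀ x ∈ H, ∃ s ∈ S, ∃ y ∈ C, x = s * y := by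
  apply prod_cover hS.1
  have h1 : C.relIndex H = q ^ k := by
    have := relIndex_mul_card hC
    rw [hk] at this
    exact Nat.eq_of_mul_eq_mul_right Nat.card_pos this
  have h2 : C.relIndex S * Nat.card (C ⊓ S : Subgroup A) = Nat.card S := by
    rw [← Subgroup.inf_relIndex_right]
    exact relIndex_mul_card inf_le_right
  have h3 : Nat.card (C ⊓ S : Subgroup A) ≤ q ^ (Nat.card C).factorization q :=
    pgroup_card_le inf_le_left (hS.isPGroup.to_le inf_le_right)
  have h4 : Nat.card S = q ^ k * q ^ (Nat.card C).factorization q := by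
    rw [hS.2, hk, factorization_mul_pow Fact.out (card_ne C), pow_add]
  rw [h1]
  by_contra hlt
  rw [not_le] at hlt
  have := Nat.mul_lt_mul_of_lt_of_le hlt h3 (pow_pos (Fact.out : q.Prime).pos _)
  rw [h2, h4] at this
  exact lt_irrefl _ this

lemma T1 {G : Type*} [Group G] [Finite G] {p : ℕ} (hp : p.Prime)
    (hv : (Nat.card G).factorization p ≤ 2) {t : G} (ht : ∀ x, t * x = x * t) (htp : t ^ p = 1)
    (htc : t ∈ commutator G) : t = 1 := by
  haveI := Fact.mk hp
  obtain ⟨P⟩ : Nonempty (Sylow p G) := inferInstance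
  have hcP := P.card_eq_multiplicity
  have hcomm : ∀ a b : P, a * b = b * a := by
    rcases Nat.lt_or_ge ((Nat.card G).factorization p) 2 with h | h
    · have h3 : Nat.card P = 1 ∨ Nat.card P = p := by
        interval_cases h' : (Nat.card G).factorization p
        · left; simpa using hcP
        · right; simpa using hcP
      rcases h3 with h3 | h3
      · intro a b
        haveI := (Nat.card_eq_one_iff_unique.1 h3).1
        exact Subsingleton.elim _ _
      · haveI := isCyclic_of_prime_card h3
        exact fun a b => (IsCyclic.commutative (α := P)).is_comm.comm a b
    · rw [le_antisymm hv h] at hcP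
      have := IsPGroup.isMulCommutative_of_card_eq_prime_sq hcP
      exact fun a b => this.is_comm.comm a b
  letI : CommGroup P := { (inferInstance : Group P) with mul_comm := hcomm }
  have h1 := MonoidHom.transfer_eq_pow (MonoidHom.id P) t (fun k g₀ _ => by
    have : Commute (t ^ k) g₀ := Commute.pow_left (ht g₀) k
    rw [mul_assoc, this.eq, inv_mul_cancel_left])
  have h2 : MonoidHom.transfer (MonoidHom.id P) t = 1 := by
    have : commutator G ≤ (MonoidHom.transfer (MonoidHom.id P)).ker := Abelianization.commutator_subset_ker _
    exact this htc
  rw [h2] at h1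
  have h3 : t ^ (P : Subgroup G).index = 1 := (congrArg Subtype.val h1).symm
  have h4 := Nat.dvd_gcd (orderOf_dvd_of_pow_eq_one htp) (orderOf_dvd_of_pow_eq_one h3)
  have h5 : Nat.Coprime p (P : Subgroup G).index :=
    (Nat.Prime.coprime_iff_not_dvd hp).2 P.not_dvd_index
  rw [h5] at h4
  exact orderOf_eq_one_iff.1 (Nat.dvd_one.1 h4)

lemma T1sub {p : ℕ} (hp : p.Prime) (hv : (Nat.card A).factorization p ≤ 2) {C : Subgroup A} {t : A}
    (ht : ∀ x ∈ C, t * x = x * t) (htp : t ^ p = 1) (htc : t ∈ ⁅C, C⁆) : t = 1 := by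
  rw [← Subgroup.map_subtype_commutator] at htc
  obtain ⟨s, hs, rfl⟩ := htc
  have := T1 (G := C) hp ?_ (t := s) (fun x => Subtype.ext (ht x x.2)) (Subtype.ext htp) hs
  · rw [this]; rfl
  · exact le_trans ((Nat.factorization_le_iff_dvd (card_ne C) Nat.card_pos.ne').2
      (Subgroup.card_subgroup_dvd_card C) p) hv

lemma S6 {p : ℕ} (hp : p.Prime) {H P : Subgroup A} (hP : IsSyl p H P)
    (hN : ∀ x ∈ H, x ∈ NN P → x ∈ CS P) : ∃ D : Subgroup A, D ≤ H ∧ ¬ p ∣ Nat.card D ∧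
      Nat.card H = Nat.card D * Nat.card P ∧ (∀ x ∈ H, ¬ p ∣ orderOf x → x ∈ D) ∧
      ∀ b, b ∈ NN H → b ∈ NN D := by
  haveI := Fact.mk hp
  obtain ⟨S, rfl⟩ := isSyl_iff.1 hP
  have hle : Subgroup.normalizer ((S : Subgroup H) : Set H) ≤ Subgroup.centralizer ((S : Subgroup H) : Set H) := by
    intro x hx
    rw [Subgroup.mem_centralizer_iff]
    intro y hy
    have := hN x x.2 (mem_nm ?_)
    · have := mem_CS.1 this y ⟨y, hy, rfl⟩
      exact Subtype.ext this.symm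
    · rintro _ ⟨z, hz, rfl⟩
      exact ⟨x * z * x⁻¹, (Subgroup.mem_normalizer_iff.1 hx z).1 hz, rfl⟩
  set τ := MonoidHom.transferSylow S hle
  have hcard : Nat.card (τ.ker.map H.subtype) = Nat.card τ.ker :=
    (Nat.card_congr (τ.ker.equivMapOfInjective _ H.subtype_injective).toEquiv).symm
  have hnd : ¬ p ∣ Nat.card (τ.ker.map H.subtype) := by
    rw [hcard]; exact MonoidHom.not_dvd_card_ker_transferSylow S hle
  have hall : ∀ x ∈ H, ¬ p ∣ orderOf x → x ∈ τ.ker.map H.subtype := by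
    intro x hx hox
    refine ⟨⟨x, hx⟩, ?_, rfl⟩
    have h1 : orderOf (τ ⟨x, hx⟩) ∣ orderOf x := by
      rw [← Subgroup.orderOf_mk x hx]; exact orderOf_map_dvd τ _
    obtain ⟨k, hk⟩ := (IsPGroup.iff_orderOf.1 S.2) (τ ⟨x, hx⟩)
    rcases Nat.eq_zero_or_pos k with h0 | h0
    · rw [h0, pow_zero] at hk
      exact orderOf_eq_one_iff.1 hk
    · exact absurd ((dvd_pow_self p h0.ne').trans (hk ▸ h1)) hox
  have hle2 : τ.ker.map H.subtype ≤ H := Subgroup.map_subtype_le _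
  refine ⟨τ.ker.map H.subtype, hle2, hnd, ?_, hall, ?_⟩
  · rw [hcard, ← (MonoidHom.ker_transferSylow_isComplement' S hle).card_mul_card]
    congr 1
    exact Nat.card_congr ((S : Subgroup H).equivMapOfInjective _ H.subtype_injective).toEquiv
  · intro b hb
    apply mem_nm
    intro x hx
    apply hall _ (nm_conj hb (hle2 hx))
    intro h
    have h1 : orderOf (b * x * b⁻¹) = orderOf x := by
      have := orderOf_injective (MulAut.conj b).toMonoidHom (MulAut.conj b).injective x
      simpa using this
    rw [h1] at h
    exact hnd (h.trans (Subgroup.orderOf_dvd_natCard _ hx))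

end b
end SP

namespace SP

lemma pow_swap0 {G : Type*} [Group G] {g u v : G} {a b : ℕ} (hu : u * g * u⁻¹ = g ^ a)
    (hv : v * g * v⁻¹ = g ^ b) : u⁻¹ * v⁻¹ * u * v * g = g * (u⁻¹ * v⁻¹ * u * v) := by
  have h1 : (u * v) * g * (u * v)⁻¹ = (v * u) * g * (v * u)⁻¹ := by
    calc (u * v) * g * (u * v)⁻¹ = u * (v * g * v⁻¹) * u⁻¹ := by group
      _ = (u * g * u⁻¹) ^ b := by rw [hv, conj_pow]
      _ = (v * g * v⁻¹) ^ a := by rw [hu, hv, ← pow_mul, ← pow_mul, mul_comm]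
      _ = v * (u * g * u⁻¹) * v⁻¹ := by rw [hu, conj_pow]
      _ = _ := by group
  have hx : (v * u)⁻¹ * ((u * v)) * g = g * ((v * u)⁻¹ * (u * v)) := by
    have : (u * v) * g = (v * u) * g * (v * u)⁻¹ * (u * v) := by rw [← h1]; group
    calc (v * u)⁻¹ * ((u * v)) * g = (v * u)⁻¹ * ((u * v) * g) := by group
      _ = _ := by rw [this]; group
  simpa [mul_assoc] using hx

section
variable {A : Type*} [Group A] [Finite A]

lemma mi {H K : Subgroup A} {x : A} (h1 : x ∈ H) (h2 : x ∈ K) : x ∈ H ⊓ K := Subgroup.mem_inf.2 ⟨h1, h2⟩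
lemma cc1 (m x : A) : m⁻¹ * (m * x * m⁻¹) * m = x := by group
lemma cc2 (m x : A) : m * (m⁻¹ * x * m) * m⁻¹ = x := by group
lemma mik {S : Type*} [Group S] {π : A →* S} {x : A} (h : π x = 1) : x ∈ π.ker := h

lemma zp_pgroup {p : ℕ} (hp : p.Prime) {x : A} (hxp : x ^ p = 1) : IsPGroup p (Subgroup.zpowers x) := by
  have hd : Nat.card (Subgroup.zpowers x) ∣ p ^ 1 := by
    rw [Nat.card_zpowers, pow_one]; exact orderOf_dvd_of_pow_eq_one hxp
  haveI := Fact.mk hp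
  obtain ⟨k, hk, hk2⟩ := (Nat.dvd_prime_pow hp).1 hd
  exact IsPGroup.of_card hk2

lemma mem_pow_of_card {p : ℕ} (hp : p.Prime) {P : Subgroup A} (hP : Nat.card P = p) {t x : A}
    (ht : t ∈ P) (ht1 : t ≠ 1) (hx : x ∈ P) : ∃ k : ℕ, x = t ^ k := by
  haveI := Fact.mk hp
  have h1 : (⟨t, ht⟩ : P) ≠ 1 := fun h => ht1 (congrArg Subtype.val h)
  have h2 := zpowers_eq_top_of_prime_card hP h1
  have h3 : (⟨x, hx⟩ : P) ∈ Subgroup.zpowers (⟨t, ht⟩ : P) := h2 ▸ Subgroup.mem_top _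
  obtain ⟨k, hk⟩ := (mem_powers_iff_mem_zpowers).2 h3
  exact ⟨k, by simpa using (congrArg Subtype.val hk).symm⟩

lemma exists_gen {p : ℕ} (hp : p.Prime) {P : Subgroup A} (hP : Nat.card P = p) :
    ∃ t ∈ P, t ≠ 1 := by
  have : 1 < Nat.card P := hP ▸ hp.one_lt
  obtain ⟨a, ha⟩ := @exists_ne P (Finite.one_lt_card_iff_nontrivial.1 this) 1
  exact ⟨a, a.2, fun h => ha (Subtype.ext h)⟩

lemma pow_card_eq {p : ℕ} {P : Subgroup A} (hP : Nat.card P = p) {t : A} (ht : t ∈ P) : t ^ p = 1 := by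
  have := pow_card_eq_one' (x := (⟨t, ht⟩ : P))
  rw [hP] at this
  exact congrArg Subtype.val this

lemma le_CS_self {p : ℕ} (hp : p.Prime) {P : Subgroup A} (hP : Nat.card P = p) : P ≤ CS P := by
  obtain ⟨t, ht, ht1⟩ := exists_gen hp hP
  intro x hx
  rw [mem_CS]
  intro y hy
  obtain ⟨k, rfl⟩ := mem_pow_of_card hp hP ht ht1 hx
  obtain ⟨j, rfl⟩ := mem_pow_of_card hp hP ht ht1 hy
  rw [← pow_add, ← pow_add, add_comm]

lemma CS_of_comm {p : ℕ} (hp : p.Prime) {P : Subgroup A} (hP : Nat.card P = p) {t x : A}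
    (ht : t ∈ P) (ht1 : t ≠ 1) (h : x * t = t * x) : x ∈ CS P := by
  rw [mem_CS]
  intro y hy
  obtain ⟨j, rfl⟩ := mem_pow_of_card hp hP ht ht1 hy
  exact (Commute.pow_right h j)

lemma comm_nm_CS {p : ℕ} (hp : p.Prime) {P : Subgroup A} (hP : Nat.card P = p) :
    ⁅NN P, NN P⁆ ≤ CS P := by
  rw [Subgroup.commutator_le]
  intro u hu v hv
  obtain ⟨t, ht, ht1⟩ := exists_gen hp hP
  obtain ⟨a, ha⟩ := mem_pow_of_card hp hP ht ht1 (nm_conj (inv_mem hu) ht)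
  obtain ⟨b, hb⟩ := mem_pow_of_card hp hP ht ht1 (nm_conj (inv_mem hv) ht)
  have := pow_swap0 ha hb
  simp only [inv_inv] at this
  exact CS_of_comm hp hP ht ht1 (by simpa [commutatorElement_def] using this)

lemma NN_CS {P : Subgroup A} {b : A} (hb : b ∈ NN P) : b ∈ NN (CS P) := by
  apply mem_nm
  intro x hx
  rw [mem_CS] at hx ⊢
  intro y hy
  have := hx _ (nm_conj' hb hy)
  calc b * x * b⁻¹ * y = b * (x * (b⁻¹ * y * b)) * b⁻¹ := by group
    _ = _ := by rw [this]; group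

lemma NN_comm {P : Subgroup A} {b : A} (hb : b ∈ NN P) : b ∈ NN ⁅P, P⁆ := by
  apply mem_nm
  have : ⁅P, P⁆ ≤ (⁅P, P⁆).comap (MulAut.conj b).toMonoidHom := by
    rw [Subgroup.commutator_le]
    intro u hu v hv
    rw [Subgroup.mem_comap]
    rw [map_commutatorElement]
    exact Subgroup.commutator_mem_commutator (nm_conj hb hu) (nm_conj hb hv)
  intro x hx
  exact this hx

lemma comm_le (P : Subgroup A) : ⁅P, P⁆ ≤ P := by
  rw [Subgroup.commutator_le]
  intro u hu v hv
  exact mul_mem (mul_mem (mul_mem hu hv) (inv_mem hu)) (inv_mem hv)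

lemma IsSyl.mono {q : ℕ} [Fact q.Prime] {H K Q : Subgroup A} (h : IsSyl q K Q) (h1 : Q ≤ H) (h2 : H ≤ K) :
    IsSyl q H Q := by
  refine ⟨h1, le_antisymm (pgroup_card_le h1 h.isPGroup) ?_⟩
  rw [h.2]
  apply Nat.pow_le_pow_right (Fact.out : q.Prime).pos
  exact (Nat.factorization_le_iff_dvd (card_ne H) (card_ne K)).2 (Subgroup.card_dvd_of_le h2) q

lemma NN_inf' {H K : Subgroup A} {b : A} (h : b ∈ NN H) (h' : b ∈ NN K) : b ∈ NN (H ⊓ K) :=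
  mem_nm fun x hx => ⟨nm_conj h hx.1, nm_conj h' hx.2⟩

lemma IsSyl.eq_of_normal {q : ℕ} [Fact q.Prime] {H P R : Subgroup A} (h : IsSyl q H P) (hn : H ≤ NN P)
    (hR : R ≤ H) (hRp : IsPGroup q R) : R ≤ P := by
  obtain ⟨Q, hQ, hRQ⟩ := exists_isSyl_ge hR hRp
  obtain ⟨m, hm, hx⟩ := isSyl_conj h hQ
  intro x hxR
  have := (hx x).1 (hRQ hxR)
  have := nm_conj (hn hm) this
  have e : m * (m⁻¹ * x * m) * m⁻¹ = x := by group
  rwa [e] at this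
end

structure ST {A S : Type*} [Group A] [Finite A] [Group S] [Finite S] (π : A →* S) (p l l' : ℕ)
    (σ ω : S) (Al : Subgroup S) : Prop where
  surj : Function.Surjective π
  hp : p.Prime
  hp5 : 5 ≤ p
  vN : (Nat.card π.ker).factorization p = 1
  vA : (Nat.card A).factorization p = 2
  prim : Prim p l l'
  sp : σ ^ p = 1
  s1 : σ ≠ 1
  ws : ω * σ * ω⁻¹ = σ ^ l
  per : ⁅Al, Al⁆ = Al
  sA : σ ∈ Al
  nor : ∀ M : Subgroup S, M.Normal → σ ∈ M → Al ≤ M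
  odd : ∀ q, q.Prime → q ≠ p → q ≠ 2 → (Nat.card π.ker).factorization q < p - 1
  two : (Nat.card π.ker).factorization 2 < 2 * (p - 1)

def ZT {A S : Type*} [Group A] [Group S] (π : A →* S) (p : ℕ) (σ : S) (z : A) : Prop :=
  z ^ p = 1 ∧ π z = σ ∧ ∃ P : Subgroup A, P ≤ π.ker ∧ Nat.card P = p ∧ z ∈ ⁅CS P, CS P⁆

structure ED {A S : Type*} [Group A] [Group S] (π : A →* S) (p : ℕ) (σ : S) (c : A) (P : Subgroup A) (z : A) : Prop where
  PN : P ≤ π.ker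
  cP : Nat.card P = p
  cC : c ∈ CS P
  cp : c ^ p = 1
  zG : z ∈ ⁅CS P, CS P⁆
  zp : z ^ p = 1
  zs : π z = σ
  cz : c * z = z * c
  tP : z⁻¹ * c ∈ P

section
variable {A S : Type*} [Group A] [Finite A] [Group S] [Finite S] {π : A →* S} {p l l' : ℕ}
    {σ ω : S} {Al : Subgroup S}

lemma ker_nm (π : A →* S) (a : A) : a ∈ NN π.ker := by
  apply mem_nm; intro x hx
  rw [MonoidHom.mem_ker] at hx ⊢; simp [hx]

lemma syl_of (h : ST π p l l' σ ω Al) {P : Subgroup A} (h1 : P ≤ π.ker) (h2 : Nat.card P = p) :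
    IsSyl p π.ker P := ⟨h1, by rw [h.vN, pow_one, h2]⟩

lemma card_of (h : ST π p l l' σ ω Al) {P : Subgroup A} (h1 : IsSyl p π.ker P) : Nat.card P = p := by
  rw [h1.2, h.vN, pow_one]

lemma LemP (h : ST π p l l' σ ω Al) {P : Subgroup A} (h1 : P ≤ π.ker) (h2 : Nat.card P = p) {x : A}
    (hx : x ∈ π.ker) (hxp : x ^ p = 1) (hxc : x ∈ CS P) : x ∈ P := by
  haveI := Fact.mk h.hp
  have hs := (syl_of h h1 h2).mono (H := π.ker ⊓ CS P) (le_inf h1 (le_CS_self h.hp h2)) inf_le_left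
  have := hs.eq_of_normal (R := Subgroup.zpowers x) (inf_le_right.trans (CS_le_NN P))
    (by rw [Subgroup.zpowers_le]; exact ⟨hx, hxc⟩) ?_
  · exact this (Subgroup.mem_zpowers x)
  · exact zp_pgroup h.hp hxp

lemma L0 (h : ST π p l l' σ ω Al) {B : Subgroup A} (hB : ¬ p ∣ Nat.card (B ⊓ π.ker : Subgroup A)) {b : A} (hb : b ∈ B)
    (hbs : π b = σ) : ∃ c ∈ B, c ^ p = 1 ∧ π c = σ ∧ ∀ y, y * b = b * y → y * c = c * y := by
  obtain ⟨k, hk, hk1⟩ := LA h.hp hB (y := b) (mi (pow_mem hb _) (mik (by rw [map_pow, hbs, h.sp])))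
  exact ⟨b ^ k, pow_mem hb _, hk, by rw [map_pow, hbs]; exact pow_mod h.sp hk1,
    fun y hy => Commute.pow_right hy k⟩

lemma L1 (hp : p.Prime) {G : Subgroup A} (hG : ¬ p ∣ Nat.card (G ⊓ π.ker : Subgroup A)) {c c' : A} (hc : c ∈ G)
    (hc' : c' ∈ G) (hcp : c ^ p = 1) (hcp' : c' ^ p = 1) (he : π c' = π c) :
    ∃ m ∈ G ⊓ π.ker, c' = m * c * m⁻¹ :=
  LB hp hG (NN_inf' (le_NN _ hc) (ker_nm π c)) hcp hcp'
    (mi (mul_mem hc' (inv_mem hc)) (mik (by simp [he])))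

lemma L2 (h : ST π p l l' σ ω Al) {G : Subgroup A} (hG : ¬ p ∣ Nat.card (G ⊓ π.ker : Subgroup A)) {c u : A} (hc : c ∈ G)
    (hcp : c ^ p = 1) (hcs : π c = σ) (hu : u ∈ NN G) (hus : π u = ω) :
    ∃ m ∈ G ⊓ π.ker, (m * u) * c * (m * u)⁻¹ = c ^ l := by
  obtain ⟨m, hm, e⟩ := L1 h.hp hG (c := c ^ l) (c' := u * c * u⁻¹) (π := π) (pow_mem hc l) (nm_conj hu hc)
    (by rw [← pow_mul, mul_comm, pow_mul, hcp, one_pow]) (by rw [conj_pow, hcp]; simp)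
    (by simp [hus, hcs, h.ws])
  refine ⟨m⁻¹, inv_mem hm, ?_⟩
  calc m⁻¹ * u * c * (m⁻¹ * u)⁻¹ = m⁻¹ * (u * c * u⁻¹) * m := by group
    _ = _ := by rw [e]; group

lemma GPN (h : ST π p l l' σ ω Al) {P : Subgroup A} (h1 : P ≤ π.ker) (h2 : Nat.card P = p) :
    ¬ p ∣ Nat.card (⁅CS P, CS P⁆ ⊓ π.ker : Subgroup A) := by
  intro hd
  haveI := Fact.mk h.hp
  obtain ⟨x, hx⟩ := exists_prime_orderOf_dvd_card' p hd
  have hxp : (x : A) ^ p = 1 := by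
    have := pow_orderOf_eq_one x
    rw [hx] at this
    exact congrArg Subtype.val this
  have hxC : (x : A) ∈ CS P := comm_le _ x.2.1
  have hxP := LemP h h1 h2 x.2.2 hxp hxC
  have := T1sub h.hp h.vA.le (C := CS P) (t := x) (fun y hy => (mem_CS.1 hy _ hxP).symm) hxp x.2.1
  have hx1 : x = 1 := Subtype.ext this
  rw [hx1, orderOf_one] at hx
  exact h.hp.one_lt.ne hx

lemma not_dvd_mono {H K : Subgroup A} (h : ¬ p ∣ Nat.card K) (hle : H ≤ K) : ¬ p ∣ Nat.card H :=
  fun hd => h (hd.trans (Subgroup.card_dvd_of_le hle))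

lemma Fr (π : A →* S) {q : ℕ} [Fact q.Prime] {B Q : Subgroup A} (hB : B.map π = ⊤) (hQ : IsSyl q (B ⊓ π.ker) Q) (s : S) :
    ∃ b ∈ B, b ∈ NN Q ∧ π b = s := by
  have : s ∈ B.map π := hB ▸ Subgroup.mem_top s
  obtain ⟨b, hb, rfl⟩ := this
  obtain ⟨m, hm, hmb⟩ := frattini hQ (NN_inf' (le_NN _ hb) (ker_nm π b))
  refine ⟨m * b, mul_mem hm.1 hb, hmb, ?_⟩
  rw [map_mul, MonoidHom.mem_ker.1 hm.2, one_mul]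

lemma PG (h : ST π p l l' σ ω Al) {B P : Subgroup A} (hB : B.map π = ⊤) (hPB : P ≤ B) (h1 : P ≤ π.ker) (h2 : Nat.card P = p) :
    Al ≤ (⁅B ⊓ CS P, B ⊓ CS P⁆).map π := by
  haveI := Fact.mk h.hp
  have hs := (syl_of h h1 h2).mono (H := B ⊓ π.ker) (le_inf hPB h1) inf_le_right
  have e1 : (B ⊓ NN P).map π = ⊤ := by
    rw [eq_top_iff]
    intro s _
    obtain ⟨b, hb, hb2, e⟩ := Fr π hB hs s
    exact ⟨b, ⟨hb, hb2⟩, e⟩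
  have e2 : ⁅B ⊓ NN P, B ⊓ NN P⁆ ≤ B ⊓ CS P :=
    le_inf ((comm_le _).trans inf_le_left)
      ((Subgroup.commutator_mono inf_le_right inf_le_right).trans (comm_nm_CS h.hp h2))
  have e3 : Al ≤ (B ⊓ CS P).map π := by
    refine le_trans ?_ (Subgroup.map_mono e2)
    rw [Subgroup.map_commutator, e1, ← h.per]
    exact Subgroup.commutator_mono le_top le_top
  rw [Subgroup.map_commutator, ← h.per]
  exact Subgroup.commutator_mono e3 e3

lemma exists_P (h : ST π p l l' σ ω Al) {B : Subgroup A} (hd : p ∣ Nat.card (B ⊓ π.ker : Subgroup A)) :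
    ∃ P : Subgroup A, P ≤ B ∧ P ≤ π.ker ∧ Nat.card P = p := by
  haveI := Fact.mk h.hp
  obtain ⟨x, hx⟩ := exists_prime_orderOf_dvd_card' p hd
  refine ⟨Subgroup.zpowers (x : A), ?_, ?_, ?_⟩
  · rw [Subgroup.zpowers_le]; exact x.2.1
  · rw [Subgroup.zpowers_le]; exact x.2.2
  · rw [Nat.card_zpowers, ← hx, Subgroup.orderOf_coe]

lemma exists_z (h : ST π p l l' σ ω Al) {B P : Subgroup A} (hB : B.map π = ⊤) (hPB : P ≤ B) (h1 : P ≤ π.ker) (h2 : Nat.card P = p) :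
    ∃ z ∈ ⁅B ⊓ CS P, B ⊓ CS P⁆, z ^ p = 1 ∧ π z = σ := by
  obtain ⟨b, hb, hbs⟩ := PG h hB hPB h1 h2 h.sA
  obtain ⟨c, h3, h4, h5, -⟩ := L0 h (not_dvd_mono (GPN h h1 h2) (inf_le_inf_right _ (Subgroup.commutator_mono inf_le_right inf_le_right))) hb hbs
  exact ⟨c, h3, h4, h5⟩

lemma Q1 (h : ST π p l l' σ ω Al) {B : Subgroup A} (hB : B.map π = ⊤) (hd : p ∣ Nat.card (B ⊓ π.ker : Subgroup A)) :
    ∃ z ∈ B, ZT π p σ z ∧ ∃ w ∈ B, π w = ω ∧ w * z * w⁻¹ = z ^ l := by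
  haveI := Fact.mk h.hp
  obtain ⟨P, hPB, h1, h2⟩ := exists_P h hd
  obtain ⟨z, hz, hzp, hzs⟩ := exists_z h hB hPB h1 h2
  have hs := (syl_of h h1 h2).mono (H := B ⊓ π.ker) (le_inf hPB h1) inf_le_right
  obtain ⟨b, hb, hb2, e⟩ := Fr π hB hs ω
  have hle : ⁅B ⊓ CS P, B ⊓ CS P⁆ ≤ ⁅CS P, CS P⁆ := Subgroup.commutator_mono inf_le_right inf_le_right
  obtain ⟨m, hm, e2⟩ := L2 h (not_dvd_mono (GPN h h1 h2) (inf_le_inf_right _ hle)) hz hzp hzs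
    (NN_comm (NN_inf' (le_NN _ hb) (NN_CS hb2))) e
  refine ⟨z, (comm_le _ hz).1, ⟨hzp, hzs, P, h1, h2, hle hz⟩, m * b, mul_mem (comm_le _ hm.1).1 hb, ?_, e2⟩
  rw [map_mul, MonoidHom.mem_ker.1 hm.2, one_mul, e]

lemma mem_conj_comm {P P' : Subgroup A} {m : A} (hm : ∀ x, x ∈ P' ↔ m⁻¹ * x * m ∈ P) {z : A} (hz : z ∈ ⁅CS P, CS P⁆) :
    m * z * m⁻¹ ∈ ⁅CS P', CS P'⁆ := by
  have hc : ∀ x ∈ CS P, m * x * m⁻¹ ∈ CS P' := by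
    intro x hx
    rw [mem_CS] at hx ⊢
    intro y hy
    have := hx _ ((hm y).1 hy)
    calc m * x * m⁻¹ * y = m * (x * (m⁻¹ * y * m)) * m⁻¹ := by group
      _ = _ := by rw [this]; group
  have : ⁅CS P, CS P⁆ ≤ (⁅CS P', CS P'⁆).comap (MulAut.conj m).toMonoidHom := by
    rw [Subgroup.commutator_le]
    intro u hu v hv
    rw [Subgroup.mem_comap, map_commutatorElement]
    exact Subgroup.commutator_mem_commutator (hc _ hu) (hc _ hv)
  exact this hz

lemma ZTconj {z m : A} (hz : ZT π p σ z) (hm : m ∈ π.ker) : ZT π p σ (m * z * m⁻¹) := by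
  obtain ⟨h1, h2, P, h3, h4, h5⟩ := hz
  refine ⟨by rw [conj_pow, h1]; simp, by simp [MonoidHom.mem_ker.1 hm, h2], cj m P, ?_, ?_, ?_⟩
  · intro x hx
    rw [mem_cj] at hx
    have := nm_conj (ker_nm π m) (h3 hx)
    have e : m * (m⁻¹ * x * m) * m⁻¹ = x := by group
    rwa [e] at this
  · rw [card_cj, h4]
  · exact mem_conj_comm (fun x => mem_cj) h5

lemma ZC (h : ST π p l l' σ ω Al) {z z' : A} (hz : ZT π p σ z) (hz' : ZT π p σ z') :
    ∃ m ∈ π.ker, z' = m * z * m⁻¹ := by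
  haveI := Fact.mk h.hp
  obtain ⟨h1, h2, P, h3, h4, h5⟩ := hz
  obtain ⟨h1', h2', P', h3', h4', h5'⟩ := hz'
  obtain ⟨m, hm, hx⟩ := isSyl_conj (syl_of h h3 h4) (syl_of h h3' h4')
  obtain ⟨k, hk, e⟩ := L1 h.hp (GPN h h3' h4') (c := m * z * m⁻¹) (mem_conj_comm hx h5) h5'
    (by rw [conj_pow, h1]; simp) h1' (by simp [MonoidHom.mem_ker.1 hm, h2, h2'])
  exact ⟨k * m, mul_mem hk.2 hm, by rw [e]; group⟩

lemma exE (h : ST π p l l' σ ω Al) {c : A} (hcp : c ^ p = 1) (hcs : π c = σ) : ∃ P z, ED π p σ c P z := by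
  haveI := Fact.mk h.hp
  have hzp : IsPGroup p (Subgroup.zpowers c) := zp_pgroup h.hp hcp
  obtain ⟨R, hR, hcR⟩ := exists_isSyl_ge (le_top : Subgroup.zpowers c ≤ ⊤) hzp
  obtain ⟨P0, hP0⟩ := exists_isSyl p π.ker
  obtain ⟨R', hR', hP0R⟩ := exists_isSyl_ge (le_top : P0 ≤ ⊤) hP0.isPGroup
  obtain ⟨m, -, hm⟩ := isSyl_conj hR' hR
  have hc2 : Nat.card R = p ^ 2 := by rw [hR.2, Subgroup.card_top, h.vA]
  have hP : Nat.card (R ⊓ π.ker : Subgroup A) = p := by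
    apply le_antisymm
    · have := pgroup_card_le (inf_le_right : R ⊓ π.ker ≤ π.ker) (hR.isPGroup.to_le inf_le_left)
      rwa [h.vN, pow_one] at this
    · have : cj m P0 ≤ R ⊓ π.ker := by
        intro x hx
        rw [mem_cj] at hx
        refine ⟨(hm x).2 (hP0R hx), ?_⟩
        have := nm_conj (ker_nm π m) (hP0.1 hx)
        have e : m * (m⁻¹ * x * m) * m⁻¹ = x := by group
        rwa [e] at this
      have := Subgroup.card_le_of_le this
      rwa [card_cj, card_of h hP0] at this
  have hcomm : ∀ x ∈ R, ∀ y ∈ R, x * y = y * x := by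
    intro x hx y hy
    have := (IsPGroup.isMulCommutative_of_card_eq_prime_sq hc2).is_comm.comm (⟨x, hx⟩ : R) ⟨y, hy⟩
    exact congrArg Subtype.val this
  have hcR' : c ∈ R := hcR (Subgroup.mem_zpowers c)
  set P := R ⊓ π.ker with hPdef
  have hcC : c ∈ CS P := mem_CS.2 fun x hx => hcomm _ hcR' _ hx.1
  have hPN : P ≤ π.ker := inf_le_right
  obtain ⟨z, hz, hzp, hzs⟩ := exists_z h (B := ⊤) (P := P) (by rw [← MonoidHom.range_eq_map]; exact MonoidHom.range_eq_top.2 h.surj) le_top hPN hP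
  rw [top_inf_eq] at hz
  have hcG := NN_comm (le_NN _ hcC)
  obtain ⟨y, hy, hyc⟩ := LC h.hp (GPN h hPN hP) (NN_inf' hcG (ker_nm π c)) hcp (x := z)
    (mi (by
      have := mul_mem (inv_mem hz) (nm_conj hcG hz)
      have e : z⁻¹ * c * z * c⁻¹ = z⁻¹ * (c * z * c⁻¹) := by group
      rwa [e]) (mik (by simp [hzs, hcs])))
  obtain ⟨z', hz', hzp', hzs', hcc⟩ := L0 h (GPN h hPN hP) (b := z * y) (mul_mem hz hy.1)
    (by rw [map_mul, hzs, MonoidHom.mem_ker.1 hy.2, mul_one])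
  have hcz := hcc c hyc.symm
  refine ⟨P, z', hPN, hP, hcC, hcp, hz', hzp', hzs', hcz, ?_⟩
  apply LemP h hPN hP
  · rw [MonoidHom.mem_ker]; simp [hzs', hcs]
  · have : Commute z'⁻¹ c := Commute.inv_left (show Commute z' c from hcz.symm)
    rw [this.mul_pow, inv_pow, hzp', hcp]; simp
  · exact mul_mem (inv_mem (comm_le _ hz')) hcC

lemma ED.zt {c z : A} {P : Subgroup A} (e : ED π p σ c P z) : ZT π p σ z :=
  ⟨e.zp, e.zs, P, e.PN, e.cP, e.zG⟩

lemma ED.ne {c z : A} {P : Subgroup A} (e : ED π p σ c P z) (hc : ¬ ZT π p σ c) : z⁻¹ * c ≠ 1 := by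
  intro h
  have : c = z := by rw [inv_mul_eq_one] at h; exact h.symm
  exact hc (this ▸ e.zt)

lemma ED.cs (h : ST π p l l' σ ω Al) {c z : A} {P : Subgroup A} (e : ED π p σ c P z) : π c = σ := by
  have := MonoidHom.mem_ker.1 (e.PN e.tP)
  rw [map_mul, map_inv, e.zs, inv_mul_eq_one] at this
  exact this.symm

lemma D1 (h : ST π p l l' σ ω Al) {c z : A} {P : Subgroup A} (e : ED π p σ c P z) (hc : z⁻¹ * c ≠ 1) {x : A} (hx : x ∈ π.ker)
    (hxc : x * c = c * x) (hxP : x ∈ NN P) : x ∈ CS P := by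
  have hxG := NN_comm (NN_CS hxP)
  have hzC := comm_le _ e.zG
  have h1 : x * z * x⁻¹ * z⁻¹ ∈ ⁅CS P, CS P⁆ ⊓ π.ker :=
    mi (mul_mem (nm_conj hxG e.zG) (inv_mem e.zG)) (mik (by simp [MonoidHom.mem_ker.1 hx]))
  have h2 : x * z * x⁻¹ * z⁻¹ ∈ P := by
    have k1 : x * (z⁻¹ * c)⁻¹ * x⁻¹ ∈ P := nm_conj hxP (inv_mem e.tP)
    have k2 := mul_mem e.tP k1
    have k3 := mem_CS.1 hzC _ k2
    have k4 : z * (z⁻¹ * c * (x * (z⁻¹ * c)⁻¹ * x⁻¹)) = x * z * x⁻¹ := by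
      calc z * (z⁻¹ * c * (x * (z⁻¹ * c)⁻¹ * x⁻¹)) = (c * x) * c⁻¹ * z * x⁻¹ := by group
        _ = _ := by rw [← hxc]; group
    rw [← k4, k3]
    simpa using k2
  have h3 : x * z * x⁻¹ * z⁻¹ = 1 := by
    by_contra hne
    apply GPN h e.PN e.cP
    haveI := Fact.mk h.hp
    have : orderOf (x * z * x⁻¹ * z⁻¹) = p := orderOf_eq_prime (pow_card_eq e.cP h2) hne
    rw [← this]
    exact Subgroup.orderOf_dvd_natCard _ h1
  have h4 : x * z = z * x := by
    have : x * z * x⁻¹ = z := mul_inv_eq_one.1 h3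
    rwa [mul_inv_eq_iff_eq_mul] at this
  apply CS_of_comm h.hp e.cP e.tP hc
  have h4' : x * z⁻¹ = z⁻¹ * x := (Commute.inv_right (show Commute x z from h4))
  rw [← mul_assoc, h4', mul_assoc, hxc, mul_assoc]

lemma exD (h : ST π p l l' σ ω Al) {c z : A} {P : Subgroup A} (e : ED π p σ c P z) (hc : z⁻¹ * c ≠ 1) :
    ∃ D, D ≤ π.ker ⊓ CC c ∧ ¬ p ∣ Nat.card D ∧ Nat.card (π.ker ⊓ CC c : Subgroup A) = Nat.card D * p ∧
      (∀ x ∈ π.ker ⊓ CC c, ¬ p ∣ orderOf x → x ∈ D) ∧ ∀ b, b ∈ NN (π.ker ⊓ CC c) → b ∈ NN D := by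
  haveI := Fact.mk h.hp
  have hs := (syl_of h e.PN e.cP).mono (H := π.ker ⊓ CC c)
    (le_inf e.PN fun x hx => mem_CC.2 (mem_CS.1 e.cC x hx).symm) inf_le_left
  obtain ⟨D, a1, a2, a3, a4, a5⟩ := S6 h.hp hs (fun x hx hxP => D1 h e hc hx.1 (mem_CC.1 hx.2) hxP)
  exact ⟨D, a1, a2, by rw [a3, e.cP], a4, a5⟩

lemma not_dvd_order {q : ℕ} (hp : p.Prime) (hq : q.Prime) (hpq : q ≠ p) {Q : Subgroup A} (hQ : IsPGroup q Q) {x : A} (hx : x ∈ Q) :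
    ¬ p ∣ orderOf x := by
  intro hd
  obtain ⟨k, hk⟩ := hQ ⟨x, hx⟩
  have hk' : x ^ q ^ k = 1 := congrArg Subtype.val hk
  have := hd.trans (orderOf_dvd_of_pow_eq_one hk')
  exact hpq ((Nat.prime_dvd_prime_iff_eq hp hq).1 (hp.dvd_of_dvd_pow this)).symm

lemma D2 (h : ST π p l l' σ ω Al) {c z : A} {P : Subgroup A} (e : ED π p σ c P z) (hc : z⁻¹ * c ≠ 1) {q : ℕ} (hq : q.Prime)
    (hqp : q ≠ p) {Q : Subgroup A} (hQ : IsSyl q π.ker Q) (hcQ : c ∈ CS Q) : p ∣ Nat.card (NN Q ⊓ π.ker : Subgroup A) := by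
  haveI := Fact.mk h.hp
  haveI := Fact.mk hq
  obtain ⟨D, a1, a2, a3, a4, a5⟩ := exD h e hc
  have hQD : Q ≤ D := fun x hx => a4 x ⟨hQ.1 hx, mem_CC.2 (mem_CS.1 hcQ x hx).symm⟩
    (not_dvd_order h.hp hq hqp hQ.isPGroup hx)
  have hQ' := hQ.mono hQD (a1.trans inf_le_left)
  have htN := e.PN e.tP
  have htD : z⁻¹ * c ∈ NN D := a5 _ (le_NN _ ⟨htN, mem_CC.2 (mem_CS.1 e.cC _ e.tP).symm⟩)
  obtain ⟨Q', b1, b2⟩ := isSyl_fixed (q := q) h.hp (pow_card_eq e.cP e.tP) htD a2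
  obtain ⟨m, hm, hx⟩ := isSyl_conj hQ' b1
  have hmN := (a1 hm).1
  have key : m⁻¹ * (z⁻¹ * c) * m ∈ NN Q ⊓ π.ker := by
    refine ⟨mem_nm fun x hxQ => ?_, nm_conj' (ker_nm π m) htN⟩
    have k1 : m * x * m⁻¹ ∈ Q' := (hx _).2 (by rwa [cc1])
    have k2 := (hx _).1 (nm_conj b2 k1)
    convert k2 using 1; group
  have ho : orderOf (m⁻¹ * (z⁻¹ * c) * m) = p := by
    apply orderOf_eq_prime
    · have := conj_pow (i := p) (a := m⁻¹) (b := z⁻¹ * c)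
      rw [inv_inv] at this
      rw [this, pow_card_eq e.cP e.tP]; simp
    · intro h1
      apply hc
      have : z⁻¹ * c = m * (m⁻¹ * (z⁻¹ * c) * m) * m⁻¹ := by group
      rw [this, h1]; simp
  rw [← ho]
  exact Subgroup.orderOf_dvd_natCard _ key
end
end SP

namespace SP

section
variable {A S : Type*} [Group A] [Finite A] [Group S] [Finite S] {π : A →* S} {p l l' : ℕ}
    {σ ω : S} {Al : Subgroup S}

lemma NN_surj (π : A →* S) (hs : Function.Surjective π) {q : ℕ} [Fact q.Prime] {Q : Subgroup A} (hQ : IsSyl q π.ker Q) :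
    (NN Q).map π = ⊤ := by
  rw [eq_top_iff]
  intro s _
  obtain ⟨b, -, hb, e⟩ := Fr π (B := ⊤) (by rw [← MonoidHom.range_eq_map]; exact MonoidHom.range_eq_top.2 hs)
    (by rwa [top_inf_eq]) s
  exact ⟨b, hb, e⟩

lemma exB (h : ST π p l l' σ ω Al) {B : Subgroup A} (hB : B.map π = ⊤) (hd : ¬ p ∣ Nat.card (B ⊓ π.ker : Subgroup A)) :
    ∃ c ∈ B, c ^ p = 1 ∧ π c = σ ∧ ∃ w ∈ B, π w = ω ∧ w * c * w⁻¹ = c ^ l := by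
  obtain ⟨b, hb, hbs⟩ : σ ∈ B.map π := hB ▸ Subgroup.mem_top _
  obtain ⟨u, hu, hus⟩ : ω ∈ B.map π := hB ▸ Subgroup.mem_top _
  obtain ⟨c, hc, hcp, hcs, -⟩ := L0 h hd hb hbs
  obtain ⟨m, hm, e⟩ := L2 h hd hc hcp hcs (le_NN _ hu) hus
  exact ⟨c, hc, hcp, hcs, m * u, mul_mem hm.1 hu, by rw [map_mul, MonoidHom.mem_ker.1 hm.2, one_mul, hus], e⟩

lemma S2 (h : ST π p l l' σ ω Al) {q : ℕ} (hq : q.Prime) (hqp : q ≠ p) (hq2 : q ≠ 2) :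
    ∃ z, ZT π p σ z ∧ ∃ Q, IsSyl q π.ker Q ∧ z ∈ CS Q := by
  haveI := Fact.mk h.hp
  haveI := Fact.mk hq
  obtain ⟨Q, hQ⟩ := exists_isSyl q π.ker
  have hB := NN_surj π h.surj hQ
  have hlt : Nat.card Q < q ^ (p - 1) := by
    rw [hQ.2]; exact Nat.pow_lt_pow_right hq.one_lt (h.odd q hq hqp hq2)
  by_cases hd : p ∣ Nat.card (NN Q ⊓ π.ker : Subgroup A)
  · obtain ⟨z, hz, hzt, w, hw, -, e⟩ := Q1 h hB hd
    exact ⟨z, hzt, Q, hQ, R4 h.hp hqp.symm h.prim hQ.isPGroup hlt hzt.1 e hz hw⟩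
  · obtain ⟨c, hc, hcp, hcs, w, hw, -, e⟩ := exB h hB hd
    have hcQ := R4 h.hp hqp.symm h.prim hQ.isPGroup hlt hcp e hc hw
    refine ⟨c, ?_, Q, hQ, hcQ⟩
    by_contra hzt
    obtain ⟨P, z, hE⟩ := exE h hcp hcs
    exact hd (D2 h hE (hE.ne hzt) hq hqp hQ hcQ)

lemma CCconj {z z' m x : A} (e : z' = m * z * m⁻¹) (hx : x * z' = z' * x) : m⁻¹ * x * m * z = z * (m⁻¹ * x * m) := by
  subst e
  calc m⁻¹ * x * m * z = m⁻¹ * (x * (m * z * m⁻¹)) * m := by group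
    _ = _ := by rw [hx]; group

lemma S2c (h : ST π p l l' σ ω Al) {z : A} (hz : ZT π p σ z) :
    ∃ k, (CC z).relIndex π.ker = 2 ^ k := by
  set C := π.ker ⊓ CC z with hC
  have h0 : (CC z).relIndex π.ker = C.relIndex π.ker := by rw [hC, Subgroup.inf_relIndex_left]
  have h1 : C.relIndex π.ker * Nat.card C = Nat.card π.ker := relIndex_mul_card inf_le_left
  have hne : C.relIndex π.ker ≠ 0 := by
    intro h'; rw [h', zero_mul] at h1; exact card_ne _ h1.symm
  rw [h0]
  refine ⟨_, Nat.eq_prime_pow_of_unique_prime_dvd hne ?_⟩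
  intro d hd hdd
  by_contra hd2
  have hfac : (Nat.card π.ker).factorization d ≤ (Nat.card C).factorization d := by
    have key : ∃ Q : Subgroup A, IsSyl d π.ker Q ∧ Q ≤ C := by
      by_cases hdp : d = p
      · subst hdp
        obtain ⟨-, -, P, hP, hPc, hzP⟩ := hz
        exact ⟨P, syl_of h hP hPc, le_inf hP fun x hx => mem_CC.2 (mem_CS.1 (comm_le _ hzP) x hx).symm⟩
      · obtain ⟨z', hz', Q, hQ, hQz⟩ := S2 h hd hdp hd2
        obtain ⟨m, hm, e⟩ := ZC h hz' hz
        refine ⟨cj m Q, isSyl_cj hQ (ker_nm π m), le_inf (isSyl_cj hQ (ker_nm π m)).1 ?_⟩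
        intro x hx
        rw [mem_cj] at hx
        rw [mem_CC, e]
        have := mem_CS.1 hQz _ hx
        calc x * (m * z' * m⁻¹) = m * ((m⁻¹ * x * m) * z') * m⁻¹ := by group
          _ = _ := by rw [← this]; group
    obtain ⟨Q, hQ, hQC⟩ := key
    have := Subgroup.card_dvd_of_le hQC
    rw [hQ.2] at this
    exact (hd.pow_dvd_iff_le_factorization (card_ne _)).1 this
  rw [← h1, Nat.factorization_mul hne (card_ne _)] at hfac
  have := (hd.pow_dvd_iff_le_factorization hne (k := 1)).1 (by simpa using hdd)
  rw [Finsupp.add_apply] at hfac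
  omega

lemma TR' (h : ST π p l l' σ ω Al) {z : A} (hz : ZT π p σ z) {Q : Subgroup A} (hQ : IsSyl 2 π.ker Q) :
    ∀ x ∈ π.ker, ∃ s ∈ Q, ∃ y ∈ CC z, x = s * y := by
  obtain ⟨k, hk⟩ := S2c h hz
  have h1 := relIndex_mul_card (inf_le_left : π.ker ⊓ CC z ≤ π.ker)
  rw [Subgroup.inf_relIndex_left, hk] at h1
  intro x hx
  obtain ⟨s, hs, y, hy, e⟩ := TR inf_le_left hQ h1.symm x hx
  exact ⟨s, hs, y, hy.2, e⟩

lemma prod_relIndex {Q C H : Subgroup A} (hS : Q ≤ H) (hx : ∀ x ∈ H, ∃ s ∈ Q, ∃ y ∈ C, x = s * y) :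
    C.relIndex Q = C.relIndex H := by
  let e := Subgroup.quotientSubgroupOfEmbeddingOfLE C hS
  have hs : Function.Surjective e := by
    intro y
    induction y using QuotientGroup.induction_on with
    | H y =>
    obtain ⟨s, hs, c, hc, e1⟩ := hx y y.2
    refine ⟨((⟨s, hs⟩ : Q) : Q ⧸ C.subgroupOf Q), ?_⟩
    rw [Subgroup.quotientSubgroupOfEmbeddingOfLE_apply_mk]
    rw [QuotientGroup.eq, Subgroup.mem_subgroupOf]
    simp [e1, hc]
  exact Nat.card_congr (Equiv.ofBijective e ⟨e.injective, hs⟩)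

def Concl (π : A →* S) (σ : S) : Prop := ∃ z, π z = σ ∧ ∃ T : Subgroup A, T ≤ π.ker ∧ IsPGroup 2 T ∧
  ∀ m ∈ π.ker, m * z * m⁻¹ * z⁻¹ ∈ T

lemma LF (h : ST π p l l' σ ω Al) {z : A} (hz : ZT π p σ z) {M : Subgroup A} (hM : M ≤ π.ker)
    (hMp : ¬ p ∣ Nat.card M) (hzM : z ∈ NN M) (hx : ∀ m ∈ π.ker, ∃ x ∈ M, m * z * m⁻¹ = x * z * x⁻¹) :
    Concl π σ := by
  obtain ⟨T, hT, hzT⟩ := isSyl_fixed (q := 2) h.hp hz.1 hzM hMp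
  have hr : (CC z).relIndex M = (CC z).relIndex π.ker := by
    apply prod_relIndex hM
    intro m hm
    obtain ⟨x, hx, e⟩ := hx m hm
    refine ⟨x, hx, x⁻¹ * m, ?_, by group⟩
    rw [mem_CC]
    calc x⁻¹ * m * z = x⁻¹ * (m * z * m⁻¹) * m := by group
      _ = _ := by rw [e]; group
  obtain ⟨k, hk⟩ := S2c h hz
  have h1 := relIndex_mul_card (inf_le_left : M ⊓ CC z ≤ M)
  rw [Subgroup.inf_relIndex_left, hr, hk] at h1
  refine ⟨z, hz.2.1, T, hT.1.trans hM, hT.isPGroup, ?_⟩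
  intro m hm
  obtain ⟨x, hx, e⟩ := hx m hm
  obtain ⟨s, hs, y, hy, rfl⟩ := TR inf_le_left hT h1.symm x hx
  have hyz := mem_CC.1 hy.2
  have e2 : m * z * m⁻¹ * z⁻¹ = s * (z * s⁻¹ * z⁻¹) := by
    rw [e]
    calc s * y * z * (s * y)⁻¹ * z⁻¹ = s * (y * z) * y⁻¹ * s⁻¹ * z⁻¹ := by group
      _ = _ := by rw [hyz]; group
  rw [e2]
  exact mul_mem hs (nm_conj hzT (inv_mem hs))

lemma LFQ (h : ST π p l l' σ ω Al) {z : A} (hz : ZT π p σ z) {Q : Subgroup A} (hQ : IsSyl 2 π.ker Q) (hzQ : z ∈ NN Q) :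
    Concl π σ := by
  have hp2 : p ≠ 2 := by have := h.hp5; omega
  apply LF h hz hQ.1 (not_dvd_of_pgroup h.hp Nat.prime_two hp2 hQ.isPGroup) hzQ
  intro m hm
  obtain ⟨s, hs, y, hy, rfl⟩ := TR' h hz hQ m hm
  refine ⟨s, hs, ?_⟩
  have hyz := mem_CC.1 hy
  calc s * y * z * (s * y)⁻¹ = s * (y * z) * y⁻¹ * s⁻¹ := by group
    _ = _ := by rw [hyz]; group

lemma LV (h : ST π p l l' σ ω Al) {c z z' : A} {Q : Subgroup A} (hQ : IsSyl 2 π.ker Q) (hcp : c ^ p = 1) (hcQ : c ∈ NN Q)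
    (hz : ZT π p σ z) (hcz : c * z = z * c) (hz' : ZT π p σ z') (hcz' : c * z' = z' * c) :
    ∃ v ∈ Q, v * c = c * v ∧ z' = v * z * v⁻¹ := by
  have hp2 : p ≠ 2 := by have := h.hp5; omega
  obtain ⟨m, hm, e⟩ := ZC h hz hz'
  obtain ⟨u, hu, y, hy, rfl⟩ := TR' h hz hQ m hm
  have hyz := mem_CC.1 hy
  have e' : z' = u * z * u⁻¹ := by
    rw [e]
    calc u * y * z * (u * y)⁻¹ = u * (y * z) * y⁻¹ * u⁻¹ := by group
      _ = _ := by rw [hyz]; group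
  have hcZ : c ∈ NN (CC z) := le_NN _ (mem_CC.2 hcz)
  have hc0 : c ∈ NN (Q ⊓ CC z) := NN_inf' hcQ hcZ
  obtain ⟨x, hx, hxc⟩ := LC h.hp (not_dvd_of_pgroup h.hp Nat.prime_two hp2 (hQ.isPGroup.to_le inf_le_left : IsPGroup 2 (Q ⊓ CC z : Subgroup A)))
    hc0 hcp (x := u) (mi (by
      have := mul_mem (inv_mem hu) (nm_conj hcQ hu)
      convert this using 1; group) (by
      rw [mem_CC]
      have k1 := CCconj e' hcz'
      have k3 : c⁻¹ * z = z * c⁻¹ := (Commute.inv_left (show Commute c z from hcz))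
      calc u⁻¹ * c * u * c⁻¹ * z = u⁻¹ * c * u * (c⁻¹ * z) := by group
        _ = (u⁻¹ * c * u * z) * c⁻¹ := by rw [k3]; group
        _ = _ := by rw [k1]; group))
  refine ⟨u * x, mul_mem hu hx.1, hxc, ?_⟩
  rw [e']
  have hxz := mem_CC.1 hx.2
  symm
  calc u * x * z * (u * x)⁻¹ = u * (x * z) * x⁻¹ * u⁻¹ := by group
      _ = _ := by rw [hxz]; group

structure WW (π : A →* S) (p l : ℕ) (σ ω : S) (Q : Subgroup A) (c : A) (P : Subgroup A) (z w : A) : Prop where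
  hQ : IsSyl 2 π.ker Q
  hd : ¬ p ∣ Nat.card (NN Q ⊓ π.ker : Subgroup A)
  hE : ED π p σ c P z
  hne : z⁻¹ * c ≠ 1
  cQ : c ∈ NN Q
  cnC : c ∉ CS Q
  wQ : w ∈ NN Q
  ws : π w = ω
  wc : w * c * w⁻¹ = c ^ l
  wz : w * z * w⁻¹ = z ^ l

lemma S3 (h : ST π p l l' σ ω Al) : Concl π σ ∨ ∃ Q c P z w, WW π p l σ ω Q c P z w := by
  by_cases hcon : Concl π σ
  · exact Or.inl hcon
  right
  have hp2 : p ≠ 2 := by have := h.hp5; omega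
  obtain ⟨Q, hQ⟩ := exists_isSyl 2 π.ker
  have hB := NN_surj π h.surj hQ
  have hd : ¬ p ∣ Nat.card (NN Q ⊓ π.ker : Subgroup A) := by
    intro hd
    obtain ⟨z, hz, hzt, -⟩ := Q1 h hB hd
    exact hcon (LFQ h hzt hQ hz)
  obtain ⟨c, hc, hcp, hcs, w0, hw0, hw0s, e0⟩ := exB h hB hd
  have hczt : ¬ ZT π p σ c := fun hzt => hcon (LFQ h hzt hQ hc)
  obtain ⟨P, z, hE⟩ := exE h hcp hcs
  have hcC : c ∉ CS Q := fun hcC => hd (D2 h hE (hE.ne hczt) Nat.prime_two hp2.symm hQ hcC)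
  have hcl : c ^ (l * l') = c := pow_mod hcp h.prim.1
  have hz1 : ZT π p σ ((w0 * z * w0⁻¹) ^ l') := by
    refine ⟨?_, ?_, cj w0 P, ?_, ?_, ?_⟩
    · rw [← pow_mul, mul_comm, pow_mul, conj_pow, hE.zp]; simp
    · rw [map_pow, map_mul, map_mul, map_inv, hE.zs, hw0s, h.ws, ← pow_mul]
      exact pow_mod h.sp h.prim.1
    · intro x hx
      rw [mem_cj] at hx
      have := nm_conj (ker_nm π w0) (hE.PN hx)
      rwa [cc2] at this
    · rw [card_cj, hE.cP]
    · exact pow_mem (mem_conj_comm (fun x => mem_cj) hE.zG) _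
  have hz1c : c * (w0 * z * w0⁻¹) ^ l' = (w0 * z * w0⁻¹) ^ l' * c := by
    apply Commute.pow_right
    have k1 : Commute (w0 * c * w0⁻¹) (w0 * z * w0⁻¹) := by
      show _ = _
      calc w0 * c * w0⁻¹ * (w0 * z * w0⁻¹) = w0 * (c * z) * w0⁻¹ := by group
        _ = _ := by rw [hE.cz]; group
    rw [e0] at k1
    have := k1.pow_left l'
    rwa [← pow_mul, hcl] at this
  obtain ⟨v, hv, hvc, e1⟩ := LV h hQ hcp hc hE.zt hE.cz hz1 hz1c
  refine ⟨Q, c, P, z, v⁻¹ * w0, hQ, hd, hE, hE.ne hczt, hc, hcC, mul_mem (inv_mem (le_NN _ hv)) hw0, ?_, ?_, ?_⟩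
  · rw [map_mul, map_inv, MonoidHom.mem_ker.1 (hQ.1 hv), hw0s]; simp
  · have k : v⁻¹ * c ^ l = c ^ l * v⁻¹ := (Commute.inv_left (show Commute v c from hvc)).pow_right l
    calc v⁻¹ * w0 * c * (v⁻¹ * w0)⁻¹ = v⁻¹ * (w0 * c * w0⁻¹) * v := by group
      _ = _ := by rw [e0, k]; group
  · have k : w0 * z * w0⁻¹ = v * z ^ l * v⁻¹ := by
      rw [← conj_pow, ← e1, ← pow_mul, mul_comm]
      symm
      exact pow_mod (by rw [conj_pow, hE.zp]; simp) h.prim.1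
    calc v⁻¹ * w0 * z * (v⁻¹ * w0)⁻¹ = v⁻¹ * (w0 * z * w0⁻¹) * v := by group
      _ = _ := by rw [k]; group
end
end SP

namespace SP

section
variable {A S : Type*} [Group A] [Finite A] [Group S] [Finite S] {π : A →* S} {p l l' : ℕ}
    {σ ω : S} {Al : Subgroup S}

lemma CC_nm {c w : A} {l l' : ℕ} (hwc : w * c * w⁻¹ = c ^ l) (hcl : c ^ (l * l') = c) : w ∈ NN (CC c) := by
  apply mem_nm
  intro x hx
  rw [mem_CC] at hx ⊢
  have k1 : Commute (w * x * w⁻¹) (w * c * w⁻¹) := by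
    show _ = _
    calc w * x * w⁻¹ * (w * c * w⁻¹) = w * (x * c) * w⁻¹ := by group
      _ = _ := by rw [hx]; group
  rw [hwc] at k1
  have := k1.pow_right l'
  rwa [← pow_mul, hcl] at this

lemma pow_clean {c : A} (hcp : c ^ p = 1) (hP : Prim p l l') : c ^ (l * l') = c := pow_mod hcp hP.1

/-- sylow 2 of centralizer -/
lemma Q0syl (h : ST π p l l' σ ω Al) {z : A} (hz : ZT π p σ z) {Q : Subgroup A} (hQ : IsSyl 2 π.ker Q) :
    IsSyl 2 (π.ker ⊓ CC z) (Q ⊓ CC z) ∧ ∃ k, Nat.card π.ker = 2 ^ k * Nat.card (π.ker ⊓ CC z : Subgroup A) ∧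
      Nat.card Q = 2 ^ k * Nat.card (Q ⊓ CC z : Subgroup A) := by
  obtain ⟨k, hk⟩ := S2c h hz
  have h1 := relIndex_mul_card (inf_le_left : π.ker ⊓ CC z ≤ π.ker)
  rw [Subgroup.inf_relIndex_left, hk] at h1
  have h2 := relIndex_mul_card (inf_le_left : Q ⊓ CC z ≤ Q)
  rw [Subgroup.inf_relIndex_left, prod_relIndex hQ.1 (TR' h hz hQ), hk] at h2
  refine ⟨⟨inf_le_inf_right _ hQ.1, ?_⟩, k, h1.symm, h2.symm⟩
  have h3 := hQ.2
  rw [← h1, ← h2, factorization_mul_pow Nat.prime_two (card_ne _), pow_add] at h3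
  exact Nat.eq_of_mul_eq_mul_left (by positivity) h3

lemma WW.wt {Q P : Subgroup A} {c z w : A} (W : WW π p l σ ω Q c P z w) : w * (z⁻¹ * c) * w⁻¹ = (z⁻¹ * c) ^ l := by
  have : Commute z⁻¹ c := Commute.inv_left (show Commute z c from W.hE.cz.symm)
  rw [this.mul_pow, ← W.wc]
  have : w * z⁻¹ * w⁻¹ = z⁻¹ ^ l := by
    rw [inv_pow, ← W.wz]; group
  rw [← this]; group

lemma WW.wP (h : ST π p l l' σ ω Al) {Q P : Subgroup A} {c z w : A} (W : WW π p l σ ω Q c P z w) : w ∈ NN P := by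
  apply mem_nm
  intro x hx
  obtain ⟨k, rfl⟩ := mem_pow_of_card h.hp W.hE.cP W.hE.tP W.hne hx
  rw [← conj_pow, W.wt]
  exact pow_mem (pow_mem W.hE.tP _) _

lemma S4 (h : ST π p l l' σ ω Al) (hcon : ¬ Concl π σ) {Q P : Subgroup A} {c z w : A} (W : WW π p l σ ω Q c P z w) :
    2 ^ (p - 1) * Nat.card (Q ⊓ CC z : Subgroup A) ≤ Nat.card Q ∧ c ∈ CS (Q ⊓ CC z) := by
  have hp2 : p ≠ 2 := by have := h.hp5; omega
  have hE := W.hE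
  have hc0 : c ∈ NN (Q ⊓ CC z) := NN_inf' W.cQ (le_NN _ (mem_CC.2 hE.cz))
  have hw0 : w ∈ NN (Q ⊓ CC z) := NN_inf' W.wQ (CC_nm W.wz (pow_clean hE.zp h.prim))
  have hle : 2 ^ (p - 1) * Nat.card (Q ⊓ CC z : Subgroup A) ≤ Nat.card Q := by
    by_contra hlt
    rw [not_le] at hlt
    have h3 := R3 h.hp hp2 h.prim inf_le_left W.hQ.isPGroup hlt hE.cp W.wc hc0 W.cQ hw0 W.wQ
    obtain ⟨D, a1, a2, a3, a4, a5⟩ := exD h hE W.hne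
    apply hcon
    apply LF h hE.zt (a1.trans inf_le_left) a2 (a5 z (NN_inf' (ker_nm π z) (le_NN _ (mem_CC.2 hE.cz.symm))))
    intro m hm
    obtain ⟨x, hx, y, hy, rfl⟩ := TR' h hE.zt W.hQ m hm
    obtain ⟨b, hb, a, ha, hbc, rfl⟩ := h3 x hx
    refine ⟨b, a4 b (mi (W.hQ.1 hb) (mem_CC.2 hbc)) (not_dvd_order h.hp Nat.prime_two hp2.symm W.hQ.isPGroup hb), ?_⟩
    have hyz := mem_CC.1 hy
    have haz := mem_CC.1 ha.2
    calc b * a * y * z * (b * a * y)⁻¹ = b * a * (y * z) * y⁻¹ * a⁻¹ * b⁻¹ := by group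
      _ = b * (a * z) * a⁻¹ * b⁻¹ := by rw [hyz]; group
      _ = _ := by rw [haz]; group
  refine ⟨hle, ?_⟩
  have hcQ : Nat.card Q < 2 ^ (2 * (p - 1)) := by
    rw [W.hQ.2]; exact Nat.pow_lt_pow_right one_lt_two h.two
  refine R4 h.hp hp2 h.prim (W.hQ.isPGroup.to_le inf_le_left) ?_ hE.cp W.wc hc0 hw0
  rw [two_mul, pow_add] at hcQ
  exact Nat.lt_of_mul_lt_mul_left (lt_of_le_of_lt hle hcQ)

lemma S5 (h : ST π p l l' σ ω Al) (hcon : ¬ Concl π σ) {Q P : Subgroup A} {c z w : A} (W : WW π p l σ ω Q c P z w) :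
    Q ⊓ CC c = Q ⊓ CC z := by
  have hp2 : p ≠ 2 := by have := h.hp5; omega
  have hE := W.hE
  obtain ⟨hle, hcQ0⟩ := S4 h hcon W
  have hcQ : Nat.card Q < 2 ^ (2 * (p - 1)) := by
    rw [W.hQ.2]; exact Nat.pow_lt_pow_right one_lt_two h.two
  set K := Q ⊓ CC c with hK
  set Q0 := Q ⊓ CC z with hQ0
  have h0K : Q0 ≤ K := le_inf inf_le_left fun x hx => mem_CC.2 (mem_CS.1 hcQ0 x hx).symm
  have hwCc : w ∈ NN (CC c) := CC_nm W.wc (pow_clean hE.cp h.prim)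
  have hcK : c ∈ NN K := NN_inf' W.cQ (le_NN _ (mem_CC.2 rfl))
  have hwK : w ∈ NN K := NN_inf' W.wQ hwCc
  have hKlt : Nat.card K < 2 ^ (p - 1) := by
    by_contra hge
    rw [not_lt] at hge
    apply W.cnC
    rw [mem_CS]
    intro x hx
    obtain ⟨b, hb, a, ha, hbc, rfl⟩ := R3 h.hp hp2 h.prim (inf_le_left : K ≤ Q) W.hQ.isPGroup (by
      refine lt_of_lt_of_le hcQ ?_
      rw [two_mul, pow_add]
      exact Nat.mul_le_mul_left _ hge) hE.cp W.wc hcK W.cQ hwK W.wQ x hx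
    have hac := mem_CC.1 ha.2
    symm; rw [mul_assoc, hac, ← mul_assoc, hbc, mul_assoc]
  set H := π.ker ⊓ CC c with hH
  have hKH : K ≤ H := inf_le_inf_right _ W.hQ.1
  have hr : (CC z).relIndex K = (CC z).relIndex H := by
    apply prod_relIndex hKH
    intro x hx
    have hxc := mem_CC.1 hx.2
    obtain ⟨v, hv, hvc, e⟩ := LV h W.hQ hE.cp W.cQ hE.zt hE.cz (z' := x * z * x⁻¹) (ZTconj hE.zt hx.1) (by
      calc c * (x * z * x⁻¹) = (c * x) * z * x⁻¹ := by group
        _ = x * (c * z) * x⁻¹ := by rw [← hxc]; group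
        _ = x * z * (c * x⁻¹) := by rw [hE.cz]; group
        _ = _ := by
          have : c * x⁻¹ = x⁻¹ * c := (Commute.inv_right (show Commute c x from hxc.symm))
          rw [this]; group)
    refine ⟨v, mi hv (mem_CC.2 hvc), v⁻¹ * x, ?_, by group⟩
    rw [mem_CC]
    calc v⁻¹ * x * z = v⁻¹ * (x * z * x⁻¹) * x := by group
      _ = _ := by rw [e]; group
  obtain ⟨hsyl, -⟩ := Q0syl h hE.zt W.hQ
  have hKz : K ⊓ CC z = Q0 := by
    apply le_antisymm
    · exact le_inf (inf_le_left.trans inf_le_left) inf_le_right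
    · exact le_inf h0K inf_le_right
  have hKc := relIndex_mul_card (inf_le_left : K ⊓ CC z ≤ K)
  rw [Subgroup.inf_relIndex_left, hKz, hr] at hKc
  obtain ⟨D, a1, a2, a3, a4, a5⟩ := exD h hE W.hne
  have hKD : K ≤ D := fun x hx => a4 x (hKH hx) (not_dvd_order h.hp Nat.prime_two hp2.symm W.hQ.isPGroup hx.1)
  have htN := hE.PN hE.tP
  have htp := pow_card_eq hE.cP hE.tP
  have htD : z⁻¹ * c ∈ NN D := a5 _ (le_NN _ (mi htN (mem_CC.2 (mem_CS.1 hE.cC _ hE.tP).symm)))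
  obtain ⟨T, hT, htT⟩ := isSyl_fixed (q := 2) h.hp htp htD a2
  have hTz : ∀ R : Subgroup A, R ≤ π.ker → R ≤ CC z → IsPGroup 2 R → Nat.card R ≤ Nat.card Q0 := by
    intro R h1 h2 h3
    have := pgroup_card_le (le_inf h1 h2) h3
    rwa [← hsyl.2] at this
  have hTK : Nat.card T ≤ Nat.card K := by
    have h1 := relIndex_mul_card (inf_le_left : T ⊓ CC z ≤ T)
    rw [Subgroup.inf_relIndex_left] at h1
    rw [← h1, ← hKc]
    refine Nat.mul_le_mul ?_ (hTz _ (inf_le_left.trans (hT.1.trans (a1.trans inf_le_left))) inf_le_right (hT.isPGroup.to_le inf_le_left))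
    exact Nat.card_le_card_of_injective _ (Subgroup.quotientSubgroupOfEmbeddingOfLE (CC z) (hT.1.trans a1)).injective
  have hKT : Nat.card K ≤ Nat.card T := by
    have := pgroup_card_le hKD (W.hQ.isPGroup.to_le inf_le_left)
    rwa [← hT.2] at this
  have hwD : w ∈ NN D := a5 _ (NN_inf' (ker_nm π w) hwCc)
  obtain ⟨d, hd, hdw⟩ := frattini hT hwD
  have e1 : (d * w) * (z⁻¹ * c) * (d * w)⁻¹ = d * (z⁻¹ * c) ^ l * d⁻¹ := by
    rw [← W.wt]; group
  have htl : (z⁻¹ * c) ^ l ∈ NN D := pow_mem htD l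
  have htlT : (z⁻¹ * c) ^ l ∈ NN T := pow_mem htT l
  obtain ⟨e, he, e2⟩ := LB h.hp (K := D ⊓ NN T) (c := (z⁻¹ * c) ^ l) (c' := (d * w) * (z⁻¹ * c) * (d * w)⁻¹)
    (not_dvd_mono a2 inf_le_left) (NN_inf htD htT |> fun h' => pow_mem h' l)
    (by rw [← pow_mul, mul_comm, pow_mul, htp, one_pow])
    (by rw [conj_pow, htp]; simp)
    (mi (by
      rw [e1]
      have := mul_mem hd (nm_conj htl (inv_mem hd))
      convert this using 1; group)
      (mul_mem (mul_mem (mul_mem hdw htT) (inv_mem hdw)) (inv_mem htlT)))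
  have htC : z⁻¹ * c ∈ CS T := R4 h.hp hp2 h.prim hT.isPGroup (lt_of_le_of_lt hTK hKlt) htp (w := e⁻¹ * (d * w)) (by
    calc e⁻¹ * (d * w) * (z⁻¹ * c) * (e⁻¹ * (d * w))⁻¹ = e⁻¹ * ((d * w) * (z⁻¹ * c) * (d * w)⁻¹) * e := by group
      _ = _ := by rw [e2]; group) htT (mul_mem (inv_mem he.2) hdw)
  have hTCz : T ≤ CC z := by
    intro x hx
    have h1 := mem_CC.1 (a1 (hT.1 hx)).2
    have h2 := mem_CS.1 htC x hx
    rw [mem_CC]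
    have h3 : Commute x (z⁻¹ * c)⁻¹ := Commute.inv_right h2.symm
    have h4 := (show Commute x c from h1).mul_right h3
    have e : c * (z⁻¹ * c)⁻¹ = z := by group
    rw [e] at h4
    exact h4
  have := hTz T (hT.1.trans (a1.trans inf_le_left)) hTCz hT.isPGroup
  exact (Subgroup.eq_of_le_of_card_ge h0K (hKT.trans this)).symm

lemma S6' (h : ST π p l l' σ ω Al) (hcon : ¬ Concl π σ) {Q P : Subgroup A} {c z w : A} (W : WW π p l σ ω Q c P z w) :
    Q ≤ NN (Q ⊓ CC z) ∧ (∀ x ∈ Q, ∀ y ∈ Q, x⁻¹ * y⁻¹ * x * y ∈ Q ⊓ CC z) ∧ ∀ x ∈ Q, x ^ 2 ∈ Q ⊓ CC z := by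
  have hp2 : p ≠ 2 := by have := h.hp5; omega
  have hE := W.hE
  obtain ⟨hle, hcQ0⟩ := S4 h hcon W
  have hKe := S5 h hcon W
  have hcQ : Nat.card Q < 2 ^ (2 * (p - 1)) := by
    rw [W.hQ.2]; exact Nat.pow_lt_pow_right one_lt_two h.two
  have hc0 : c ∈ NN (Q ⊓ CC z) := NN_inf' W.cQ (le_NN _ (mem_CC.2 hE.cz))
  have hw0 : w ∈ NN (Q ⊓ CC z) := NN_inf' W.wQ (CC_nm W.wz (pow_clean hE.zp h.prim))
  set Q0 := Q ⊓ CC z with hQ0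
  have hlt : Q0 < Q := by
    refine lt_of_le_of_ne inf_le_left fun he => W.cnC ?_
    rw [← he]; exact hcQ0
  obtain ⟨Q1, h01, h1Q, hmem⟩ := exists_step hlt W.hQ.isPGroup
  have hinv : ∀ b ∈ NN Q0, b ∈ NN Q → b ∈ NN Q1 := by
    intro b hb0 hb
    apply mem_nm
    intro x hx
    rw [hmem] at hx ⊢
    have hbM := NN_inf hb hb0
    refine ⟨nm_conj hbM hx.1, fun y hy => ?_, ?_⟩
    · have := nm_conj hb0 (hx.2.1 _ (nm_conj' hbM hy))
      simpa [mul_assoc] using this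
    · rw [conj_pow]; exact nm_conj hb0 hx.2.2
  have hc1 := hinv c hc0 W.cQ
  have hw1 := hinv w hw0 W.wQ
  have hge : 2 ^ (p - 1) * Nat.card Q0 ≤ Nat.card Q1 := by
    by_contra hn
    rw [not_le] at hn
    apply h01.not_ge
    intro x hx
    obtain ⟨b, hb, a, ha, hbc, rfl⟩ := R3 h.hp hp2 h.prim h01.le (W.hQ.isPGroup.to_le h1Q) hn hE.cp W.wc hc0 hc1 hw0 hw1 x hx
    refine mul_mem ?_ ha
    rw [← hKe]
    exact mi (h1Q hb) (mem_CC.2 hbc)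
  have hQ1 : Q ≤ Q1 := by
    intro x hx
    obtain ⟨b, hb, a, ha, hbc, rfl⟩ := R3 h.hp hp2 h.prim h1Q W.hQ.isPGroup (by
      refine lt_of_lt_of_le hcQ ?_
      rw [two_mul, pow_add]
      refine Nat.mul_le_mul_left _ (le_trans ?_ hge)
      exact Nat.le_mul_of_pos_right _ Nat.card_pos) hE.cp W.wc hc1 W.cQ hw1 W.wQ x hx
    refine mul_mem (h01.le ?_) ha
    rw [← hKe]
    exact mi hb (mem_CC.2 hbc)
  refine ⟨fun x hx => ((hmem x).1 (hQ1 hx)).1.2, fun x hx y hy => ((hmem x).1 (hQ1 hx)).2.1 y ((hmem y).1 (hQ1 hy)).1,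
    fun x hx => ((hmem x).1 (hQ1 hx)).2.2⟩
end
end SP

namespace SP

lemma C_normal {M : Type*} [Group M] [Finite M] {C Q : Subgroup M} (hQ : IsSyl 2 ⊤ Q)
    (ha : ∀ x : M, ∃ s ∈ Q, ∃ y ∈ C, x = s * y) (hb : ∀ x ∈ Q ⊓ C, ∀ m : M, m * x * m⁻¹ ∈ C)
    (hc : ∀ y ∈ NN Q, ∀ x ∈ Q, x⁻¹ * y * x * y⁻¹ ∈ Q ⊓ C) : C.Normal := by
  set K := C.normalCore with hK
  have hKC : K ≤ C := Subgroup.normalCore_le C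
  have hQK : Q ⊓ C ≤ K := fun x hx m => hb x hx m
  let f : M →* M ⧸ K := QuotientGroup.mk' K
  have hf : Function.Surjective f := QuotientGroup.mk'_surjective K
  have hker : f.ker = K := QuotientGroup.ker_mk' K
  have hfk : ∀ x ∈ K, f x = 1 := fun x hx => by rw [← MonoidHom.mem_ker, hker]; exact hx
  -- image is Sylow
  have hsyl : IsSyl 2 ⊤ (Q.map f) := by
    have hcQ : Nat.card Q = 2 ^ (Nat.card M).factorization 2 := by rw [hQ.2, Subgroup.card_top]
    let P : Sylow 2 M := Sylow.ofCard Q hcQ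
    have h1 := (P.mapSurjective hf).card_eq_multiplicity
    refine ⟨le_top, ?_⟩
    rw [Subgroup.card_top, ← h1]
    rfl
  have hcardQ : Nat.card (Q.map f) = C.relIndex ⊤ := by
    rw [← Subgroup.relIndex_ker, hker, ← prod_relIndex le_top (fun x _ => ha x), ← Subgroup.inf_relIndex_left, ← Subgroup.inf_relIndex_left (K := C)]
    congr 1
    exact le_antisymm (inf_le_inf_left _ hKC) (le_inf inf_le_left hQK)
  have hcomm : ∀ y ∈ NN Q, f y ∈ CS (Q.map f) := by
    intro y hy
    rw [mem_CS]
    rintro _ ⟨x, hx, rfl⟩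
    have := hfk _ (hQK (hc y hy x hx))
    simp only [map_mul, map_inv] at this
    rw [mul_inv_eq_one, mul_assoc, inv_mul_eq_iff_eq_mul] at this
    exact this
  obtain ⟨D, -, d2, d3, d4, d5⟩ := S6 Nat.prime_two hsyl (by
    intro x _ hx
    obtain ⟨x, rfl⟩ := hf x
    have hQL : IsSyl 2 ((Q.map f).comap f) Q := hQ.mono (Subgroup.le_comap_map f Q) le_top
    obtain ⟨m, hm, hmx⟩ := frattini hQL (b := x) (mem_nm fun y hy => by
      rw [Subgroup.mem_comap] at hy ⊢
      simpa using nm_conj hx hy)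
    have h1 := hcomm _ hmx
    have h2 : f m ∈ CS (Q.map f) := by
      obtain ⟨q, hq, e⟩ := hm
      rw [← e]
      exact hcomm q (le_NN _ hq)
    have : f x = (f m)⁻¹ * f (m * x) := by simp
    rw [this]
    exact mul_mem (inv_mem h2) h1)
  have hi : (C.map f).index = C.index := Subgroup.index_map_eq C hf (by rw [hker]; exact hKC)
  rw [Subgroup.relIndex_top_right] at hcardQ
  have hcard := (C.map f).index_mul_card
  rw [Subgroup.card_top] at d3
  have hodd : ¬ 2 ∣ Nat.card (C.map f) := by
    intro h2
    have h3 := hsyl.2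
    rw [Subgroup.card_top, ← hcard, hi, ← hcardQ, ] at h3
    obtain ⟨k, hk⟩ := (IsPGroup.iff_card).1 hsyl.isPGroup
    rw [hk, factorization_mul_pow Nat.prime_two (card_ne _), pow_add] at h3
    have h5 : 2 ^ (Nat.card (C.map f)).factorization 2 = 1 := by
      have : 0 < 2 ^ k := by positivity
      nlinarith
    have h6 := (Nat.prime_two.pow_dvd_iff_le_factorization (card_ne (C.map f)) (k := 1)).1 (by simpa using h2)
    have : 2 ^ 1 ≤ 2 ^ (Nat.card (C.map f)).factorization 2 := Nat.pow_le_pow_right (by norm_num) h6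
    omega
  have hCD : C.map f ≤ D := fun x hx => d4 x (Subgroup.mem_top _) fun h2 => hodd (h2.trans (Subgroup.orderOf_dvd_natCard _ hx))
  have hDe : C.map f = D := by
    apply Subgroup.eq_of_le_of_card_ge hCD
    rw [← hcard, hi, ← hcardQ] at d3
    rw [mul_comm] at d3
    exact (Nat.eq_of_mul_eq_mul_right Nat.card_pos d3).ge
  constructor
  intro x hx m
  have h1 : f (m * x * m⁻¹) ∈ C.map f := by
    rw [hDe]
    have := nm_conj (d5 (f m) (mem_nm fun _ _ => Subgroup.mem_top _)) (hDe ▸ Subgroup.mem_map_of_mem f hx : f x ∈ D)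
    simpa using this
  obtain ⟨y, hy, e⟩ := h1
  have : y⁻¹ * (m * x * m⁻¹) ∈ K := by
    rw [← hker, MonoidHom.mem_ker, map_mul, map_inv, e]; simp
  have := mul_mem hy (hKC this)
  simpa using this

section
variable {A S : Type*} [Group A] [Finite A] [Group S] [Finite S] {π : A →* S} {p l l' : ℕ}
    {σ ω : S} {Al : Subgroup S}

lemma C_normal' (h : ST π p l l' σ ω Al) (hcon : ¬ Concl π σ) {Q P : Subgroup A} {c z w : A} (W : WW π p l σ ω Q c P z w)
    (hY : ∀ y ∈ NN Q ⊓ π.ker, ∀ x ∈ Q, x⁻¹ * y * x * y⁻¹ ∈ Q ⊓ CC z) (hcore : ∀ x ∈ Q ⊓ CC z, ∀ m ∈ π.ker, m * x * m⁻¹ ∈ CC z) :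
    ∀ m ∈ π.ker, m ∈ NN (π.ker ⊓ CC z) := by
  have hN := C_normal (M := π.ker) (C := (CC z).subgroupOf π.ker) (Q := Q.subgroupOf π.ker) ?_ ?_ ?_ ?_
  · intro m hm
    apply mem_nm
    intro x hx
    have := hN.conj_mem (⟨x, hx.1⟩ : π.ker) hx.2 ⟨m, hm⟩
    exact mi (nm_conj (ker_nm π m) hx.1) this
  · refine ⟨le_top, ?_⟩
    rw [Subgroup.card_top, ← W.hQ.2]
    exact Nat.card_congr (Subgroup.subgroupOfEquivOfLe W.hQ.1).toEquiv
  · intro x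
    obtain ⟨s, hs, y, hy, e⟩ := TR' h W.hE.zt W.hQ x x.2
    have hyN : y ∈ π.ker := by
      have : y = s⁻¹ * x := by rw [e]; group
      rw [this]; exact mul_mem (inv_mem (W.hQ.1 hs)) x.2
    exact ⟨⟨s, W.hQ.1 hs⟩, hs, ⟨y, hyN⟩, hy, Subtype.ext e⟩
  · intro x hx m
    exact hcore x (mi hx.1 hx.2) m m.2
  · intro y hy x hx
    have hyQ : (y : A) ∈ NN Q := mem_nm fun a ha => by
      have := nm_conj hy (x := ⟨a, W.hQ.1 ha⟩) ha
      exact this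
    have := hY y (mi hyQ y.2) x hx
    exact mi this.1 this.2

lemma S7a0 (h : ST π p l l' σ ω Al) (hcon : ¬ Concl π σ) {Q P : Subgroup A} {c z w : A} (W : WW π p l σ ω Q c P z w)
    (hC : ∀ m ∈ π.ker, m ∈ NN (π.ker ⊓ CC z)) : False := by
  haveI := Fact.mk h.hp
  have hE := W.hE
  apply hcon
  apply LF h hE.zt (M := ⁅CS P, CS P⁆ ⊓ π.ker) inf_le_right (GPN h hE.PN hE.cP) (NN_inf' (le_NN _ hE.zG) (ker_nm π z))
  intro m hm
  have hPC : IsSyl p (π.ker ⊓ CC z) P := (syl_of h hE.PN hE.cP).mono (le_inf hE.PN fun x hx => mem_CC.2 (mem_CS.1 (comm_le _ hE.zG) x hx).symm) inf_le_left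
  obtain ⟨k, hk, hkm⟩ := frattini hPC (hC m hm)
  obtain ⟨x, hx, e⟩ := L1 h.hp (GPN h hE.PN hE.cP) (c := z) (c' := (k * m) * z * (k * m)⁻¹) (π := π) hE.zG
    (nm_conj (NN_comm (NN_CS hkm)) hE.zG) hE.zp (by rw [conj_pow, hE.zp]; simp)
    (by simp [MonoidHom.mem_ker.1 hm, MonoidHom.mem_ker.1 hk.1])
  refine ⟨x, hx, ?_⟩
  have h1 := mem_CC.1 (nm_conj' (hC x hx.2) hk).2
  calc m * z * m⁻¹ = k⁻¹ * ((k * m) * z * (k * m)⁻¹) * k := by group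
    _ = k⁻¹ * x * (z * (x⁻¹ * k * x)) * x⁻¹ := by rw [e]; group
    _ = _ := by rw [← h1]; group

lemma S7core (h : ST π p l l' σ ω Al) (hcon : ¬ Concl π σ) {Q P : Subgroup A} {c z w : A} (W : WW π p l σ ω Q c P z w) :
    ∀ x ∈ Q ⊓ CC z, ∀ m ∈ π.ker, m * x * m⁻¹ ∈ CC z := by
  obtain ⟨h1, -, -⟩ := S6' h hcon W
  intro x hx m hm
  obtain ⟨s, hs, y, hy, e⟩ := TR' h W.hE.zt W.hQ m⁻¹ (inv_mem hm)
  have e2 : m = y⁻¹ * s⁻¹ := by rw [← mul_inv_rev, ← e, inv_inv]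
  have h2 := (nm_conj' (h1 hs) hx).2
  have h3 := mul_mem (mul_mem (inv_mem hy) h2) hy
  rw [e2]
  convert h3 using 1
  group

lemma S7Y (h : ST π p l l' σ ω Al) (hcon : ¬ Concl π σ) (hω : ω ∈ Al) {Q P : Subgroup A} {c z w : A} (W : WW π p l σ ω Q c P z w) :
    ∀ y ∈ NN Q ⊓ π.ker, ∀ x ∈ Q, x⁻¹ * y * x * y⁻¹ ∈ Q ⊓ CC z := by
  have hp2 : p ≠ 2 := by have := h.hp5; omega
  have hE := W.hE
  obtain ⟨hnn, hab, hsq⟩ := S6' h hcon W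
  have hcore := S7core h hcon W
  have hKe := S5 h hcon W
  have hcQ : Nat.card Q < 2 ^ (2 * (p - 1)) := by
    rw [W.hQ.2]; exact Nat.pow_lt_pow_right one_lt_two h.two
  have hc0 : c ∈ NN (Q ⊓ CC z) := NN_inf' W.cQ (le_NN _ (mem_CC.2 hE.cz))
  set Q0 := Q ⊓ CC z with hQ0
  have hY0 : ∀ y ∈ NN Q ⊓ π.ker, y ∈ NN Q0 := fun y hy => mem_nm fun x hx =>
    mi (nm_conj hy.1 hx.1) (hcore x hx y hy.2)
  let E : Subgroup A :=
    { carrier := {y | y ∈ NN Q ⊓ π.ker ∧ ∀ x ∈ Q, x⁻¹ * y * x * y⁻¹ ∈ Q0}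
      one_mem' := ⟨one_mem _, fun x hx => by simp [one_mem]⟩
      mul_mem' := by
        rintro a b ⟨ha, ha'⟩ ⟨hb, hb'⟩
        refine ⟨mul_mem ha hb, fun x hx => ?_⟩
        have h1 := mul_mem (ha' x hx) (nm_conj (hY0 a ha) (hb' x hx))
        have h2 := ha' (b * x * b⁻¹) (nm_conj hb.1 hx)
        have e : x⁻¹ * (a * b) * x * (a * b)⁻¹ = (x⁻¹ * (b * x * b⁻¹)) * ((b * x * b⁻¹)⁻¹ * a * (b * x * b⁻¹) * a⁻¹) := by group
        rw [e]
        refine mul_mem ?_ h2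
        have := hb' x hx
        convert this using 1; group
      inv_mem' := by
        rintro a ⟨ha, ha'⟩
        refine ⟨inv_mem ha, fun x hx => ?_⟩
        have h1 := inv_mem (ha' (a⁻¹ * x * a) (nm_conj' ha.1 hx))
        convert h1 using 1; group }
  have hEY : E ≤ NN Q ⊓ π.ker := fun y hy => hy.1
  suffices hYE : NN Q ⊓ π.ker = E by
    intro y hy
    have : y ∈ E := hYE ▸ hy
    exact this.2
  symm
  apply Subgroup.eq_of_le_of_card_ge hEY
  apply Nat.le_of_dvd Nat.card_pos
  rw [← Nat.factorization_le_iff_dvd (card_ne _) (card_ne _)]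
  intro r
  by_cases hr : r.Prime
  swap
  · rw [Nat.factorization_eq_zero_of_not_prime _ hr]; exact Nat.zero_le _
  haveI := Fact.mk hr
  by_cases hrp : r = p
  · rw [Nat.factorization_eq_zero_of_not_dvd (hrp ▸ W.hd)]; exact Nat.zero_le _
  have key : ∃ R : Subgroup A, IsSyl r (NN Q ⊓ π.ker) R ∧ R ≤ E := by
    by_cases hr2 : r = 2
    · subst hr2
      have hQY : Q ≤ NN Q ⊓ π.ker := le_inf (le_NN _) W.hQ.1
      refine ⟨Q, W.hQ.mono hQY inf_le_right, fun y hy => ⟨hQY hy, fun x hx => ?_⟩⟩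
      have := hab x hx y⁻¹ (inv_mem hy)
      simpa using this
    · have hBs := NN_surj π h.surj W.hQ
      have hR0 : ∃ R, IsSyl r (NN Q ⊓ π.ker) R ∧ c ∈ CS R := by
        obtain ⟨R, hR⟩ := exists_isSyl r (NN Q ⊓ π.ker)
        have hs : (NN Q ⊓ NN R).map π = ⊤ := by
          rw [eq_top_iff]
          intro s _
          obtain ⟨b, hb, hb2, e⟩ := Fr π hBs hR s
          exact ⟨b, mi hb hb2, e⟩
        obtain ⟨c', hc', hcp', hcs', w', hw', -, e'⟩ := exB h hs (not_dvd_mono W.hd (inf_le_inf_right _ inf_le_left))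
        have hRlt : Nat.card R < r ^ (p - 1) := by
          refine lt_of_le_of_lt (pgroup_card_le (hR.1.trans inf_le_right) hR.isPGroup) ?_
          exact Nat.pow_lt_pow_right hr.one_lt (h.odd r hr hrp hr2)
        have hcR := R4 h.hp (Ne.symm hrp) h.prim hR.isPGroup hRlt hcp' e' hc'.2 hw'.2
        obtain ⟨m, hm, em⟩ := L1 h.hp W.hd (π := π) W.cQ hc'.1 hE.cp hcp' (by rw [hcs', hE.cs h])
        refine ⟨cj m⁻¹ R, isSyl_cj hR (le_NN _ (inv_mem hm)), ?_⟩
        rw [mem_CS]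
        intro x hx
        rw [mem_cj, inv_inv] at hx
        have := mem_CS.1 hcR _ hx
        rw [em] at this
        have h2 : m * (c * x) * m⁻¹ = m * (x * c) * m⁻¹ := by
          calc m * (c * x) * m⁻¹ = m * c * m⁻¹ * (m * x * m⁻¹) := by group
            _ = _ := by rw [this]; group
        exact mul_left_cancel (mul_right_cancel h2)
      obtain ⟨R, hR, hcR⟩ := hR0
      refine ⟨R, hR, ?_⟩
      set Z := NN Q ⊓ CS R with hZ
      have hZN : (Z.map π).Normal := by
        constructor
        rintro _ ⟨x, hx, rfl⟩ s
        obtain ⟨b, hb, hb2, rfl⟩ := Fr π hBs hR s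
        refine ⟨b * x * b⁻¹, nm_conj (NN_inf' (le_NN _ hb) (NN_CS hb2)) hx, by simp⟩
      have hAl := h.nor _ hZN ⟨c, mi W.cQ hcR, hE.cs h⟩
      obtain ⟨u, hu, hus⟩ := hAl hω
      obtain ⟨m, hm, em⟩ := L2 h (not_dvd_mono W.hd (inf_le_inf_right _ inf_le_left) : ¬ p ∣ Nat.card (Z ⊓ π.ker : Subgroup A)) (mi W.cQ hcR) hE.cp (hE.cs h) (le_NN _ hu) hus
      have hmu : m * u ∈ Z := mul_mem hm.1 hu
      have hw0 : m * u ∈ NN Q0 := by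
        rw [← hKe]
        exact NN_inf' hmu.1 (CC_nm em (pow_clean hE.cp h.prim))
      have hfix : ∀ x ∈ Q, x⁻¹ * c * x * c⁻¹ ∈ Q0 → x ∈ Q0 := by
        intro x hx hxc
        obtain ⟨a, ha, hac⟩ := LC h.hp (not_dvd_of_pgroup h.hp Nat.prime_two hp2 (W.hQ.isPGroup.to_le inf_le_left : IsPGroup 2 Q0)) hc0 hE.cp hxc
        have h1 : x * a ∈ Q0 := by
          rw [← hKe]; exact mi (mul_mem hx ha.1) (mem_CC.2 hac)
        have := mul_mem h1 (inv_mem ha)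
        simpa using this
      have hind : ∀ j : ℕ, ∀ y ∈ R, (∀ x ∈ Q, x⁻¹ * y ^ r ^ j * x * (y ^ r ^ j)⁻¹ ∈ Q0) → ∀ x ∈ Q, x⁻¹ * y * x * y⁻¹ ∈ Q0 := by
        intro j
        induction j with
        | zero => intro y _ hy; simpa using hy
        | succ j ih =>
          intro y hy hyj
          have h1 := ih (y ^ r) (pow_mem hy r) (by rw [← pow_mul, ← pow_succ']; exact hyj)
          exact E2 h.hp hp2 h.prim hr hr2 hrp inf_le_left hab hsq
            (lt_of_lt_of_le hcQ (Nat.le_mul_of_pos_right _ Nat.card_pos)) hE.cp em hc0 W.cQ hw0 hmu.1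
            (hY0 y (hR.1 hy)) (hR.1 hy).1 hfix h1 (mem_CS.1 hcR y hy).symm (mem_CS.1 hmu.2 y hy).symm
      intro y hy
      refine ⟨hR.1 hy, ?_⟩
      obtain ⟨j, hj⟩ := hR.isPGroup ⟨y, hy⟩
      have hj' : y ^ r ^ j = 1 := congrArg Subtype.val hj
      apply hind j y hy
      intro x hx
      rw [hj']; simp [one_mem]
  obtain ⟨R, hR, hRE⟩ := key
  have := Subgroup.card_dvd_of_le hRE
  rw [hR.2] at this
  exact (hr.pow_dvd_iff_le_factorization (card_ne _)).1 this

lemma S7a (h : ST π p l l' σ ω Al) (hω : ω ∈ Al) : Concl π σ := by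
  by_contra hcon
  rcases S3 h with h1 | ⟨Q, c, P, z, w, W⟩
  · exact hcon h1
  · exact S7a0 h hcon W (C_normal' h hcon W (S7Y h hcon hω W) (S7core h hcon W))

lemma S7b (h : ST π p l l' σ ω Al) (h2 : (Nat.card π.ker).factorization 2 < p - 1) : Concl π σ := by
  by_contra hcon
  rcases S3 h with h1 | ⟨Q, c, P, z, w, W⟩
  · exact hcon h1
  · have hp2 : p ≠ 2 := by have := h.hp5; omega
    apply W.cnC
    refine R4 h.hp hp2 h.prim W.hQ.isPGroup ?_ W.hE.cp W.wc W.cQ W.wQ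
    rw [W.hQ.2]; exact Nat.pow_lt_pow_right one_lt_two h2
end
end SP

namespace SP

lemma syl3 {A : Type*} [Group A] [Finite A] {p : ℕ} (hp : p.Prime) {H P : Subgroup A} (h : IsSyl p H P) :
    (NN P).relIndex H % p = 1 := by
  haveI := Fact.mk hp
  obtain ⟨P', rfl⟩ := isSyl_iff.1 h
  have h1 := card_sylow_modEq_one p H
  rw [P'.card_eq_index_normalizer] at h1
  have h2 : Subgroup.normalizer (P' : Set H) = (NN ((P' : Subgroup H).map H.subtype)).subgroupOf H := by
    ext x
    constructor
    · intro hx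
      apply mem_nm
      rintro _ ⟨y, hy, rfl⟩
      exact ⟨x * y * x⁻¹, (Subgroup.mem_normalizer_iff.1 hx y).1 hy, by simp⟩
    · intro hx
      refine (mem_nm (Q := (P' : Subgroup H)) fun y hy => ?_ : x ∈ NN (P' : Subgroup H))
      obtain ⟨y', hy', e⟩ := nm_conj (Subgroup.mem_subgroupOf.1 hx) (Subgroup.mem_map_of_mem H.subtype hy)
      have : y' = x * y * x⁻¹ := Subtype.ext (by simpa using e)
      rw [← this]; exact hy'
  rw [h2] at h1
  have := h1
  unfold Nat.ModEq at this
  rw [Nat.mod_eq_of_lt hp.one_lt] at this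
  exact this

section
variable {A S : Type*} [Group A] [Finite A] [Group S] [Finite S] {π : A →* S} {l l' : ℕ}
    {σ ω : S} {Al : Subgroup S}

lemma S7c (h : ST π 5 l l' σ ω Al) (h720 : Nat.card π.ker = 720) : Concl π σ := by
  by_contra hcon
  rcases S3 h with h1 | ⟨Q, c, P, z, w, W⟩
  · exact hcon h1
  have hE := W.hE
  haveI := Fact.mk h.hp
  have hf : (720 : ℕ).factorization 2 = 4 := by
    have := factorization_mul_pow (q := 2) (k := 4) (m := 45) Nat.prime_two (by norm_num)
    norm_num at this
    rw [this]
    simp [Nat.factorization_eq_zero_of_not_dvd]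
  have hQ16 : Nat.card Q = 16 := by rw [W.hQ.2, h720, hf]; norm_num
  obtain ⟨hle, -⟩ := S4 h hcon W
  have h01 : Nat.card (Q ⊓ CC z : Subgroup A) = 1 := by
    have : 0 < Nat.card (Q ⊓ CC z : Subgroup A) := Nat.card_pos
    rw [show 2 ^ (5-1) = 16 by norm_num] at hle
    omega
  have hbot : Q ⊓ CC z = ⊥ := Subgroup.card_eq_one.1 h01
  have hcbot : Q ⊓ CC c = ⊥ := by rw [S5 h hcon W, hbot]
  obtain ⟨-, -, hsq⟩ := S6' h hcon W
  have hsq' : ∀ x ∈ Q, x ^ 2 = 1 := fun x hx => by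
    have := hsq x hx
    rwa [hbot, Subgroup.mem_bot] at this
  obtain ⟨-, k, hk1, hk2⟩ := Q0syl h hE.zt W.hQ
  have hC45 : Nat.card (π.ker ⊓ CC z : Subgroup A) = 45 := by
    rw [h01, hQ16, mul_one] at hk2
    rw [h720, ← hk2] at hk1; omega
  set C := π.ker ⊓ CC z with hC
  have hPC : P ≤ C := le_inf hE.PN fun x hx => mem_CC.2 (mem_CS.1 (comm_le _ hE.zG) x hx).symm
  have hPs := syl_of h hE.PN hE.cP
  have hPCs : IsSyl 5 C P := hPs.mono hPC inf_le_left
  obtain ⟨t, htP, htne⟩ : ∃ t, t ∈ P ∧ t ≠ 1 := ⟨_, hE.tP, W.hne⟩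
  have ht5 : t ^ 5 = 1 := pow_card_eq hE.cP htP
  have hto : orderOf t = 5 := orderOf_eq_prime ht5 htne
  have hCN : C ≤ NN P := by
    rw [← Subgroup.relIndex_eq_one]
    have h1 := syl3 h.hp hPCs
    have h2 := relIndex_mul_card (inf_le_right : NN P ⊓ C ≤ C)
    rw [Subgroup.inf_relIndex_right, hC45] at h2
    have h3 := Subgroup.card_dvd_of_le (le_inf (le_NN P) hPC)
    rw [hE.cP] at h3
    obtain ⟨j, hj⟩ := h3
    rw [hj] at h2
    have h4 : (NN P).relIndex C * j = 9 := by nlinarith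
    have h5 : (NN P).relIndex C ∣ 9 := ⟨j, h4.symm⟩
    have h6 := Nat.le_of_dvd (by norm_num) h5
    generalize (NN P).relIndex C = r at *
    interval_cases r <;> omega
  have hCC : C ≤ CS P := by
    intro x hx
    obtain ⟨a, ha⟩ := mem_pow_of_card h.hp hE.cP htP htne (nm_conj (hCN hx) htP)
    apply CS_of_comm h.hp hE.cP htP htne
    have hx45 : x ^ 45 = 1 := by
      rw [← hC45]; exact congrArg Subtype.val (pow_card_eq_one' (x := (⟨x, hx⟩ : C)))
    have hpw : ∀ k : ℕ, x ^ k * t * (x ^ k)⁻¹ = t ^ a ^ k := by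
      intro k
      induction k with
      | zero => simp
      | succ k ih =>
        calc x ^ (k+1) * t * (x ^ (k+1))⁻¹ = x * (x ^ k * t * (x^k)⁻¹) * x⁻¹ := by rw [pow_succ']; group
          _ = (x * t * x⁻¹) ^ a ^ k := by rw [ih, conj_pow]
          _ = _ := by rw [ha, ← pow_mul, ← pow_succ']
    have h1 := hpw 45
    rw [hx45] at h1
    have h2 : t ^ 1 = t ^ a ^ 45 := by rw [← h1]; simp
    rw [pow_eq_pow_iff_modEq, hto] at h2
    have h3 : a % 5 = 1 := by
      unfold Nat.ModEq at h2
      rw [Nat.pow_mod] at h2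
      have : a % 5 < 5 := Nat.mod_lt _ (by norm_num)
      interval_cases a % 5 <;> simp_all
    rw [pow_mod ht5 h3] at ha
    exact mul_inv_eq_iff_eq_mul.1 ha
  have hN := syl3 h.hp hPs
  have h2 := relIndex_mul_card (inf_le_right : NN P ⊓ π.ker ≤ π.ker)
  rw [Subgroup.inf_relIndex_right, h720] at h2
  have hCle : C ≤ NN P ⊓ π.ker := le_inf hCN inf_le_left
  obtain ⟨j, hj⟩ := Subgroup.card_dvd_of_le hCle
  rw [hC45] at hj
  rw [hj] at h2
  have h4 : (NN P).relIndex π.ker * j = 16 := by nlinarith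
  have h5 : (NN P).relIndex π.ker ≤ 16 := Nat.le_of_dvd (by norm_num) ⟨j, h4.symm⟩
  have h6 : (NN P).relIndex π.ker = 16 ∨ (NN P).relIndex π.ker = 1 := by
    generalize (NN P).relIndex π.ker = r at *
    interval_cases r <;> omega
  have hdt : ∀ y ∈ NN Q ⊓ π.ker, y ^ 5 = 1 → y ≠ 1 → False := by
    intro y hy h1 h2
    apply W.hd
    rw [← orderOf_eq_prime h1 h2]
    exact Subgroup.orderOf_dvd_natCard _ hy
  rcases h6 with h6 | h6
  · have hj1 : j = 1 := by rw [h6] at h4; omega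
    have hCe : C = NN P ⊓ π.ker := Subgroup.eq_of_le_of_card_ge hCle (by rw [hj, hC45, hj1])
    obtain ⟨D, a1, a2, a3, a4, a5⟩ := S6 h.hp hPs (fun x hx hxP => hCC (hCe ▸ mi hxP hx))
    have htD : t ∈ NN D := a5 _ (ker_nm π t)
    obtain ⟨T, b1, b2⟩ := isSyl_fixed (q := 2) h.hp ht5 htD a2
    have hT : IsSyl 2 π.ker T := by
      refine ⟨b1.1.trans a1, ?_⟩
      rw [b1.2]
      congr 1
      rw [a3, hE.cP, Nat.factorization_mul (card_ne _) (by norm_num)]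
      simp [Nat.factorization_eq_zero_of_not_dvd]
    obtain ⟨m, hm, hx⟩ := isSyl_conj W.hQ hT
    refine hdt (m⁻¹ * t * m) (mi (mem_nm fun x hxQ => ?_) (nm_conj' (ker_nm π m) (hE.PN htP))) ?_ ?_
    · have k1 : m * x * m⁻¹ ∈ T := (hx _).2 (by rwa [cc1])
      have k2 := (hx _).1 (nm_conj b2 k1)
      convert k2 using 1; group
    · have := conj_pow (i := 5) (a := m⁻¹) (b := t)
      rw [inv_inv] at this
      rw [this, ht5]; simp
    · intro h1
      apply htne
      have : t = m * (m⁻¹ * t * m) * m⁻¹ := by group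
      rw [this, h1]; simp
  · have hNN : π.ker ≤ NN P := Subgroup.relIndex_eq_one.1 h6
    have hpm : ∀ x ∈ Q, x * t * x⁻¹ = t ∨ x * t * x⁻¹ = t⁻¹ := by
      intro x hx
      obtain ⟨a, ha⟩ := mem_pow_of_card h.hp hE.cP htP htne (nm_conj (hNN (W.hQ.1 hx)) htP)
      have h1 : t ^ 1 = t ^ (a * a) := by
        rw [pow_mul, ← ha, conj_pow, ← ha]
        have := hsq' x hx
        calc t ^ 1 = x ^ 2 * t * (x ^ 2)⁻¹ := by rw [this]; simp
          _ = _ := by rw [pow_two]; group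
      rw [pow_eq_pow_iff_modEq, hto] at h1
      have h3 : a % 5 = 1 ∨ a % 5 = 4 := by
        unfold Nat.ModEq at h1
        rw [Nat.mul_mod] at h1
        have : a % 5 < 5 := Nat.mod_lt _ (by norm_num)
        interval_cases a % 5 <;> simp_all
      rcases h3 with h3 | h3
      · left; rw [ha, pow_mod ht5 h3]
      · right
        rw [ha, eq_inv_iff_mul_eq_one, ← pow_succ, ← orderOf_dvd_iff_pow_eq_one, hto]
        omega
    have hxy : ∀ x ∈ Q, x ∉ CS P → x * t * x⁻¹ = t⁻¹ := by
      intro x hx hxC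
      refine (hpm x hx).resolve_left fun h1 => hxC ?_
      apply CS_of_comm h.hp hE.cP htP htne
      exact mul_inv_eq_iff_eq_mul.1 h1
    by_cases hX : Q ≤ CS P
    · refine hdt t (mi (CS_le_NN _ (mem_CS.2 fun x hx => ?_)) (hE.PN htP)) ht5 htne
      exact (mem_CS.1 (hX hx) _ htP).symm
    have hXb : Q ⊓ CS P = ⊥ := by
      rw [eq_bot_iff, ← hcbot]
      have hc := R4 (Q := Q ⊓ CS P) h.hp (q := 2) (by norm_num) h.prim (W.hQ.isPGroup.to_le inf_le_left) ?_ hE.cp W.wc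
        (NN_inf' W.cQ (le_NN _ hE.cC)) (NN_inf' W.wQ (NN_CS (WW.wP h W)))
      · intro x hx
        exact mi hx.1 (mem_CC.2 (mem_CS.1 hc x hx).symm)
      · have h1 : Nat.card (Q ⊓ CS P : Subgroup A) ≤ Nat.card Q := Subgroup.card_le_of_le inf_le_left
        have h2 : Nat.card (Q ⊓ CS P : Subgroup A) ≠ Nat.card Q := fun e =>
          hX (inf_eq_left.1 (Subgroup.eq_of_le_of_card_ge inf_le_left e.ge))
        rw [show 2 ^ (5-1) = 16 by norm_num]
        omega
    have hnot : ∀ x ∈ Q, x ≠ 1 → x ∉ CS P := fun x hx h1 h2 => h1 (by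
      have : x ∈ Q ⊓ CS P := mi hx h2
      rwa [hXb, Subgroup.mem_bot] at this)
    have hone : ∀ x ∈ Q, ∀ y ∈ Q, x ≠ 1 → y ≠ 1 → x = y := by
      intro x hx y hy h1 h2
      by_contra hne
      have hxy1 : x⁻¹ * y ≠ 1 := fun e => hne (inv_mul_eq_one.1 e)
      apply hnot _ (mul_mem (inv_mem hx) hy) hxy1
      apply CS_of_comm h.hp hE.cP htP htne
      have e1 := hxy x hx (hnot x hx h1)
      have e2 := hxy y hy (hnot y hy h2)
      have e3 : x * t * x⁻¹ = y * t * y⁻¹ := by rw [e1, e2]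
      calc x⁻¹ * y * t = x⁻¹ * (y * t * y⁻¹) * y := by group
        _ = _ := by rw [← e3]; group
    have : Nat.card Q ≤ 2 := by
      by_cases hq : ∃ x : Q, x ≠ 1
      · obtain ⟨x, hx⟩ := hq
        have hs : (Set.univ : Set Q) ⊆ {1, x} := by
          intro y _
          by_cases hy : y = 1
          · simp [hy]
          · right
            exact Subtype.ext (hone y y.2 x x.2 (fun e => hy (Subtype.ext e)) (fun e => hx (Subtype.ext e)))
        have := Set.ncard_le_ncard hs (Set.toFinite _)
        rw [Set.ncard_univ] at this
        exact this.trans (Set.ncard_insert_le _ _ |>.trans (by simp))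
      · push Not at hq
        haveI : Subsingleton Q := ⟨fun a b => by rw [hq a, hq b]⟩
        exact (Finite.card_le_one_iff_subsingleton.2 this).trans (by norm_num)
    omega
end
end SP

namespace SP

lemma v2_odd (j : ℕ) : padicValNat 2 (2 * j + 1).factorial = padicValNat 2 (2 * j).factorial :=
  padicValNat_factorial_mul_add j one_lt_two

lemma v2_three : ∀ k : ℕ, 0 < k → 3 ∣ k → padicValNat 2 k.factorial + 2 ≤ k := by
  intro k
  induction k using Nat.strong_induction_on with
  | _ k ih =>
    intro h0 h3
    rcases Nat.even_or_odd' k with ⟨j, rfl | rfl⟩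
    · have := ih j (by omega) (by omega) (by omega)
      rw [padicValNat_factorial_mul]; omega
    · rw [v2_odd]
      have := padicValNat_factorial_lt_of_ne_zero (p := 2) (n := 2 * j) (by omega)
      omega

lemma choose_p (n : ℕ) (hn : 5 ≤ n) : ∃ p, p.Prime ∧ 5 ≤ p ∧ p ≤ n ∧ n + 2 ≤ 2 * p ∧
    (p + 2 ≤ n ∨ padicValNat 2 n.factorial < p - 1 ∨ (n = 6 ∧ p = 5)) := by
  have h4 : ¬ Nat.Prime 4 := by norm_num
  rcases Nat.even_or_odd' n with ⟨m, rfl | rfl⟩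
  · obtain ⟨p, hp, hp1, hp2⟩ := Nat.exists_prime_lt_and_le_two_mul (m - 1) (by omega)
    have e1 : p % 2 = 1 := hp.eq_two_or_odd.resolve_left (by omega)
    by_cases hm : p = m
    · obtain ⟨q, hq, hq1, hq2⟩ := Nat.exists_prime_lt_and_le_two_mul m (by omega)
      have e2 : q % 2 = 1 := hq.eq_two_or_odd.resolve_left (by omega)
      refine ⟨q, hq, by omega, by omega, by omega, ?_⟩
      by_cases h5 : q + 2 ≤ 2 * m
      · exact Or.inl h5
      right
      by_cases h6 : m = 3
      · right; omega
      left
      subst hm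
      have hq3 : q = 2 * p - 1 := by omega
      have a1 : p % 3 ≠ 0 := fun h => by
        have := (Nat.prime_dvd_prime_iff_eq Nat.prime_three hp).1 (Nat.dvd_of_mod_eq_zero h); omega
      have a2 : q % 3 ≠ 0 := fun h => by
        have := (Nat.prime_dvd_prime_iff_eq Nat.prime_three hq).1 (Nat.dvd_of_mod_eq_zero h); omega
      have a0 : p % 3 = 1 ∨ p % 3 = 2 := by omega
      have a3 : 3 ∣ p - 1 := by
        rcases a0 with a0 | a0
        · omega
        · exact absurd (by omega : q % 3 = 0) a2
      have a4 := v2_three (p - 1) (by omega) a3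
      have a5 := v2_odd ((p - 1) / 2)
      rw [show 2 * ((p - 1) / 2) + 1 = p by omega, show 2 * ((p - 1) / 2) = p - 1 by omega] at a5
      rw [padicValNat_factorial_mul]
      omega
    · have e3 : p ≠ 4 := fun h => h4 (h ▸ hp)
      exact ⟨p, hp, by omega, by omega, by omega, Or.inl (by omega)⟩
  · obtain ⟨p, hp, hp1, hp2⟩ := Nat.exists_prime_lt_and_le_two_mul (m + 1) (by omega)
    have e1 : p % 2 = 1 := hp.eq_two_or_odd.resolve_left (by omega)
    have e3 : p ≠ 4 := fun h => h4 (h ▸ hp)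
    refine ⟨p, hp, by omega, by omega, by omega, ?_⟩
    by_cases h5 : p + 2 ≤ 2 * m + 1
    · exact Or.inl h5
    right; left
    rw [v2_odd]
    have := padicValNat_factorial_lt_of_ne_zero (p := 2) (n := 2 * m) (by omega)
    omega

lemma choose_q (n : ℕ) (hn : 5 ≤ n) (h6 : n ≠ 6) : ∃ p, p.Prime ∧ 3 ≤ p ∧ p + 2 ≤ n ∧
    (n < 2 * p ∨ (n = 2 * p ∧ 5 ≤ p)) := by
  have h4 : ¬ Nat.Prime 4 := by norm_num
  rcases Nat.even_or_odd' n with ⟨m, rfl | rfl⟩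
  · obtain ⟨p, hp, hp1, hp2⟩ := Nat.exists_prime_lt_and_le_two_mul (m - 1) (by omega)
    have e3 : p ≠ 4 := fun h => h4 (h ▸ hp)
    exact ⟨p, hp, by omega, by omega, by omega⟩
  · obtain ⟨p, hp, hp1, hp2⟩ := Nat.exists_prime_lt_and_le_two_mul m (by omega)
    have e1 : p % 2 = 1 := hp.eq_two_or_odd.resolve_left (by omega)
    exact ⟨p, hp, by omega, by omega, by omega⟩

lemma exists_prim (p : ℕ) (hp : p.Prime) : ∃ l l', Prim p l l' := by
  haveI := Fact.mk hp
  obtain ⟨u, hu⟩ := IsCyclic.exists_generator (α := (ZMod p)ˣ)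
  refine ⟨((u⁻¹ : (ZMod p)ˣ) : ZMod p).val, (u : ZMod p).val, ?_, ?_⟩
  · have : ((((u⁻¹ : (ZMod p)ˣ) : ZMod p).val * (u : ZMod p).val : ℕ) : ZMod p) = ((1 : ℕ) : ZMod p) := by
      push_cast
      rw [ZMod.natCast_zmod_val, ZMod.natCast_zmod_val]; exact inv_mul_cancel₀ u.ne_zero
    rw [ZMod.natCast_eq_natCast_iff] at this
    unfold Nat.ModEq at this
    rw [this, Nat.mod_eq_of_lt hp.one_lt]
  · rw [ZMod.natCast_zmod_val, orderOf_units, orderOf_eq_card_of_forall_mem_zpowers hu, Nat.card_eq_fintype_card, ZMod.card_units]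

lemma v_p {n p : ℕ} (hp : p.Prime) (h1 : p ≤ n) (h2 : n < 2 * p) : n.factorial.factorization p = 1 := by
  haveI := Fact.mk hp
  rw [Nat.factorization_def _ hp, ← padicValNat_mul_div_factorial]
  have : n / p = 1 := by
    rw [Nat.div_eq_iff hp.pos]; constructor <;> omega
  rw [this, padicValNat_factorial_mul]; simp

lemma v_q {n p q : ℕ} (hn : 5 ≤ n) (hq : q.Prime) (h2 : n + 2 ≤ 2 * p) (hq2 : q ≠ 2) : n.factorial.factorization q < p - 1 := by
  haveI := Fact.mk hq
  rw [Nat.factorization_def _ hq]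
  have h := sub_one_mul_padicValNat_factorial_lt_of_ne_zero (p := q) (n := n) (by omega)
  have : 2 ≤ q - 1 := by have := hq.two_le; omega
  have := Nat.mul_le_mul_right (padicValNat q n.factorial) this
  omega

lemma v_2 {n p : ℕ} (hn : 5 ≤ n) (h2 : n + 2 ≤ 2 * p) : n.factorial.factorization 2 < 2 * (p - 1) := by
  rw [Nat.factorization_def _ Nat.prime_two]
  have := padicValNat_factorial_lt_of_ne_zero (p := 2) (n := n) (by omega)
  omega
end SP

namespace SP
open Equiv

lemma cardFin (n : ℕ) (hn : 5 ≤ n) : 5 ≤ Nat.card (Fin n) := by simpa using hn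

lemma cycle_conj {n p : ℕ} (hp : p.Prime) {σ τ : Perm (Fin n)} (h1 : σ.IsCycle) (h2 : τ.IsCycle)
    (o1 : orderOf σ = p) (o2 : orderOf τ = p) : IsConj σ τ := by
  rw [h1.isConj_iff h2, ← h1.orderOf, ← h2.orderOf, o1, o2]

lemma odd_mem_alt {n p : ℕ} (hp : p.Prime) (hp2 : p ≠ 2) {σ : Perm (Fin n)} (h : σ ^ p = 1) : σ ∈ alternatingGroup (Fin n) := by
  rw [Perm.mem_alternatingGroup]
  have h1 : (Perm.sign σ) ^ p = 1 := by rw [← map_pow, h, map_one]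
  have h2 : Odd p := hp.odd_of_ne_two hp2
  rcases Int.units_eq_one_or (Perm.sign σ) with e | e
  · exact e
  · rw [e, h2.neg_one_pow] at h1; exact absurd h1 (by decide)

lemma exists_omega {n p l l' : ℕ} (hn : 5 ≤ n) (hp : p.Prime) (hp5 : 5 ≤ p) (h2 : n + 2 ≤ 2 * p) (hP : Prim p l l')
    {σ : Perm (Fin n)} (hσ : orderOf σ = p) :
    ∃ ω : Perm (Fin n), ω * σ * ω⁻¹ = σ ^ l ∧ (p + 2 ≤ n → ω ∈ alternatingGroup (Fin n)) := by
  have hl : Nat.Coprime (orderOf σ) l := by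
    rw [hσ, hp.coprime_iff_not_dvd]
    intro hd
    have := hP.1
    rw [Nat.mod_eq_zero_of_dvd (hd.mul_right l')] at this
    omega
  have ho : orderOf (σ ^ l) = p := by rw [hl.orderOf_pow, hσ]
  have cyc : ∀ τ : Perm (Fin n), orderOf τ = p → τ.IsCycle := fun τ ht =>
    Perm.isCycle_of_prime_order' (by rwa [ht]) (by rw [ht]; simp; omega)
  have hc := cycle_conj hp (cyc σ hσ) (cyc _ ho) hσ ho
  by_cases h : p + 2 ≤ n
  · have mA := odd_mem_alt hp (by omega) (hσ ▸ pow_orderOf_eq_one σ)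
    have mA2 := odd_mem_alt hp (by omega) (ho ▸ pow_orderOf_eq_one (σ ^ l))
    have := alternatingGroup.isConj_of (σ := ⟨σ, mA⟩) (τ := ⟨σ ^ l, mA2⟩) hc (by
      rw [← (cyc σ hσ).orderOf, hσ]; simpa using h)
    obtain ⟨ω, hω⟩ := isConj_iff.1 this
    exact ⟨ω, congrArg Subtype.val hω, fun _ => ω.2⟩
  · obtain ⟨ω, hω⟩ := isConj_iff.1 hc
    exact ⟨ω, hω, fun h' => absurd h' h⟩

theorem getConcl (n : ℕ) (hn : 5 ≤ n) (N : Type*) [Group N] (hcard : Nat.card N = n.factorial)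
    (f : Perm (Fin n) →* MulAut N) : ∃ σ : Perm (Fin n), σ ≠ 1 ∧
      Concl (SemidirectProduct.rightHom : N ⋊[f] Perm (Fin n) →* Perm (Fin n)) σ := by
  haveI : Finite N := Nat.finite_of_card_ne_zero (by rw [hcard]; exact n.factorial_ne_zero)
  haveI : Finite (N ⋊[f] Perm (Fin n)) := Finite.of_equiv _ SemidirectProduct.equivProd.symm
  obtain ⟨p, hp, hp5, hpn, h2, hc⟩ := choose_p n hn
  haveI := Fact.mk hp
  obtain ⟨l, l', hP⟩ := exists_prim p hp
  obtain ⟨σ, hσ⟩ := exists_prime_orderOf_dvd_card (G := Perm (Fin n)) p (by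
    rw [Fintype.card_perm, Fintype.card_fin]; exact (hp.dvd_factorial).2 hpn)
  obtain ⟨ω, hω, hωA⟩ := exists_omega hn hp hp5 h2 hP hσ
  have hk : Nat.card (SemidirectProduct.rightHom : N ⋊[f] Perm (Fin n) →* Perm (Fin n)).ker = n.factorial := by
    rw [← SemidirectProduct.range_inl_eq_ker_rightHom, ← hcard]
    exact (Nat.card_congr (MonoidHom.ofInjective SemidirectProduct.inl_injective).toEquiv).symm
  have hS : Nat.card (Perm (Fin n)) = n.factorial := by rw [Nat.card_eq_fintype_card, Fintype.card_perm, Fintype.card_fin]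
  have s1 : σ ≠ 1 := fun h => by rw [h, orderOf_one] at hσ; omega
  have hST : ST (SemidirectProduct.rightHom : N ⋊[f] Perm (Fin n) →* Perm (Fin n)) p l l' σ ω (alternatingGroup (Fin n)) :=
    { surj := SemidirectProduct.rightHom_surjective
      hp := hp
      hp5 := hp5
      vN := by rw [hk]; exact v_p hp hpn (by omega)
      vA := by
        rw [SemidirectProduct.card, hcard, hS, Nat.factorization_mul n.factorial_ne_zero n.factorial_ne_zero, Finsupp.add_apply,
          v_p hp hpn (by omega)]
      prim := hP
      sp := hσ ▸ pow_orderOf_eq_one σ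
      s1 := s1
      ws := hω
      per := commutator_alternatingGroup_eq_self (cardFin n hn)
      sA := odd_mem_alt hp (by omega) (hσ ▸ pow_orderOf_eq_one σ)
      nor := by
        intro M hM hs
        refine Perm.alternatingGroup_le_of_normal (cardFin n hn) ?_
        exact ⟨⟨⟨σ, hs⟩, 1, fun h => s1 (congrArg Subtype.val h)⟩⟩
      odd := by
        intro q hq _ hq2
        rw [hk]; exact v_q hn hq h2 hq2
      two := by rw [hk]; exact v_2 hn h2 }
  refine ⟨σ, s1, ?_⟩
  rcases hc with hc | hc | ⟨rfl, rfl⟩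
  · exact S7a hST (hωA hc)
  · exact S7b hST (by rw [hk, Nat.factorization_def _ Nat.prime_two]; exact hc)
  · exact S7c hST (by rw [hk]; rfl)
end SP

namespace SP
open Equiv

lemma odd_mem_alt' {n k : ℕ} (h2 : Odd k) {σ : Perm (Fin n)} (h : σ ^ k = 1) : σ ∈ alternatingGroup (Fin n) := by
  rw [Perm.mem_alternatingGroup]
  have h1 : (Perm.sign σ) ^ k = 1 := by rw [← map_pow, h, map_one]
  rcases Int.units_eq_one_or (Perm.sign σ) with e | e
  · exact e
  · rw [e, h2.neg_one_pow] at h1; exact absurd h1 (by decide)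

lemma cube_cycle {p : ℕ} (hp : p.Prime) (hp5 : 5 ≤ p) {y : Perm (Fin (2 * p))} (hy : orderOf y = 3 * p) :
    orderOf (y ^ 3) = p ∧ (y ^ 3).IsCycle := by
  haveI := Fact.mk hp
  have hu : orderOf (y ^ 3) = p := by
    rw [orderOf_pow_of_dvd (by norm_num) (by rw [hy]; exact dvd_mul_right _ _), hy]; omega
  have hv : orderOf (y ^ p) = 3 := by
    rw [orderOf_pow_of_dvd (by omega) (by rw [hy]; exact dvd_mul_left _ _), hy]
    exact Nat.mul_div_cancel _ hp.pos
  refine ⟨hu, ?_⟩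
  obtain ⟨k, hk⟩ := Perm.cycleType_prime_order (σ := y ^ 3) (by rwa [hu])
  have hs := Perm.sum_cycleType (y ^ 3)
  rw [hk, Multiset.sum_replicate, hu, smul_eq_mul] at hs
  have hle : (y ^ 3).support.card ≤ 2 * p := by simpa using Finset.card_le_univ (y ^ 3).support
  have hk2 : k + 1 ≤ 2 := by
    rw [← hs] at hle
    exact Nat.le_of_mul_le_mul_right hle hp.pos
  by_cases hk0 : k = 0
  · rw [← Perm.card_cycleType_eq_one, hk, Multiset.card_replicate, hk0]
  exfalso
  have hk1 : k = 1 := by omega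
  subst hk1
  have huniv : (y ^ 3).support = Finset.univ := by
    rw [← Finset.card_eq_iff_eq_univ, ← hs]; simp
  obtain ⟨j, hj⟩ := Perm.cycleType_prime_order (σ := y ^ p) (by rw [hv]; exact Nat.prime_three)
  have hs2 := Perm.sum_cycleType (y ^ p)
  rw [hj, Multiset.sum_replicate, hv, smul_eq_mul] at hs2
  have hle2 : (y ^ p).support.card ≤ 2 * p := by simpa using Finset.card_le_univ (y ^ p).support
  have hcomm : Commute (y ^ 3) (y ^ p) := (Commute.refl y).pow_pow 3 p
  have hinv : ∀ x, (y ^ 3) x ∈ (y ^ p).support ↔ x ∈ (y ^ p).support := by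
    intro x
    rw [Perm.mem_support, Perm.mem_support, not_iff_not, ← Perm.mul_apply, ← hcomm.eq, Perm.mul_apply, (y ^ 3).injective.eq_iff]
  let w : Perm {x // x ∈ (y ^ p).support} := (y ^ 3).subtypePerm hinv
  have hwp : w ^ p ^ 1 = 1 := by
    rw [pow_one]
    simp only [w, Perm.subtypePerm_pow]
    ext x
    simp only [Perm.subtypePerm_apply]
    have : (y ^ 3) ^ p = 1 := orderOf_dvd_iff_pow_eq_one.1 (by rw [hu])
    rw [this]; simp
  have hmod := Perm.card_compl_support_modEq hwp
  have hempty : w.supportᶜ = ∅ := by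
    rw [Finset.compl_eq_empty_iff, Finset.eq_univ_iff_forall]
    intro x
    rw [Perm.mem_support]
    intro h
    have h1 : (y ^ 3) x = x := congrArg Subtype.val h
    have h2 : (x : Fin (2 * p)) ∈ (y ^ 3).support := by rw [huniv]; exact Finset.mem_univ _
    exact Perm.mem_support.1 h2 h1
  rw [hempty, Finset.card_empty, Fintype.card_coe] at hmod
  have hd : p ∣ (j + 1) * 3 := by
    rw [hs2]; exact (Nat.modEq_zero_iff_dvd).1 hmod.symm
  have hd2 : p ∣ j + 1 := (hp.dvd_mul.1 hd).resolve_right fun h => by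
    have := Nat.le_of_dvd (by norm_num) h; omega
  have := Nat.le_of_dvd (by omega) hd2
  omega

lemma ord_alt {n : ℕ} (θ : alternatingGroup (Fin n) ≃* alternatingGroup (Fin n)) (x : alternatingGroup (Fin n)) :
    orderOf ((θ x : alternatingGroup (Fin n)) : Perm (Fin n)) = orderOf (x : Perm (Fin n)) := by
  rw [Subgroup.orderOf_coe, Subgroup.orderOf_coe, MulEquiv.orderOf_eq]

lemma type42 {y : Perm (Fin 6)} (hy : y ∈ alternatingGroup (Fin 6)) (ho : orderOf y = 4) : y.cycleType = {4, 2} := by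
  have h1 := Perm.lcm_cycleType y
  rw [ho] at h1
  have h2 := Perm.sum_cycleType y
  have h3 : y.support.card ≤ 6 := by simpa using Finset.card_le_univ y.support
  rw [← h2] at h3
  have h4 : ∀ a ∈ y.cycleType, a = 2 ∨ a = 4 := by
    intro a ha
    have e1 := Perm.two_le_of_mem_cycleType ha
    have e2 : a ∣ 4 := h1 ▸ Multiset.dvd_lcm ha
    have e3 := Nat.le_of_dvd (by norm_num) e2
    interval_cases a <;> simp_all
  have h5 : 4 ∈ y.cycleType := by
    by_contra h
    have : y.cycleType.lcm ∣ 2 := Multiset.lcm_dvd.2 fun a ha => by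
      rcases h4 a ha with rfl | rfl
      · exact dvd_rfl
      · exact absurd ha h
    rw [h1] at this
    revert this; decide
  rw [Perm.mem_alternatingGroup, Perm.sign_of_cycleType] at hy
  generalize y.cycleType = m at *
  obtain ⟨m', rfl⟩ := Multiset.exists_cons_of_mem h5
  rcases Multiset.empty_or_exists_mem m' with rfl | ⟨a, ha⟩
  · exfalso; revert hy; simp; decide
  · obtain ⟨m'', rfl⟩ := Multiset.exists_cons_of_mem ha
    rcases Multiset.empty_or_exists_mem m'' with rfl | ⟨b, hb⟩
    · rw [Multiset.sum_cons, Multiset.sum_cons] at h3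
      rcases h4 a (by simp) with rfl | rfl
      · rfl
      · simp at h3
    · exfalso
      obtain ⟨m''', rfl⟩ := Multiset.exists_cons_of_mem hb
      simp only [Multiset.sum_cons] at h3
      have e1 := h4 a (by simp)
      have e2 := h4 b (by simp)
      omega

lemma classFix {n : ℕ} (hn : 5 ≤ n) (θ : alternatingGroup (Fin n) ≃* alternatingGroup (Fin n)) :
    ∃ x b : alternatingGroup (Fin n), 3 ≤ orderOf x ∧ b * θ x * b⁻¹ = x := by
  by_cases h6 : n = 6
  · subst h6
    obtain ⟨x, hx⟩ := (Perm.exists_with_cycleType_iff (α := Fin 6) (m := {4, 2})).2 (by simp)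
    have hxA : x ∈ alternatingGroup (Fin 6) := by
      rw [Perm.mem_alternatingGroup, Perm.sign_of_cycleType, hx]; simp; decide
    have hxo : orderOf x = 4 := by rw [← Perm.lcm_cycleType, hx]; decide
    have hy := type42 (θ ⟨x, hxA⟩).2 (by rw [ord_alt]; exact hxo)
    have hc : IsConj ((θ ⟨x, hxA⟩ : alternatingGroup (Fin 6)) : Perm (Fin 6)) x := by
      rw [Perm.isConj_iff_cycleType_eq, hy, hx]
    obtain ⟨b, hb⟩ := isConj_iff.1 hc
    have h3 : 3 ≤ orderOf (⟨x, hxA⟩ : alternatingGroup (Fin 6)) := by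
      rw [← Subgroup.orderOf_coe]; show 3 ≤ orderOf x; omega
    by_cases hbA : b ∈ alternatingGroup (Fin 6)
    · exact ⟨⟨x, hxA⟩, ⟨b, hbA⟩, h3, Subtype.ext hb⟩
    · obtain ⟨c, τ, e, hd, hcy, hcs⟩ := Perm.mem_cycleType_iff.1 (show 4 ∈ x.cycleType by rw [hx]; simp)
      have hcx : c * x = x * c := by
        rw [e, mul_assoc, ← hd.commute.eq]
      have hsc : Perm.sign c = -1 := by rw [hcy.sign, hcs]; decide
      have hcb : c * b ∈ alternatingGroup (Fin 6) := by
        rw [Perm.mem_alternatingGroup] at hbA ⊢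
        rw [map_mul, hsc, (Int.units_eq_one_or (Perm.sign b)).resolve_left hbA]; decide
      refine ⟨⟨x, hxA⟩, ⟨c * b, hcb⟩, h3, Subtype.ext ?_⟩
      show c * b * _ * (c * b)⁻¹ = x
      calc c * b * ((θ ⟨x, hxA⟩ : alternatingGroup (Fin 6)) : Perm (Fin 6)) * (c * b)⁻¹
          = c * (b * ((θ ⟨x, hxA⟩ : alternatingGroup (Fin 6)) : Perm (Fin 6)) * b⁻¹) * c⁻¹ := by group
        _ = x := by rw [hb, hcx]; group
  · obtain ⟨p, hp, hp3, hpn, hc⟩ := choose_q n hn h6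
    haveI := Fact.mk hp
    have key : ∃ x : alternatingGroup (Fin n), orderOf (x : Perm (Fin n)) = p ∧ (x : Perm (Fin n)).IsCycle ∧
        ((θ x : alternatingGroup (Fin n)) : Perm (Fin n)).IsCycle := by
      rcases hc with hc | ⟨rfl, hp5⟩
      · obtain ⟨σ, hσ⟩ := exists_prime_orderOf_dvd_card (G := Perm (Fin n)) p (by
          rw [Fintype.card_perm, Fintype.card_fin]; exact (hp.dvd_factorial).2 (by omega))
        have cyc : ∀ τ : Perm (Fin n), orderOf τ = p → τ.IsCycle := fun τ ht =>
          Perm.isCycle_of_prime_order' (by rwa [ht]) (by rw [ht]; simpa using hc)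
        refine ⟨⟨σ, odd_mem_alt hp (by omega) (hσ ▸ pow_orderOf_eq_one σ)⟩, hσ, cyc _ hσ, cyc _ ?_⟩
        rw [ord_alt]; exact hσ
      · obtain ⟨y, hy⟩ := (Perm.exists_with_cycleType_iff (α := Fin (2 * p)) (m := {p, 3})).2 (by simp; omega)
        have hyo : orderOf y = 3 * p := by
          rw [← Perm.lcm_cycleType, hy]
          simp only [Multiset.insert_eq_cons, Multiset.lcm_cons, Multiset.lcm_singleton]
          have : Nat.Coprime p 3 := (Nat.coprime_primes hp Nat.prime_three).2 (by omega)
          simp [lcm_eq_nat_lcm, this.lcm_eq_mul, mul_comm]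
        have hodd : Odd (3 * p) := by
          have := hp.odd_of_ne_two (by omega)
          exact Odd.mul (by decide) this
        let Y : alternatingGroup (Fin (2 * p)) := ⟨y, odd_mem_alt' hodd (hyo ▸ pow_orderOf_eq_one y)⟩
        have c1 := cube_cycle hp hp5 hyo
        have c2 := cube_cycle hp hp5 (y := ((θ Y : alternatingGroup (Fin (2 * p))) : Perm _)) (by rw [ord_alt]; exact hyo)
        exact ⟨Y ^ 3, c1.1, c1.2, by rw [map_pow]; exact c2.2⟩
    obtain ⟨x, ho, c1, c2⟩ := key
    have ho2 := (ord_alt θ x).trans ho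
    have hconj := alternatingGroup.isConj_of (σ := θ x) (τ := x) (cycle_conj hp c2 c1 ho2 ho) (by
      rw [← c2.orderOf, ho2]; simpa using hpn)
    obtain ⟨b, hb⟩ := isConj_iff.1 hconj
    exact ⟨x, b, by rw [← Subgroup.orderOf_coe, ho]; exact hp3, hb⟩
end SP

namespace SP
open Equiv

section core
variable {N : Type*} [Group N] [Finite N]

def OO (N : Type*) [Group N] : Subgroup N := ⨅ P : Sylow 2 N, (P : Subgroup N)

lemma OO_pgroup : IsPGroup 2 (OO N) := by
  obtain ⟨P⟩ := (inferInstance : Nonempty (Sylow 2 N))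
  exact P.isPGroup'.to_le (iInf_le _ P)

lemma OO_char (φ : MulAut N) {x : N} (hx : x ∈ OO N) : φ x ∈ OO N := by
  rw [OO, Subgroup.mem_iInf] at hx ⊢
  intro P
  have h1 := hx (φ⁻¹ • P)
  have h2 := Subgroup.smul_mem_pointwise_smul (x : N) φ _ h1
  have h3 : φ • x ∈ ((φ • (φ⁻¹ • P) : Sylow 2 N) : Subgroup N) := h2
  rw [smul_inv_smul] at h3
  exact h3

instance OO_normal : (OO N).Normal := ⟨fun x hx m => OO_char (MulAut.conj m) hx⟩

lemma le_OO {K : Subgroup N} (hK : K.Normal) (h : IsPGroup 2 K) : K ≤ OO N := by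
  haveI : Fact (Nat.Prime 2) := ⟨Nat.prime_two⟩
  obtain ⟨P, hP⟩ := h.exists_le_sylow
  refine le_iInf fun P' => ?_
  obtain ⟨m, rfl⟩ := MulAction.exists_smul_eq N P P'
  intro x hx
  have h1 : m⁻¹ * x * m ∈ K := by simpa using hK.conj_mem x hx m⁻¹
  have h2 := Subgroup.smul_mem_pointwise_smul _ (MulAut.conj m) _ (hP h1)
  have e : (MulAut.conj m) • (m⁻¹ * x * m) = x := by
    show m * (m⁻¹ * x * m) * m⁻¹ = x
    group
  rw [e] at h2
  exact h2

lemma OO_map (φ : MulAut N) : (OO N).map (φ : N →* N) = OO N := by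
  apply le_antisymm
  · rintro _ ⟨x, hx, rfl⟩
    exact OO_char φ hx
  · intro x hx
    exact ⟨φ⁻¹ x, OO_char φ⁻¹ hx, MulAut.apply_inv_self N φ x⟩

def bar (N : Type*) [Group N] [Finite N] : MulAut N →* MulAut (N ⧸ OO N) where
  toFun φ := QuotientGroup.congr (OO N) (OO N) φ (OO_map φ)
  map_one' := by
    ext x
    obtain ⟨x, rfl⟩ := QuotientGroup.mk'_surjective _ x
    rfl
  map_mul' a b := by
    ext x
    obtain ⟨x, rfl⟩ := QuotientGroup.mk'_surjective _ x
    rfl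

lemma bar_mk (φ : MulAut N) (x : N) : bar N φ (QuotientGroup.mk' (OO N) x) = QuotientGroup.mk' (OO N) (φ x) := rfl

lemma bar_conj (x : N) : bar N (MulAut.conj x) = MulAut.conj (QuotientGroup.mk' (OO N) x) := by
  ext y
  obtain ⟨y, rfl⟩ := QuotientGroup.mk'_surjective _ y
  rw [bar_mk, MulAut.conj_apply, MulAut.conj_apply]; simp
end core

section inn
variable {B : Type*} [Group B] [Finite B]

lemma conj_eq (φ : MulAut B) (x : B) : φ * MulAut.conj x * φ⁻¹ = MulAut.conj (φ x) := by
  ext y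
  simp [MulAut.mul_apply]

lemma inn_normal : (MulAut.conj : B →* MulAut B).range.Normal := by
  constructor
  rintro _ ⟨x, rfl⟩ φ
  exact ⟨φ x, (conj_eq φ x).symm⟩

lemma conj_one {x : B} (h : MulAut.conj x = 1) : x ∈ Subgroup.center B := by
  rw [Subgroup.mem_center_iff]
  intro y
  have h1 : x * y * x⁻¹ = y := by
    have := congrArg (fun φ : MulAut B => φ y) h
    simpa using this
  exact (mul_inv_eq_iff_eq_mul.1 h1).symm

lemma conj_inj (hc : Subgroup.center B = ⊥) : Function.Injective (MulAut.conj : B →* MulAut B) := by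
  rw [injective_iff_map_eq_one]
  intro x h
  have := conj_one h
  rwa [hc, Subgroup.mem_bot] at this

lemma lift_inn {H : Type*} [Group H] (hc : Subgroup.center B = ⊥) (ψ : H →* MulAut B)
    (h : ∀ a, ψ a ∈ (MulAut.conj : B →* MulAut B).range) : ∃ φ : H →* B, ∀ a, ψ a = MulAut.conj (φ a) := by
  choose F hF using h
  refine ⟨MonoidHom.mk' F fun a b => conj_inj hc ?_, fun a => (hF a).symm⟩
  rw [hF, map_mul, map_mul, hF, hF]

lemma inn_card {H : Type*} [Group H] (ψ : H →* MulAut B) (hi : Function.Injective ψ)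
    (h : ∀ a, ψ a ∈ (MulAut.conj : B →* MulAut B).range) : Nat.card H * Nat.card (Subgroup.center B) ≤ Nat.card B := by
  haveI : Finite (MulAut B) := Finite.of_injective (fun φ : MulAut B => (φ : B → B)) DFunLike.coe_injective
  have h1 : Nat.card H ≤ Nat.card (MulAut.conj : B →* MulAut B).range :=
    Nat.card_le_card_of_injective (fun a => (⟨ψ a, h a⟩ : (MulAut.conj : B →* MulAut B).range))
      fun a b e => hi (congrArg Subtype.val e)
  have h2 := (MulAut.conj : B →* MulAut B).ker.index_mul_card
  rw [Subgroup.index_ker] at h2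
  have h3 : Subgroup.center B ≤ (MulAut.conj : B →* MulAut B).ker := by
    intro x hx
    rw [MonoidHom.mem_ker]
    ext y
    rw [MulAut.conj_apply, ← Subgroup.mem_center_iff.1 hx y]; simp
  rw [← h2]
  exact Nat.mul_le_mul h1 (Subgroup.card_le_of_le h3)
end inn

section alt
variable {n : ℕ} (hn : 5 ≤ n)
include hn

lemma perf {M : Type*} [Group M] (ψ : alternatingGroup (Fin n) →* M) (h : ∀ a b, ψ a * ψ b = ψ b * ψ a) : ∀ a, ψ a = 1 := by
  intro a
  have h1 : commutator (alternatingGroup (Fin n)) ≤ ψ.ker := by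
    rw [commutator_def, Subgroup.commutator_le]
    intro x _ y _
    rw [MonoidHom.mem_ker, map_commutatorElement, commutatorElement_eq_one_iff_mul_comm]
    exact h x y
  rw [commutator_alternatingGroup_eq_top (cardFin n hn)] at h1
  exact h1 (Subgroup.mem_top a)

lemma inj_or {M : Type*} [Group M] (ψ : alternatingGroup (Fin n) →* M) : Function.Injective ψ ∨ ∀ a, ψ a = 1 := by
  haveI := alternatingGroup.isSimpleGroup (cardFin n hn)
  rcases (inferInstance : ψ.ker.Normal).eq_bot_or_eq_top with h | h
  · exact Or.inl ((MonoidHom.ker_eq_bot_iff ψ).1 h)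
  · right; intro a
    have : a ∈ ψ.ker := by rw [h]; trivial
    exact this

lemma fin_of_hom {N : Type*} [Group N] (ψ : alternatingGroup (Fin n) →* N) (hi : Function.Injective ψ) :
    ∃ H : Subgroup N, Nonempty (H ≃* alternatingGroup (Fin n)) :=
  ⟨ψ.range, ⟨(MonoidHom.ofInjective hi).symm⟩⟩

lemma card_alt : 2 * Nat.card (alternatingGroup (Fin n)) = n.factorial := by
  haveI : Nontrivial (Fin n) := Fin.nontrivial_iff_two_le.2 (by omega)
  rw [Nat.card_eq_fintype_card, two_mul_card_alternatingGroup, Fintype.card_perm, Fintype.card_fin]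
end alt
end SP

namespace SP
open Equiv

lemma alpha_OO {N : Type*} [Group N] [Finite N] (α : MulAut N) {T : Subgroup N} (hT : IsPGroup 2 T)
    (h : ∀ m, m * (α m)⁻¹ ∈ T) : bar N α = 1 := by
  set D : Subgroup N := Subgroup.closure (Set.range fun m => m * (α m)⁻¹) with hD
  have hDT : D ≤ T := by
    rw [hD, Subgroup.closure_le]
    rintro _ ⟨m, rfl⟩
    exact h m
  have hg : ∀ m, m * (α m)⁻¹ ∈ D := fun m => Subgroup.subset_closure ⟨m, rfl⟩
  have hN : D.Normal := by
    constructor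
    intro x hx k
    have : D ≤ D.comap (MulAut.conj k : N →* N) := by
      nth_rw 1 [hD]
      rw [Subgroup.closure_le]
      rintro _ ⟨m, rfl⟩
      show k * (m * (α m)⁻¹) * k⁻¹ ∈ D
      have := mul_mem (hg (k * m)) (inv_mem (hg k))
      convert this using 1
      rw [map_mul]; group
    exact this hx
  have hO := le_OO hN (hT.to_le hDT)
  ext x
  obtain ⟨x, rfl⟩ := QuotientGroup.mk'_surjective _ x
  rw [bar_mk, MulAut.one_apply, eq_comm, ← mul_inv_eq_one, ← map_inv, ← map_mul]
  exact (QuotientGroup.eq_one_iff _).2 (hO (hg x))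

lemma inner_bar {n : ℕ} (hn : 5 ≤ n) {N : Type*} [Group N] [Finite N] (hcard : Nat.card N = n.factorial)
    (f : Perm (Fin n) →* MulAut N) : ∀ a ∈ alternatingGroup (Fin n), bar N (f a) ∈ (MulAut.conj : N ⧸ OO N →* _).range := by
  obtain ⟨σ, s1, z, hz, T, hT, hT2, hT3⟩ := getConcl n hn N hcard f
  have hα : bar N (MulAut.conj z.left * f σ) = 1 := by
    apply alpha_OO (T := T.comap SemidirectProduct.inl) _ (hT2.comap_of_injective _ SemidirectProduct.inl_injective)
    intro m
    have hm : (SemidirectProduct.inl m : N ⋊[f] Perm (Fin n)) ∈ (SemidirectProduct.rightHom : N ⋊[f] Perm (Fin n) →* _).ker := by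
      rw [MonoidHom.mem_ker]; simp
    have := hT3 _ hm
    rw [Subgroup.mem_comap]
    convert this using 1
    have hz' : z.right = σ := hz
    ext
    · simp [MulAut.mul_apply, hz', mul_assoc]
    · simp
  have hσ : bar N (f σ) ∈ (MulAut.conj : N ⧸ OO N →* _).range := by
    rw [map_mul, bar_conj] at hα
    rw [eq_inv_of_mul_eq_one_right hα]
    exact inv_mem ⟨_, rfl⟩
  haveI := inn_normal (B := N ⧸ OO N)
  have hA := Perm.alternatingGroup_le_of_normal (cardFin n hn)
    (N := (MulAut.conj : N ⧸ OO N →* _).range.comap ((bar N).comp f))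
    ⟨⟨⟨σ, hσ⟩, 1, fun h => s1 (congrArg Subtype.val h)⟩⟩
  exact fun a ha => hA ha

/-- If an action on `N` is trivial modulo a normal subgroup of order two then it is trivial on a perfect group. -/
lemma triv_of_bar {n : ℕ} (hn : 5 ≤ n) {N : Type*} [Group N] [Finite N] (hU : Nat.card (OO N) = 2)
    (ψ : alternatingGroup (Fin n) →* MulAut N) (h : ∀ a, bar N (ψ a) = 1) : ∀ a, ψ a = 1 := by
  obtain ⟨u, v, huv, hall⟩ := Nat.card_eq_two_iff.1 hU
  have htwo : ∀ x y : N, x ∈ OO N → y ∈ OO N → x ≠ 1 → y ≠ 1 → x = y := by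
    intro x y hx hy h1 h2
    have key : ∀ w : OO N, w = u ∨ w = v := fun w => by
      have : w ∈ ({u, v} : Set (OO N)) := by rw [hall]; trivial
      simpa using this
    have e0 := key 1
    have ex := key ⟨x, hx⟩
    have ey := key ⟨y, hy⟩
    have : (⟨x, hx⟩ : OO N) = ⟨y, hy⟩ := by
      have n1 : (⟨x, hx⟩ : OO N) ≠ 1 := fun e => h1 (congrArg Subtype.val e)
      have n2 : (⟨y, hy⟩ : OO N) ≠ 1 := fun e => h2 (congrArg Subtype.val e)
      rcases e0 with e0 | e0 <;> rcases ex with ex | ex <;> rcases ey with ey | ey <;>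
        first
        | (rw [ex, ey]; done)
        | (exact absurd (ex.trans e0.symm) n1)
        | (exact absurd (ey.trans e0.symm) n2)
    exact congrArg Subtype.val this
  have hfix : ∀ φ : MulAut N, ∀ x ∈ OO N, φ x = x := by
    intro φ x hx
    by_cases h1 : x = 1
    · rw [h1, map_one]
    · exact htwo _ _ (OO_char φ hx) hx (fun e => h1 ((map_eq_one_iff φ φ.injective).1 e)) h1
  have hm : ∀ a m, m⁻¹ * ψ a m ∈ OO N := by
    intro a m
    have h1 := congrArg (fun φ : MulAut (N ⧸ OO N) => φ (QuotientGroup.mk' (OO N) m)) (h a)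
    simp only [bar_mk, MulAut.one_apply] at h1
    exact QuotientGroup.eq.1 h1.symm
  apply perf hn
  have hcomp : ∀ a b m, ψ a (ψ b m) = m * ((m⁻¹ * ψ a m) * (m⁻¹ * ψ b m)) := by
    intro a b m
    have e : ψ b m = m * (m⁻¹ * ψ b m) := by group
    calc ψ a (ψ b m) = ψ a (m * (m⁻¹ * ψ b m)) := by rw [← e]
      _ = ψ a m * (m⁻¹ * ψ b m) := by rw [map_mul, hfix (ψ a) _ (hm b m)]
      _ = _ := by group
  intro a b
  ext m
  rw [MulAut.mul_apply, MulAut.mul_apply, hcomp, hcomp]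
  congr 1
  have h1 := hfix (MulAut.conj (m⁻¹ * ψ a m)) _ (hm b m)
  rw [MulAut.conj_apply] at h1
  exact mul_inv_eq_iff_eq_mul.1 h1
end SP

namespace SP
open Equiv

lemma final {n : ℕ} (hn : 5 ≤ n) {N : Type*} [Group N] [Finite N] (hcard : Nat.card N = n.factorial)
    (f : Perm (Fin n) →* MulAut N) (g : Perm (Fin n) → N) (hg : Function.Bijective g)
    (hfg : ∀ σ τ, g (σ * τ) = g σ * f σ (g τ)) :
    ∃ H : Subgroup N, Nonempty (H ≃* alternatingGroup (Fin n)) := by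
  have g1 : g 1 = 1 := by
    have := hfg 1 1
    rw [mul_one, map_one, MulAut.one_apply] at this
    exact (mul_eq_left.1 this.symm)
  let h : Perm (Fin n) →* MulAut N := MonoidHom.mk' (fun s => MulAut.conj (g s) * f s) (by
    intro a b
    rw [hfg, map_mul, map_mul, ← conj_eq]
    group)
  have hh : ∀ s, h s = MulAut.conj (g s) * f s := fun s => rfl
  have hfI := inner_bar hn hcard f
  have hhI := inner_bar hn hcard h
  set q := QuotientGroup.mk' (OO N) with hq
  have hqs : Function.Surjective q := QuotientGroup.mk'_surjective _
  have hbh : ∀ s, bar N (h s) = MulAut.conj (q (g s)) * bar N (f s) := fun s => by rw [hh, map_mul, bar_conj]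
  let Fa : alternatingGroup (Fin n) →* MulAut (N ⧸ OO N) := ((bar N).comp f).comp (alternatingGroup (Fin n)).subtype
  let Ha : alternatingGroup (Fin n) →* MulAut (N ⧸ OO N) := ((bar N).comp h).comp (alternatingGroup (Fin n)).subtype
  have hFI : ∀ a, Fa a ∈ (MulAut.conj : N ⧸ OO N →* _).range := fun a => hfI a a.2
  have hHI : ∀ a, Ha a ∈ (MulAut.conj : N ⧸ OO N →* _).range := fun a => hhI a a.2
  have hA := card_alt hn
  have hUq : Nat.card N = Nat.card (N ⧸ OO N) * Nat.card (OO N) := Subgroup.card_eq_card_quotient_mul_card_subgroup _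
  have h3n : 3 ∣ n.factorial := Nat.prime_three.dvd_factorial.2 (by omega)
  -- one of the two restrictions is injective
  have hinj : Function.Injective Fa ∨ Function.Injective Ha := by
    rcases inj_or hn Fa with h1 | h1
    · exact Or.inl h1
    rcases inj_or hn Ha with h2 | h2
    · exact Or.inr h2
    exfalso
    have hF1 : ∀ a : alternatingGroup (Fin n), bar N (f a) = 1 := h1
    have hH1 : ∀ a : alternatingGroup (Fin n), bar N (h a) = 1 := h2
    have hcen : ∀ a : alternatingGroup (Fin n), q (g a) ∈ Subgroup.center (N ⧸ OO N) := by
      intro a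
      apply conj_one
      have := hbh a
      rw [hF1, hH1, mul_one] at this
      exact this.symm
    let ψ : alternatingGroup (Fin n) →* N ⧸ OO N := MonoidHom.mk' (fun a => q (g a)) (by
      intro a b
      show q (g ((a : Perm (Fin n)) * b)) = _
      rw [hfg, map_mul, ← bar_mk, hF1]; rfl)
    have hψ := perf hn ψ (fun a b => (Subgroup.mem_center_iff.1 (hcen b) (ψ a)))
    have hle : Nat.card (alternatingGroup (Fin n)) ≤ Nat.card (OO N) := by
      refine Nat.card_le_card_of_injective (fun a : alternatingGroup (Fin n) => (⟨g a, (QuotientGroup.eq_one_iff _).1 (hψ a)⟩ : OO N)) ?_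
      intro a b e
      exact Subtype.ext (hg.1 (congrArg Subtype.val e))
    obtain ⟨k, hk⟩ := (IsPGroup.iff_card (p := 2)).1 (OO_pgroup (N := N))
    have hpos : 0 < Nat.card (OO N) := Nat.card_pos
    have hq2 : Nat.card (N ⧸ OO N) ≤ 2 := by
      by_contra hlt
      rw [not_le] at hlt
      have := Nat.mul_le_mul_right (Nat.card (OO N)) (Nat.succ_le_of_lt hlt)
      simp only [Nat.succ_eq_add_one] at this
      omega
    rw [← hcard, hUq, Nat.prime_three.dvd_mul] at h3n
    rcases h3n with h3n | h3n
    · have := Nat.le_of_dvd Nat.card_pos h3n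
      omega
    · rw [hk] at h3n
      have := Nat.prime_three.dvd_of_dvd_pow h3n
      omega
  have hbound : Nat.card (alternatingGroup (Fin n)) * Nat.card (Subgroup.center (N ⧸ OO N)) ≤ Nat.card (N ⧸ OO N) := by
    rcases hinj with h1 | h1
    · exact inn_card Fa h1 hFI
    · exact inn_card Ha h1 hHI
  have hA0 : 0 < Nat.card (alternatingGroup (Fin n)) := Nat.card_pos
  have hzu : Nat.card (Subgroup.center (N ⧸ OO N)) * Nat.card (OO N) ≤ 2 := by
    have h1 := Nat.mul_le_mul_right (Nat.card (OO N)) hbound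
    rw [← hUq, hcard, ← hA, mul_assoc, mul_comm 2] at h1
    exact Nat.le_of_mul_le_mul_left h1 hA0
  have hz0 : 0 < Nat.card (Subgroup.center (N ⧸ OO N)) := Nat.card_pos
  have hu0 : 0 < Nat.card (OO N) := Nat.card_pos
  have hU12 : Nat.card (OO N) = 1 ∨ Nat.card (OO N) = 2 := by
    have : Nat.card (OO N) ≤ 2 := le_trans (Nat.le_mul_of_pos_left _ hz0) hzu
    omega
  rcases hU12 with hU | hU
  · -- trivial core
    have hbot : OO N = ⊥ := Subgroup.card_eq_one.1 hU
    have hqi : Function.Injective q := by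
      rw [← MonoidHom.ker_eq_bot_iff, hq, QuotientGroup.ker_mk', hbot]
    let e : N ≃* N ⧸ OO N := MulEquiv.ofBijective q ⟨hqi, hqs⟩
    have hZ : Subgroup.center (N ⧸ OO N) = ⊥ := by
      have hp2 : IsPGroup 2 (Subgroup.center N) := by
        have h1 : Nat.card (Subgroup.center N) = Nat.card (Subgroup.center (N ⧸ OO N)) :=
          Nat.card_congr (Subgroup.centerCongr e).toEquiv
        have h2 : Nat.card (Subgroup.center N) = 2 ^ 0 ∨ Nat.card (Subgroup.center N) = 2 ^ 1 := by
          rw [hU, mul_one] at hzu; omega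
        rcases h2 with h2 | h2 <;> exact IsPGroup.of_card h2
      have h3 := le_OO (inferInstance : (Subgroup.center N).Normal) hp2
      rw [hbot, le_bot_iff] at h3
      rw [← Subgroup.card_eq_one, ← Nat.card_congr (Subgroup.centerCongr e).toEquiv, h3]
      simp
    have hgen : ∀ ψ : alternatingGroup (Fin n) →* MulAut (N ⧸ OO N), Function.Injective ψ →
        (∀ a, ψ a ∈ (MulAut.conj : N ⧸ OO N →* _).range) → ∃ H : Subgroup N, Nonempty (H ≃* alternatingGroup (Fin n)) := by
      intro ψ hi hr
      obtain ⟨φ, hφ⟩ := lift_inn hZ ψ hr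
      apply fin_of_hom hn (e.symm.toMonoidHom.comp φ)
      intro a b hab
      have : φ a = φ b := e.symm.injective hab
      apply hi
      rw [hφ, hφ, this]
    rcases hinj with h1 | h1
    · exact hgen Fa h1 hFI
    · exact hgen Ha h1 hHI
  · have hZ : Subgroup.center (N ⧸ OO N) = ⊥ := by
      rw [← Subgroup.card_eq_one]
      rw [hU] at hzu; omega
    obtain ⟨φ, hφ⟩ := lift_inn hZ Fa hFI
    obtain ⟨χ, hχ⟩ := lift_inn hZ Ha hHI
    rcases inj_or hn φ with hφi | hφ1
    swap
    · -- f is trivial on the alternating group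
      have ht := triv_of_bar hn hU (f.comp (alternatingGroup (Fin n)).subtype) (fun a => by
        have := hφ a
        rw [hφ1, map_one] at this
        exact this)
      refine fin_of_hom hn (MonoidHom.mk' (fun a => g a) ?_) ?_
      · intro a b
        show g ((a : Perm (Fin n)) * b) = _
        have : f a = 1 := ht a
        rw [hfg, this]; rfl
      · intro a b hab
        exact Subtype.ext (hg.1 hab)
    rcases inj_or hn χ with hχi | hχ1
    swap
    · have ht := triv_of_bar hn hU (h.comp (alternatingGroup (Fin n)).subtype) (fun a => by
        have := hχ a
        rw [hχ1, map_one] at this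
        exact this)
      refine fin_of_hom hn (MonoidHom.mk' (fun a => (g a)⁻¹) ?_) ?_
      · intro a b
        show (g ((a : Perm (Fin n)) * b))⁻¹ = _
        have h1 : h a = 1 := ht a
        have h2 : f a (g b) = (g a)⁻¹ * g b * g a := by
          have := congrArg (fun φ : MulAut N => φ (g b)) h1
          simp only [hh, MulAut.mul_apply, MulAut.conj_apply, MulAut.one_apply] at this
          have e2 := mul_inv_eq_iff_eq_mul.1 this
          rw [mul_assoc, ← e2, inv_mul_cancel_left]
        rw [hfg, h2]; group
      · intro a b hab
        exact Subtype.ext (hg.1 (inv_injective hab))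
    exfalso
    have hcq : Nat.card (alternatingGroup (Fin n)) = Nat.card (N ⧸ OO N) := by
      rw [hU, hcard, ← hA] at hUq; omega
    have hφb : Function.Bijective φ := (Nat.bijective_iff_injective_and_card φ).2 ⟨hφi, hcq⟩
    have hχb : Function.Bijective χ := (Nat.bijective_iff_injective_and_card χ).2 ⟨hχi, hcq⟩
    let eφ := MulEquiv.ofBijective φ hφb
    let eχ := MulEquiv.ofBijective χ hχb
    let θ : alternatingGroup (Fin n) ≃* alternatingGroup (Fin n) := eχ.trans eφ.symm
    have hθ : ∀ a, φ (θ a) = χ a := fun a => eφ.apply_symm_apply (eχ a)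
    obtain ⟨x, b, hx3, hxb⟩ := classFix hn θ
    have hAn : ∀ (s : Perm (Fin n)) (a : alternatingGroup (Fin n)), s * a * s⁻¹ ∈ alternatingGroup (Fin n) :=
      fun s a => (inferInstance : (alternatingGroup (Fin n)).Normal).conj_mem a a.2 s
    have hga : ∀ a : alternatingGroup (Fin n), q (g a) = χ a * (φ a)⁻¹ := by
      intro a
      have h1 := hbh a
      have h2 : bar N (h a) = MulAut.conj (χ a) := hχ a
      have h3 : bar N (f a) = MulAut.conj (φ a) := hφ a
      rw [h2, h3, ← map_mul] at h1
      rw [conj_inj hZ h1]; group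
    have hfs : ∀ (s : Perm (Fin n)) (a : alternatingGroup (Fin n)), bar N (f s) (φ a) = φ ⟨s * a * s⁻¹, hAn s a⟩ := by
      intro s a
      apply conj_inj hZ
      rw [← conj_eq, ← hφ, ← hφ]
      show _ = bar N (f (s * a * s⁻¹))
      rw [map_mul, map_mul, map_mul, map_mul, map_inv, map_inv]; rfl
    have hhs : ∀ (s : Perm (Fin n)) (a : alternatingGroup (Fin n)), bar N (h s) (χ a) = χ ⟨s * a * s⁻¹, hAn s a⟩ := by
      intro s a
      apply conj_inj hZ
      rw [← conj_eq, ← hχ, ← hχ]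
      show _ = bar N (h (s * a * s⁻¹))
      rw [map_mul, map_mul, map_mul, map_mul, map_inv, map_inv]; rfl
    -- choose s with image of g s equal to the inverse of φ b
    obtain ⟨m, hm⟩ := hqs (φ b)⁻¹
    obtain ⟨s, rfl⟩ := hg.2 m
    -- the element y = s⁻¹ x s is fixed
    set y : alternatingGroup (Fin n) := ⟨s⁻¹ * x * s⁻¹⁻¹, hAn s⁻¹ x⟩ with hy
    have hyx : (⟨s * y * s⁻¹, hAn s y⟩ : alternatingGroup (Fin n)) = x := by
      apply Subtype.ext
      show s * (s⁻¹ * x * s⁻¹⁻¹) * s⁻¹ = (x : Perm (Fin n))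
      group
    have hfy : χ y = φ y := by
      apply (bar N (f s)).injective
      rw [hfs, hyx]
      have h1 := hhs s y
      rw [hyx, hbh, MulAut.mul_apply, MulAut.conj_apply, hm] at h1
      have h2 : bar N (f s) (χ y) = φ b * χ x * (φ b)⁻¹ := by rw [← h1]; group
      rw [h2, ← hθ, ← map_inv, ← map_mul, ← map_mul, hxb]
    have hoy : orderOf y = orderOf x := by
      rw [← Subgroup.orderOf_coe, ← Subgroup.orderOf_coe]
      show orderOf (s⁻¹ * x * s⁻¹⁻¹) = _
      have := MulEquiv.orderOf_eq (MulAut.conj s⁻¹) (x : Perm (Fin n))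
      rwa [MulAut.conj_apply] at this
    have hmem : ∀ k : ℕ, g ((y ^ k : alternatingGroup (Fin n)) : Perm (Fin n)) ∈ OO N := by
      intro k
      apply (QuotientGroup.eq_one_iff _).1
      show q _ = 1
      rw [hga, map_pow, map_pow, hfy]; group
    have hc3 : Nat.card (Fin 3) ≤ Nat.card (OO N) := by
      refine Nat.card_le_card_of_injective (fun k : Fin 3 => (⟨g ((y ^ (k : ℕ) : alternatingGroup (Fin n)) : Perm (Fin n)), hmem k⟩ : OO N)) ?_
      intro i j hij
      have h1 : y ^ (i : ℕ) = y ^ (j : ℕ) := Subtype.ext (hg.1 (congrArg Subtype.val hij))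
      have := pow_injOn_Iio_orderOf (x := y) (by show (i : ℕ) < _; omega) (by show (j : ℕ) < _; omega) h1
      exact Fin.ext this
    simp at hc3
    omega
end SP

theorem stmt_6 (n : ℕ) (hn : 5 ≤ n) (N : Type*) [Group N]
    (hcard : Nat.card N = n.factorial)
    (f : Equiv.Perm (Fin n) →* MulAut N) (g : Equiv.Perm (Fin n) → N)
    (hg : Function.Bijective g)
    (hfg : ∀ σ τ : Equiv.Perm (Fin n), g (σ * τ) = g σ * f σ (g τ)) :
    ∃ H : Subgroup N, Nonempty (H ≃* alternatingGroup (Fin n)) := by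
  haveI : Finite N := Nat.finite_of_card_ne_zero (by rw [hcard]; exact n.factorial_ne_zero)
  exact SP.final hn hcard f g hg hfg
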